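/- arXiv:2503.06851 — 2 statements merged into one kernel-verified Lean document; each statement's English description precedes it below -/
import Mathlib

section
/- For every positive integer d there exist a compact metric space (𝒳, 𝐝) and a continuous action T : ℝ^d × 𝒳 → 𝒳 satisfying both of the following: (i) for every ergodic ν ∈ M^T(𝒳), rdim(𝒳,T,𝐝,ν) exists and equals 0; (ii) there exists μ ∈ M^T(𝒳) with rdim(𝒳,T,𝐝,μ) = ∞, i.e. R(𝐝,μ,ε)/log(1/ε) → ∞ as ε → 0. -/
open MeasureTheory Filter Set
open scoped ENNReal Topology NNReal

noncomputable section

/-- Shannon entropy (base 2) of a finitely-valued random variable. -/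
def shannonEntropy {Ω S : Type*} [MeasurableSpace Ω] [Fintype S]
    (P : Measure Ω) (f : Ω → S) : ℝ :=
  -∑ i : S, ((P (f ⁻¹' {i})).toReal * Real.logb 2 ((P (f ⁻¹' {i})).toReal))

/-- Mutual information (base 2) of two random variables, defined as the supremum over all
finite measurable partitions (encoded as measurable maps into `Fin n`) of
`H(α∘X) + H(β∘Y) - H(α∘X, β∘Y)`. -/
def mutualInfo {Ω A B : Type*} [MeasurableSpace Ω] [MeasurableSpace A] [MeasurableSpace B]
    (P : Measure Ω) (X : Ω → A) (Y : Ω → B) : ℝ≥0∞ :=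
  ⨆ (n : ℕ) (m : ℕ) (α : A → Fin n) (_ : Measurable α) (β : B → Fin m) (_ : Measurable β),
    ENNReal.ofReal (shannonEntropy P (fun ω => α (X ω)) + shannonEntropy P (fun ω => β (Y ω))
      - shannonEntropy P (fun ω => (α (X ω), β (Y ω))))

/-- The box `[0,L)^d ⊆ ℝ^d`. -/
def unitBox (d : ℕ) (L : ℝ) : Set (Fin d → ℝ) := Set.univ.pi fun _ => Set.Ico (0 : ℝ) L

/-- Lebesgue measure on `ℝ^d` restricted to the box `[0,L)^d`. -/
def boxMeasure (d : ℕ) (L : ℝ) : Measure (Fin d → ℝ) := volume.restrict (unitBox d L)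

/-- The space `L¹([0,L)^d, X)` of measurable maps modulo a.e. equality. -/
abbrev L1Maps (d : ℕ) (L : ℝ) (X : Type*) [TopologicalSpace X] :=
  (Fin d → ℝ) →ₘ[boxMeasure d L] X

/-- The `L¹` distance `D(f,g) = ∫_{[0,L)^d} 𝐝(f(u), g(u)) dm(u)`. -/
def L1dist {d : ℕ} {L : ℝ} {X : Type*} [MetricSpace X] (f g : L1Maps d L X) : ℝ :=
  ∫ u, dist (f u) (g u) ∂(boxMeasure d L)

/-- The Borel σ-algebra of the metric `L1dist` on `L¹([0,L)^d, X)`,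
generated by the open balls of the metric. -/
instance L1Maps.measurableSpace {d : ℕ} {L : ℝ} {X : Type*} [MetricSpace X] :
    MeasurableSpace (L1Maps d L X) :=
  MeasurableSpace.generateFrom {s | ∃ (f : L1Maps d L X) (r : ℝ), s = {g | L1dist f g < r}}

/-- The expected mean distortion `E[(1/L^d) ∫_{[0,L)^d} 𝐝(T^u X, Y_u) dm(u)]`. -/
def distortion {X : Type*} [MetricSpace X] (d : ℕ) (T : (Fin d → ℝ) → X → X) (L : ℝ)
    {Ω : Type*} [MeasurableSpace Ω] (P : Measure Ω) (Xv : Ω → X) (Yv : Ω → L1Maps d L X) : ℝ :=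
  ∫ ω, (L ^ d)⁻¹ * ∫ u, dist (T u (Xv ω)) (Yv ω u) ∂(boxMeasure d L) ∂P

/-- `R_L(𝐝, μ, ε)`: the infimum of `I(X;Y)` over all pairs of random variables on a common
probability space with `Law X = μ`, `Y` taking values in `L¹([0,L)^d, X)` and expected mean
distortion `< ε`. -/
def RL {X : Type*} [MetricSpace X] [MeasurableSpace X] (d : ℕ)
    (T : (Fin d → ℝ) → X → X) (μ : Measure X) (L ε : ℝ) : ℝ≥0∞ :=
  ⨅ (Ω : Type) (_ : MeasurableSpace Ω) (P : Measure Ω) (_ : IsProbabilityMeasure P)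
    (Xv : Ω → X) (Yv : Ω → L1Maps d L X) (_ : Measurable Xv) (_ : Measurable Yv)
    (_ : Measure.map Xv P = μ) (_ : distortion d T L P Xv Yv < ε),
    mutualInfo P Xv Yv

/-- The rate distortion function `R(𝐝, μ, ε) = lim_{L→∞} R_L(𝐝, μ, ε)/L^d`, which exists and
equals `inf_{L>0} R_L(𝐝, μ, ε)/L^d`. -/
def RD {X : Type*} [MetricSpace X] [MeasurableSpace X] (d : ℕ)
    (T : (Fin d → ℝ) → X → X) (μ : Measure X) (ε : ℝ) : ℝ≥0∞ :=
  ⨅ (L : ℝ) (_ : 0 < L), RL d T μ L ε / ENNReal.ofReal (L ^ d)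

/-- Upper rate distortion dimension. -/
def urdim {X : Type*} [MetricSpace X] [MeasurableSpace X] (d : ℕ)
    (T : (Fin d → ℝ) → X → X) (μ : Measure X) : ℝ≥0∞ :=
  Filter.limsup (fun ε : ℝ => RD d T μ ε / ENNReal.ofReal (Real.logb 2 (1 / ε))) (𝓝[>] (0 : ℝ))

/-- Lower rate distortion dimension. -/
def lrdim {X : Type*} [MetricSpace X] [MeasurableSpace X] (d : ℕ)
    (T : (Fin d → ℝ) → X → X) (μ : Measure X) : ℝ≥0∞ :=
  Filter.liminf (fun ε : ℝ => RD d T μ ε / ENNReal.ofReal (Real.logb 2 (1 / ε))) (𝓝[>] (0 : ℝ))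

/-- `μ` is invariant under the `ℝ^d`-action `T`. -/
def MeasInvariant {X : Type*} [MeasurableSpace X] (d : ℕ)
    (T : (Fin d → ℝ) → X → X) (μ : Measure X) : Prop :=
  ∀ u : Fin d → ℝ, Measure.map (T u) μ = μ

/-- `T` is a continuous action of the additive group `ℝ^d`. -/
def IsContAction {X : Type*} [TopologicalSpace X] (d : ℕ) (T : (Fin d → ℝ) → X → X) : Prop :=
  Continuous (fun p : (Fin d → ℝ) × X => T p.1 p.2) ∧ (∀ x, T 0 x = x) ∧
    ∀ u v x, T (u + v) x = T u (T v x)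

/-- The metric `𝐝_L(x,y) = sup_{u ∈ [0,L)^d} 𝐝(T^u x, T^u y)`. -/
def dSup {X : Type*} [MetricSpace X] (d : ℕ) (T : (Fin d → ℝ) → X → X) (L : ℝ) (x y : X) : ℝ :=
  ⨆ u : unitBox d L, dist (T u.1 x) (T u.1 y)

/-- The `ε`-covering number of `X` for the (pre)metric `ρ`: the minimal number of open sets
of `ρ`-diameter `< ε` covering `X`. -/
def covNum (X : Type*) [TopologicalSpace X] (ρ : X → X → ℝ) (ε : ℝ) : ℕ :=
  sInf {n : ℕ | ∃ F : Finset (Set X), F.card = n ∧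
    (∀ U ∈ F, IsOpen U ∧ (⨆ x ∈ U, ⨆ y ∈ U, ENNReal.ofReal (ρ x y)) < ENNReal.ofReal ε) ∧
    ⋃₀ (F : Set (Set X)) = Set.univ}

/-- The entropy at scale `ε`: `S(X,T,𝐝,ε) = lim_{L→∞} log₂ #(X, 𝐝_L, ε) / L^d`
(the limit exists, hence equals the limsup used here). -/
def entScale {X : Type*} [MetricSpace X] (d : ℕ) (T : (Fin d → ℝ) → X → X) (ε : ℝ) : ℝ≥0∞ :=
  Filter.limsup
    (fun L : ℝ => ENNReal.ofReal (Real.logb 2 (covNum X (dSup d T L) ε) / L ^ d)) Filter.atTop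

/-- The upper metric mean dimension. -/
def umdim {X : Type*} [MetricSpace X] (d : ℕ) (T : (Fin d → ℝ) → X → X) : ℝ≥0∞ :=
  Filter.limsup (fun ε : ℝ => entScale d T ε / ENNReal.ofReal (Real.logb 2 (1 / ε))) (𝓝[>] (0 : ℝ))

/-- The σ-algebra on the space of Borel probability measures on `X` (for a compact metric `X`
this is the Borel σ-algebra of the weak* topology). -/
instance ProbabilityMeasure.measurableSpace' {α : Type*} [MeasurableSpace α] :
    MeasurableSpace (ProbabilityMeasure α) :=
  inferInstanceAs (MeasurableSpace {μ : Measure α // IsProbabilityMeasure μ})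

/-- The space `M^T(X)` of `T`-invariant Borel probability measures on `X`. -/
abbrev InvM (X : Type*) [MeasurableSpace X] [MetricSpace X] (d : ℕ)
    (T : (Fin d → ℝ) → X → X) :=
  {ν : ProbabilityMeasure X // MeasInvariant d T (ν : Measure X)}

end

/-- `μ` is ergodic for the action `T`: there is no `T`-invariant Borel set of measure
strictly between `0` and `1`. -/
def MeasErgodic {X : Type*} [MeasurableSpace X] (d : ℕ)
    (T : (Fin d → ℝ) → X → X) (μ : Measure X) : Prop :=
  ∀ A : Set X, MeasurableSet A → (∀ u : Fin d → ℝ, T u ⁻¹' A = A) → μ A = 0 ∨ μ A = 1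


open MeasureTheory Filter Set
open scoped ENNReal Topology NNReal

namespace RDProof

/-! ### Finite information theory -/

lemma shannonEntropy_eq {Ω S : Type*} [MeasurableSpace Ω] [Fintype S]
    (P : Measure Ω) (f : Ω → S) :
    shannonEntropy P f = (∑ i : S, Real.negMulLog (P.real (f ⁻¹' {i}))) / Real.log 2 := by
  unfold shannonEntropy Real.negMulLog Real.logb Measure.real
  rw [Finset.sum_div, ← Finset.sum_neg_distrib]
  refine Finset.sum_congr rfl fun i _ => ?_
  ring

lemma sum_real_fiber {Ω S : Type*} [MeasurableSpace Ω] [Fintype S]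
    [MeasurableSpace S] [MeasurableSingletonClass S]
    (P : Measure Ω) [IsProbabilityMeasure P] {f : Ω → S} (hf : Measurable f)
    (A : Set Ω) (hA : MeasurableSet A) :
    ∑ i, P.real (A ∩ f ⁻¹' {i}) = P.real A := by
  rw [← measureReal_biUnion_finset]
  · congr 1
    ext ω
    simp
  · intro i _ j _ hij
    refine Disjoint.mono inter_subset_right inter_subset_right ?_
    exact Disjoint.preimage f (by simpa using hij)
  · intro i _
    exact hA.inter (hf (measurableSet_singleton i))

lemma dv_finite {S S' : Type*} [Fintype S] [Fintype S'] (π : S → S' → ℝ) (p : S → ℝ) (q : S' → ℝ)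
    (hπ : ∀ a b, 0 ≤ π a b) (hp : ∀ a, ∑ b, π a b = p a) (hq : ∀ b, ∑ a, π a b = q b)
    (h1 : ∑ b, q b = 1) (g : S → S' → ℝ)
    (hg : ∀ b, 0 < q b → ∑ a, p a * Real.exp (g a b) ≤ 1) :
    ∑ a, ∑ b, π a b * g a b ≤
      ∑ a, Real.negMulLog (p a) + ∑ b, Real.negMulLog (q b)
        - ∑ a, ∑ b, Real.negMulLog (π a b) := by
  have hp0 : ∀ a, 0 ≤ p a := fun a => by
    rw [← hp]; exact Finset.sum_nonneg fun b _ => hπ a b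
  have hq0 : ∀ a, 0 ≤ q a := fun a => by
    rw [← hq]; exact Finset.sum_nonneg fun b _ => hπ b a
  have key : ∀ a b, π a b - p a * q b * Real.exp (g a b) ≤
      π a b * (Real.log (π a b) - Real.log (p a) - Real.log (q b) - g a b) := by
    intro a b
    rcases (hπ a b).eq_or_lt with h | h
    · rw [← h]
      simp only [zero_sub, zero_mul, Left.neg_nonpos_iff]
      have := hp0 a
      have := hq0 b
      positivity
    · have hpa : 0 < p a := by
        rw [← hp]
        exact lt_of_lt_of_le h (Finset.single_le_sum (f := fun b => π a b)
          (fun b _ => hπ a b) (Finset.mem_univ b))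
      have hqb : 0 < q b := by
        rw [← hq]
        exact lt_of_lt_of_le h (Finset.single_le_sum (f := fun a => π a b)
          (fun a _ => hπ a b) (Finset.mem_univ a))
      set t := p a * q b * Real.exp (g a b) / π a b with ht
      have htpos : 0 < t := by positivity
      have hlog := Real.log_le_sub_one_of_pos htpos
      have e : Real.log t = Real.log (p a) + Real.log (q b) + g a b - Real.log (π a b) := by
        rw [ht, Real.log_div (by positivity) (by positivity),
          Real.log_mul (by positivity) (by positivity),
          Real.log_mul (by positivity) (by positivity), Real.log_exp]
      rw [e] at hlog
      have h2 : π a b * t = p a * q b * Real.exp (g a b) := by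
        rw [ht]; field_simp
      nlinarith
  have s1 : ∑ a, ∑ b, (π a b - p a * q b * Real.exp (g a b)) ≤
      ∑ a, ∑ b, π a b * (Real.log (π a b) - Real.log (p a) - Real.log (q b) - g a b) :=
    Finset.sum_le_sum fun a _ => Finset.sum_le_sum fun b _ => key a b
  have s2 : 0 ≤ ∑ a, ∑ b, (π a b - p a * q b * Real.exp (g a b)) := by
    rw [Finset.sum_comm]
    refine Finset.sum_nonneg fun b _ => ?_
    rw [Finset.sum_sub_distrib, hq]
    have : ∑ a, p a * q b * Real.exp (g a b) = q b * ∑ a, p a * Real.exp (g a b) := by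
      rw [Finset.mul_sum]; exact Finset.sum_congr rfl fun a _ => by ring
    rw [this]
    rcases (hq0 b).eq_or_lt with h | h
    · simp [← h]
    · nlinarith [hg b h]
  have e1 : ∑ a, Real.negMulLog (p a) = ∑ a, ∑ b, - π a b * Real.log (p a) := by
    refine Finset.sum_congr rfl fun a _ => ?_
    rw [← Finset.sum_mul, Finset.sum_neg_distrib, hp, Real.negMulLog]
  have e2 : ∑ b, Real.negMulLog (q b) = ∑ a, ∑ b, - π a b * Real.log (q b) := by
    rw [Finset.sum_comm]
    refine Finset.sum_congr rfl fun a _ => ?_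
    rw [← Finset.sum_mul, Finset.sum_neg_distrib, hq, Real.negMulLog]
  have e3 : ∑ a, ∑ b, π a b * (Real.log (π a b) - Real.log (p a) - Real.log (q b) - g a b)
      = ∑ a, Real.negMulLog (p a) + ∑ b, Real.negMulLog (q b)
        - ∑ a, ∑ b, Real.negMulLog (π a b) - ∑ a, ∑ b, π a b * g a b := by
    rw [e1, e2]
    simp only [← Finset.sum_add_distrib, ← Finset.sum_sub_distrib]
    refine Finset.sum_congr rfl fun a _ => Finset.sum_congr rfl fun b _ => ?_
    rw [Real.negMulLog]; ring
  linarith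

lemma sum_negMulLog_le {S : Type*} [Fintype S] (q : S → ℝ) (hq : ∀ b, 0 ≤ q b)
    (h1 : ∑ b, q b = 1) (t : Finset S) (ht : ∀ b ∉ t, q b = 0) (N : ℕ) (hN : t.card ≤ N) :
    ∑ b, Real.negMulLog (q b) ≤ Real.log N := by
  have hsum : ∑ b ∈ t, q b = 1 := by
    rw [← h1]; exact Finset.sum_subset (Finset.subset_univ t) fun b _ hb => ht b hb
  have hNpos : 0 < N := by
    rcases Nat.eq_zero_or_pos N with h | h
    · subst h
      have : t = ∅ := by simpa using hN
      simp [this] at hsum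
    · exact h
  have hN' : (0 : ℝ) < N := by exact_mod_cast hNpos
  have e : ∑ b, Real.negMulLog (q b) = ∑ b ∈ t, Real.negMulLog (q b) := by
    symm
    exact Finset.sum_subset (Finset.subset_univ t) fun b _ hb => by rw [ht b hb]; simp
  rw [e]
  have key : ∀ b, Real.negMulLog (q b) ≤ q b * Real.log N + ((N : ℝ)⁻¹ - q b) := by
    intro b
    rcases (hq b).eq_or_lt with h | h
    · rw [← h]; simp
    · have hl := Real.log_le_sub_one_of_pos (show 0 < (N : ℝ)⁻¹ / q b by positivity)
      rw [Real.log_div (by positivity) (by positivity), Real.log_inv] at hl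
      have h2 : q b * ((N : ℝ)⁻¹ / q b) = (N : ℝ)⁻¹ := by field_simp
      rw [Real.negMulLog]
      nlinarith
  calc ∑ b ∈ t, Real.negMulLog (q b) ≤ ∑ b ∈ t, (q b * Real.log N + ((N : ℝ)⁻¹ - q b)) :=
        Finset.sum_le_sum fun b _ => key b
    _ = Real.log N + (t.card * (N : ℝ)⁻¹ - 1) := by
        rw [Finset.sum_add_distrib, Finset.sum_sub_distrib, ← Finset.sum_mul, hsum]; simp
    _ ≤ Real.log N := by
        have : (t.card : ℝ) * (N : ℝ)⁻¹ ≤ 1 := by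
          rw [← div_eq_mul_inv, div_le_one hN']; exact_mod_cast hN
        linarith

lemma sum_negMulLog_marginal {S S' : Type*} [Fintype S] [Fintype S'] (π : S → S' → ℝ) (p : S → ℝ)
    (hπ : ∀ a b, 0 ≤ π a b) (hp : ∀ a, ∑ b, π a b = p a) :
    ∑ a, Real.negMulLog (p a) ≤ ∑ a, ∑ b, Real.negMulLog (π a b) := by
  refine Finset.sum_le_sum fun a _ => ?_
  have : Real.negMulLog (p a) = ∑ b, - π a b * Real.log (p a) := by
    rw [← Finset.sum_mul, Finset.sum_neg_distrib, hp, Real.negMulLog]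
  rw [this]
  refine Finset.sum_le_sum fun b _ => ?_
  rw [Real.negMulLog]
  rcases (hπ a b).eq_or_lt with h | h
  · simp [← h]
  · have : π a b ≤ p a := by
      rw [← hp]
      exact (Finset.single_le_sum (f := fun b => π a b)
          (fun b _ => hπ a b) (Finset.mem_univ b))
    have := Real.log_le_log h this
    nlinarith

/-- data of two finitely valued random variables -/
lemma entropy_pair {Ω S S' : Type*} [MeasurableSpace Ω] [Fintype S] [Fintype S']
    (P : Measure Ω) (f : Ω → S) (g : Ω → S') :
    shannonEntropy P f + shannonEntropy P g - shannonEntropy P (fun ω => (f ω, g ω)) =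
    (∑ a, Real.negMulLog (P.real (f ⁻¹' {a})) + ∑ b, Real.negMulLog (P.real (g ⁻¹' {b}))
        - ∑ a, ∑ b, Real.negMulLog (P.real (f ⁻¹' {a} ∩ g ⁻¹' {b}))) / Real.log 2 := by
  rw [shannonEntropy_eq, shannonEntropy_eq, shannonEntropy_eq, Fintype.sum_prod_type]
  have : ∀ a b, (fun ω => (f ω, g ω)) ⁻¹' {(a, b)} = f ⁻¹' {a} ∩ g ⁻¹' {b} := by
    intro a b; ext ω; simp
  simp only [this]
  ring

lemma mutualInfo_le {Ω A B : Type*} [MeasurableSpace Ω] [MeasurableSpace A] [MeasurableSpace B]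
    (P : Measure Ω) [IsProbabilityMeasure P] {X : Ω → A} {Y : Ω → B}
    (hX : Measurable X) (hY : Measurable Y)
    (ι : Type*) [Fintype ι] (κ : Ω → ι) (r : ι → B) (hr : ∀ ω, Y ω = r (κ ω)) :
    mutualInfo P X Y ≤ ENNReal.ofReal (Real.logb 2 (Fintype.card ι)) := by
  classical
  unfold mutualInfo
  refine iSup_le fun n => iSup_le fun m => iSup_le fun α => iSup_le fun hα =>
    iSup_le fun β => iSup_le fun hβ => ENNReal.ofReal_le_ofReal ?_
  rw [entropy_pair, Real.logb]
  have hl2 : 0 < Real.log 2 := Real.log_pos one_lt_two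
  refine div_le_div_of_nonneg_right ?_ hl2.le
  have hf : Measurable (fun ω => α (X ω)) := hα.comp hX
  have hg : Measurable (fun ω => β (Y ω)) := hβ.comp hY
  have m1 := sum_negMulLog_marginal
    (fun a b => P.real ((fun ω => α (X ω)) ⁻¹' {a} ∩ (fun ω => β (Y ω)) ⁻¹' {b}))
    (fun a => P.real ((fun ω => α (X ω)) ⁻¹' {a})) (fun _ _ => measureReal_nonneg)
    (fun a => sum_real_fiber P hg _ (hf (measurableSet_singleton a)))
  have m2 := sum_negMulLog_le (fun b => P.real ((fun ω => β (Y ω)) ⁻¹' {b}))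
    (fun _ => measureReal_nonneg)
    (by simpa using sum_real_fiber P hg univ MeasurableSet.univ)
    (Finset.univ.image fun i => β (r i))
    (by
      intro b hb
      have : (fun ω => β (Y ω)) ⁻¹' {b} = ∅ := by
        ext ω
        simp only [mem_preimage, mem_singleton_iff, mem_empty_iff_false, iff_false]
        intro h
        apply hb
        rw [Finset.mem_image]
        exact ⟨κ ω, Finset.mem_univ _, by rw [← hr]; exact h⟩
      simp [this]) (Fintype.card ι) (Finset.card_image_le.trans (by simp))
  linarith

lemma le_mutualInfo {Ω A B : Type*} [MeasurableSpace Ω] [MeasurableSpace A] [MeasurableSpace B]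
    (P : Measure Ω) [IsProbabilityMeasure P] {X : Ω → A} {Y : Ω → B}
    (hX : Measurable X) (hY : Measurable Y) {S S' : Type*} [Fintype S] [Fintype S']
    [MeasurableSpace S] [DiscreteMeasurableSpace S]
    [MeasurableSpace S'] [DiscreteMeasurableSpace S']
    (α : A → S) (hα : Measurable α) (β : B → S') (hβ : Measurable β)
    (g : S → S' → ℝ)
    (hg : ∀ y : B, ∫ ω, Real.exp (g (α (X ω)) (β y)) ∂P ≤ 1) :
    ENNReal.ofReal ((∫ ω, g (α (X ω)) (β (Y ω)) ∂P) / Real.log 2) ≤ mutualInfo P X Y := by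
  classical
  have hl2 : 0 < Real.log 2 := Real.log_pos one_lt_two
  let eS := Fintype.equivFin S
  let eS' := Fintype.equivFin S'
  have hα' : Measurable (fun x => eS (α x)) := (measurable_of_countable eS).comp hα
  have hβ' : Measurable (fun x => eS' (β x)) := (measurable_of_countable eS').comp hβ
  have hf : Measurable (fun ω => α (X ω)) := hα.comp hX
  have hf' : Measurable (fun ω => eS (α (X ω))) := hα'.comp hX
  have hgg : Measurable (fun ω => β (Y ω)) := hβ.comp hY
  have hgg' : Measurable (fun ω => eS' (β (Y ω))) := hβ'.comp hY
  refine le_trans (ENNReal.ofReal_le_ofReal ?_) (le_iSup_of_le (Fintype.card S)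
    (le_iSup_of_le (Fintype.card S') (le_iSup_of_le (fun x => eS (α x)) (le_iSup_of_le hα'
      (le_iSup_of_le (fun x => eS' (β x)) (le_iSup_of_le hβ' le_rfl))))))
  rw [entropy_pair]
  refine div_le_div_of_nonneg_right ?_ hl2.le
  have hint : ∀ (φ : S → ℝ), ∫ ω, φ (α (X ω)) ∂P = ∑ a, P.real ((fun ω => α (X ω)) ⁻¹' {a}) * φ a := by
    intro φ
    have h0 : ∫ ω, φ (α (X ω)) ∂P = ∫ a, φ a ∂(P.map fun ω => α (X ω)) := by
      rw [integral_map hf.aemeasurable (Measurable.of_discrete.aestronglyMeasurable)]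
    have : IsProbabilityMeasure (P.map fun ω => α (X ω)) :=
      Measure.isProbabilityMeasure_map hf.aemeasurable
    rw [h0, integral_fintype (Integrable.of_finite)]
    refine Finset.sum_congr rfl fun a _ => ?_
    rw [map_measureReal_apply hf (measurableSet_singleton a), smul_eq_mul]
  have hint2 : ∫ ω, g (α (X ω)) (β (Y ω)) ∂P =
      ∑ a, ∑ b, P.real ((fun ω => α (X ω)) ⁻¹' {a} ∩ (fun ω => β (Y ω)) ⁻¹' {b}) * g a b := by
    have hfg : Measurable fun ω => (α (X ω), β (Y ω)) := hf.prodMk hgg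
    have h0 : ∫ ω, g (α (X ω)) (β (Y ω)) ∂P =
        ∫ p : S × S', g p.1 p.2 ∂(P.map fun ω => (α (X ω), β (Y ω))) := by
      rw [integral_map hfg.aemeasurable (Measurable.of_discrete.aestronglyMeasurable)]
    have : IsProbabilityMeasure (P.map fun ω => (α (X ω), β (Y ω))) :=
      Measure.isProbabilityMeasure_map hfg.aemeasurable
    rw [h0, integral_fintype (Integrable.of_finite), Fintype.sum_prod_type]
    refine Finset.sum_congr rfl fun a _ => Finset.sum_congr rfl fun b _ => ?_
    rw [map_measureReal_apply hfg (measurableSet_singleton (a, b)), smul_eq_mul]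
    congr 2
    ext ω; simp
  have key := dv_finite
    (fun a b => P.real ((fun ω => α (X ω)) ⁻¹' {a} ∩ (fun ω => β (Y ω)) ⁻¹' {b}))
    (fun a => P.real ((fun ω => α (X ω)) ⁻¹' {a})) (fun b => P.real ((fun ω => β (Y ω)) ⁻¹' {b}))
    (fun _ _ => measureReal_nonneg)
    (fun a => sum_real_fiber P hgg _ (hf (measurableSet_singleton a)))
    (fun b => by
      have := sum_real_fiber P hf _ (hgg (measurableSet_singleton b))
      simp_rw [inter_comm] at this ⊢
      exact this)
    (by simpa using sum_real_fiber P hgg univ MeasurableSet.univ) g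
    (by
      intro b hb
      have hne : ((fun ω => β (Y ω)) ⁻¹' {b}).Nonempty := by
        by_contra h
        rw [not_nonempty_iff_eq_empty] at h
        simp [h] at hb
      obtain ⟨ω, hω⟩ := hne
      have hω' : β (Y ω) = b := hω
      have := hg (Y ω)
      rw [hω', hint (fun a => Real.exp (g a b))] at this
      exact this)
  rw [hint2]
  refine key.trans (le_of_eq ?_)
  have q1 : ∀ a, (fun ω => eS (α (X ω))) ⁻¹' {eS a} = (fun ω => α (X ω)) ⁻¹' {a} := by
    intro a; ext ω; simp
  have q2 : ∀ a, (fun ω => eS' (β (Y ω))) ⁻¹' {eS' a} = (fun ω => β (Y ω)) ⁻¹' {a} := by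
    intro a; ext ω; simp
  rw [← eS.sum_comp, ← eS'.sum_comp, ← eS.sum_comp (fun a => ∑ b, Real.negMulLog
    (P.real ((fun ω => eS (α (X ω))) ⁻¹' {a} ∩ (fun ω => eS' (β (Y ω))) ⁻¹' {b})))]
  simp only [q1, q2]
  congr 1
  refine Finset.sum_congr rfl fun a _ => ?_
  rw [← eS'.sum_comp]
  simp only [q2]

end RDProof

open MeasureTheory Filter Set
open scoped ENNReal Topology NNReal

namespace RDProof

lemma measurableSet_unitBox (d : ℕ) (L : ℝ) : MeasurableSet (unitBox d L) :=
  MeasurableSet.univ_pi fun _ => measurableSet_Ico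

lemma boxMeasure_univ (d : ℕ) (L : ℝ) (hL : 0 ≤ L) :
    boxMeasure d L univ = ENNReal.ofReal (L ^ d) := by
  unfold boxMeasure unitBox
  rw [Measure.restrict_apply_univ, Real.volume_pi_Ico]
  simp [ENNReal.ofReal_pow hL]

lemma isFiniteMeasure_box (d : ℕ) (L : ℝ) (hL : 0 ≤ L) : IsFiniteMeasure (boxMeasure d L) :=
  ⟨by rw [boxMeasure_univ d L hL]; exact ENNReal.ofReal_lt_top⟩

lemma norm_le_of_mem_box {d : ℕ} {L : ℝ} (hL : 0 ≤ L) {u : Fin d → ℝ} (hu : u ∈ unitBox d L) :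
    ‖u‖ ≤ L := by
  rw [pi_norm_le_iff_of_nonneg hL]
  intro i
  have := hu i (mem_univ i)
  rw [Real.norm_eq_abs, abs_of_nonneg this.1]
  exact this.2.le

lemma ae_box {d : ℕ} {L : ℝ} : ∀ᵐ u ∂(boxMeasure d L), u ∈ unitBox d L :=
  ae_restrict_mem (measurableSet_unitBox d L)

lemma measurable_fin_mk {A : Type*} [MeasurableSpace A] {n : ℕ} {f : A → ℕ} (hf : Measurable f)
    (h : ∀ x, f x < n) : Measurable fun x => (⟨f x, h x⟩ : Fin n) := by
  refine measurable_to_countable' fun i => ?_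
  have : (fun x => (⟨f x, h x⟩ : Fin n)) ⁻¹' {i} = f ⁻¹' {(i : ℕ)} := by
    ext x; simp [Fin.ext_iff]
  rw [this]
  exact hf (measurableSet_singleton _)

/-- Mean distortion between an orbit and a path. -/
noncomputable def Dbar {X : Type*} [MetricSpace X] (d : ℕ) (T : (Fin d → ℝ) → X → X) (L : ℝ)
    (x : X) (y : L1Maps d L X) : ℝ :=
  (L ^ d)⁻¹ * ∫ u, dist (T u x) (y u) ∂(boxMeasure d L)

section
variable {X : Type} [MetricSpace X] [CompactSpace X] {d : ℕ} {T : (Fin d → ℝ) → X → X}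

lemma orbit_continuous (hT : IsContAction d T) (x : X) : Continuous fun u => T u x :=
  hT.1.comp (continuous_id.prodMk continuous_const)

lemma Dbar_integrable (hT : IsContAction d T) {L : ℝ} (hL : 0 < L) (x : X) (y : L1Maps d L X) :
    Integrable (fun u => dist (T u x) (y u)) (boxMeasure d L) := by
  have := isFiniteMeasure_box d L hL.le
  refine Integrable.of_bound (C := Metric.diam (univ : Set X)) ?_ ?_
  · exact ((orbit_continuous hT x).aestronglyMeasurable).dist y.aestronglyMeasurable
  · refine Eventually.of_forall fun u => ?_
    rw [Real.norm_eq_abs, abs_of_nonneg dist_nonneg]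
    exact Metric.dist_le_diam_of_mem isCompact_univ.isBounded (mem_univ _) (mem_univ _)

lemma Dbar_nonneg {L : ℝ} (hL : 0 < L) (x : X) (y : L1Maps d L X) : 0 ≤ Dbar d T L x y :=
  mul_nonneg (by positivity) (integral_nonneg fun _ => dist_nonneg)

lemma box_real {L : ℝ} (hL : 0 < L) : (boxMeasure d L).real univ = L ^ d := by
  rw [Measure.real, boxMeasure_univ d L hL.le, ENNReal.toReal_ofReal (by positivity)]

lemma Dbar_le (hT : IsContAction d T) {L : ℝ} (hL : 0 < L) (x : X) (y : L1Maps d L X) :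
    Dbar d T L x y ≤ Metric.diam (univ : Set X) := by
  have := isFiniteMeasure_box d L hL.le
  have h : ∫ u, dist (T u x) (y u) ∂(boxMeasure d L) ≤
      ∫ u, Metric.diam (univ : Set X) ∂(boxMeasure d L) :=
    integral_mono (Dbar_integrable hT hL x y) (integrable_const _)
      fun u => Metric.dist_le_diam_of_mem isCompact_univ.isBounded (mem_univ _) (mem_univ _)
  rw [integral_const, box_real hL, smul_eq_mul] at h
  unfold Dbar
  rw [inv_mul_le_iff₀ (by positivity)]
  exact h

lemma Dbar_lip (hT : IsContAction d T)
    (hLip : ∀ u x x', dist (T u x) (T u x') ≤ Real.exp ‖u‖ * dist x x')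
    {L : ℝ} (hL : 0 < L) (x x' : X) (y : L1Maps d L X) :
    Dbar d T L x y ≤ Dbar d T L x' y + Real.exp L * dist x x' := by
  have := isFiniteMeasure_box d L hL.le
  have h : ∫ u, dist (T u x) (y u) ∂(boxMeasure d L) ≤
      ∫ u, (dist (T u x') (y u) + Real.exp L * dist x x') ∂(boxMeasure d L) := by
    refine integral_mono_ae (Dbar_integrable hT hL x y)
      ((Dbar_integrable hT hL x' y).add (integrable_const _)) ?_
    filter_upwards [ae_box] with u hu
    have h1 := dist_triangle (T u x) (T u x') (y u)
    have h2 := hLip u x x'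
    have h3 : Real.exp ‖u‖ * dist x x' ≤ Real.exp L * dist x x' :=
      mul_le_mul_of_nonneg_right (Real.exp_le_exp.2 (norm_le_of_mem_box hL.le hu)) dist_nonneg
    linarith
  rw [integral_add (Dbar_integrable hT hL x' y) (integrable_const _), integral_const,
    box_real hL, smul_eq_mul] at h
  unfold Dbar
  rw [inv_mul_le_iff₀ (by positivity), mul_add, mul_inv_cancel_left₀ (by positivity)]
  exact h

lemma Dbar_eq (hT : IsContAction d T) {L : ℝ} (x : X) (y : L1Maps d L X) :
    Dbar d T L x y = (L ^ d)⁻¹ * L1dist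
      (AEEqFun.mk (fun u => T u x) (orbit_continuous hT x).aestronglyMeasurable) y := by
  unfold Dbar L1dist
  congr 1
  refine integral_congr_ae ?_
  filter_upwards [AEEqFun.coeFn_mk (μ := boxMeasure d L) (fun u => T u x)
    (orbit_continuous hT x).aestronglyMeasurable] with u hu
  rw [hu]

lemma Dbar_measurable (hT : IsContAction d T) {L : ℝ} (x : X) :
    Measurable fun y : L1Maps d L X => Dbar d T L x y := by
  simp_rw [Dbar_eq hT]
  refine Measurable.const_mul ?_ _
  refine measurable_of_Iio fun r => ?_
  exact MeasurableSpace.measurableSet_generateFrom ⟨_, r, rfl⟩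

lemma Dbar_continuous (hT : IsContAction d T)
    (hLip : ∀ u x x', dist (T u x) (T u x') ≤ Real.exp ‖u‖ * dist x x')
    {L : ℝ} (hL : 0 < L) (y : L1Maps d L X) : Continuous fun x => Dbar d T L x y := by
  refine (LipschitzWith.of_le_add_mul (Real.exp L).toNNReal fun x x' => ?_).continuous
  rw [Real.coe_toNNReal _ (Real.exp_pos L).le]
  exact Dbar_lip hT hLip hL x x' y

variable [MeasurableSpace X] [BorelSpace X]

lemma Dbar_measurable_comp (hT : IsContAction d T)
    (hLip : ∀ u x x', dist (T u x) (T u x') ≤ Real.exp ‖u‖ * dist x x')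
    {L : ℝ} (hL : 0 < L) {Ω : Type} [MeasurableSpace Ω] {Xv : Ω → X} {Yv : Ω → L1Maps d L X}
    (hX : Measurable Xv) (hY : Measurable Yv) :
    Measurable fun ω => Dbar d T L (Xv ω) (Yv ω) := by
  have : Measurable (Function.uncurry fun (x : X) (y : L1Maps d L X) => Dbar d T L x y) :=
    measurable_uncurry_of_continuous_of_measurable (fun y => Dbar_continuous hT hLip hL y)
      (fun x => Dbar_measurable hT x)
  exact this.comp (hX.prodMk hY)

lemma exists_quantizer [Nonempty X] {ρ : ℝ} (hρ : 0 < ρ) :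
    ∃ (N : ℕ) (α : X → Fin N) (r : Fin N → X), Measurable α ∧ ∀ x, dist x (r (α x)) ≤ ρ := by
  let e : ℕ → X := TopologicalSpace.denseSeq X
  have hcov : (univ : Set X) ⊆ ⋃ k, Metric.ball (e k) ρ := by
    intro x _
    obtain ⟨k, hk⟩ := (TopologicalSpace.denseRange_denseSeq X).exists_dist_lt x hρ
    exact mem_iUnion.2 ⟨k, hk⟩
  obtain ⟨t, ht⟩ := isCompact_univ.elim_finite_subcover _ (fun k => Metric.isOpen_ball) hcov
  let M := t.sup id
  refine ⟨M + 1, fun x => ⟨SimpleFunc.nearestPtInd e M x,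
    Nat.lt_succ_of_le (SimpleFunc.nearestPtInd_le e M x)⟩, fun i => e i, ?_, ?_⟩
  · exact measurable_fin_mk (SimpleFunc.nearestPtInd e M).measurable _
  · intro x
    have hx := ht (mem_univ x)
    simp only [mem_iUnion, Metric.mem_ball, exists_prop] at hx
    obtain ⟨k, hk, hxk⟩ := hx
    have h1 := SimpleFunc.edist_nearestPt_le e x (Finset.le_sup (f := id) hk : k ≤ M)
    rw [edist_dist, edist_dist, ENNReal.ofReal_le_ofReal_iff dist_nonneg] at h1
    have h2 : dist x (e (SimpleFunc.nearestPtInd e M x)) ≤ dist (e k) x := by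
      rw [dist_comm]; exact h1
    rw [dist_comm] at hxk
    exact h2.trans hxk.le

lemma rate_lower (hT : IsContAction d T)
    (hLip : ∀ u x x', dist (T u x) (T u x') ≤ Real.exp ‖u‖ * dist x x')
    (μ : Measure X) [IsProbabilityMeasure μ] {L ε : ℝ} (hL : 0 < L) (hε : 0 < ε)
    (A : Set X) (hA : MeasurableSet A) (s c : ℝ) (hs : 0 ≤ s)
    (hexp : ∀ y : L1Maps d L X, ∫ x in A, Real.exp (c - s * Dbar d T L x y) ∂μ ≤ μ.real A) :
    ENNReal.ofReal ((μ.real A * c - 4 * s * ε) / Real.log 2) ≤ RL d T μ L ε := by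
  classical
  unfold RL
  refine le_iInf fun Ω => le_iInf fun mΩ => le_iInf fun P => le_iInf fun hP => le_iInf fun Xv =>
    le_iInf fun Yv => le_iInf fun hX => le_iInf fun hY => le_iInf fun hmap => le_iInf fun hdist => ?_
  have hl2 : 0 < Real.log 2 := Real.log_pos one_lt_two
  have : Nonempty Ω := by
    by_contra h
    rw [not_nonempty_iff] at h
    have := measure_univ (μ := P)
    simp [univ_eq_empty_iff.2 h] at this
  have : Nonempty X := ⟨Xv (Classical.arbitrary Ω)⟩
  obtain ⟨N, α, r, hα, hαr⟩ := exists_quantizer (X := X) (ρ := Real.exp (-L) * ε) (by positivity)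
  have q1 : ∀ x, Real.exp L * dist x (r (α x)) ≤ ε := by
    intro x
    calc Real.exp L * dist x (r (α x)) ≤ Real.exp L * (Real.exp (-L) * ε) :=
          mul_le_mul_of_nonneg_left (hαr x) (Real.exp_pos L).le
      _ = ε := by rw [← mul_assoc, ← Real.exp_add]; simp
  let C := Metric.diam (univ : Set X)
  let B := ⌊C / ε⌋₊
  let α' : X → Fin N × Bool := fun x => (α x, decide (x ∈ A))
  have hα' : Measurable α' := by
    refine hα.prodMk ?_
    refine measurable_to_countable' fun b => ?_
    cases b
    · have : (fun x => decide (x ∈ A)) ⁻¹' {false} = Aᶜ := by ext x; simp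
      rw [this]; exact hA.compl
    · have : (fun x => decide (x ∈ A)) ⁻¹' {true} = A := by ext x; simp
      rw [this]; exact hA
  let β : L1Maps d L X → (Fin N → Fin (B + 1)) := fun y i => ⟨⌊Dbar d T L (r i) y / ε⌋₊, by
    refine Nat.lt_succ_of_le (Nat.floor_le_floor ?_)
    exact div_le_div_of_nonneg_right (Dbar_le hT hL _ y) hε.le⟩
  have hβ : Measurable β := by
    refine measurable_pi_lambda _ fun i => ?_
    exact measurable_fin_mk
      (Nat.measurable_floor.comp ((Dbar_measurable hT (r i)).div_const ε)) _
  let g : (Fin N × Bool) → (Fin N → Fin (B + 1)) → ℝ := fun i b =>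
    if i.2 then c - s * (ε * ((b i.1 : ℕ) + 1) + ε) else 0
  have g_up : ∀ x y, x ∈ A → g (α' x) (β y) ≤ c - s * Dbar d T L x y := by
    intro x y hx
    have h1 := Dbar_lip hT hLip hL x (r (α x)) y
    have h2 := q1 x
    have h3 := Nat.lt_floor_add_one (Dbar d T L (r (α x)) y / ε)
    rw [div_lt_iff₀ hε] at h3
    simp only [g, α', β, hx, decide_true, if_true]
    have : Dbar d T L x y ≤ ε * ((⌊Dbar d T L (r (α x)) y / ε⌋₊ : ℕ) + 1) + ε := by
      linarith
    nlinarith [mul_le_mul_of_nonneg_left this hs]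
  have g_lo : ∀ x y, A.indicator (fun _ => c) x - s * Dbar d T L x y - 3 * s * ε
      ≤ g (α' x) (β y) := by
    intro x y
    have hD0 := Dbar_nonneg (T := T) hL x y
    by_cases hx : x ∈ A
    · have h1 := Dbar_lip hT hLip hL (r (α x)) x y
      rw [dist_comm] at h1
      have h2 := q1 x
      have h3 := Nat.floor_le (div_nonneg (Dbar_nonneg (T := T) hL (r (α x)) y) hε.le)
      rw [le_div_iff₀ hε] at h3
      simp only [g, α', β, hx, decide_true, if_true, indicator_of_mem]
      have : ε * ((⌊Dbar d T L (r (α x)) y / ε⌋₊ : ℕ) + 1) + ε ≤ Dbar d T L x y + 3 * ε := by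
        linarith
      nlinarith [mul_le_mul_of_nonneg_left this hs]
    · simp only [g, α', hx, decide_false, indicator_of_notMem, not_false_eq_true]
      have := mul_nonneg hs hD0
      have := mul_nonneg hs hε.le
      simp only [Bool.false_eq_true, if_false]
      linarith
  have hexp' : ∀ y : L1Maps d L X, ∫ ω, Real.exp (g (α' (Xv ω)) (β y)) ∂P ≤ 1 := by
    intro y
    have hm : Measurable fun x => Real.exp (g (α' x) (β y)) :=
      Real.measurable_exp.comp ((Measurable.of_discrete (f := fun i => g i (β y))).comp hα')
    have e0 : ∫ ω, Real.exp (g (α' (Xv ω)) (β y)) ∂P = ∫ x, Real.exp (g (α' x) (β y)) ∂μ := by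
      rw [← hmap, integral_map hX.aemeasurable hm.aestronglyMeasurable]
    rw [e0]
    have hint : Integrable (fun x => Real.exp (g (α' x) (β y))) μ := by
      refine Integrable.of_bound (C := ∑ i, Real.exp (g i (β y))) hm.aestronglyMeasurable ?_
      refine Eventually.of_forall fun x => ?_
      rw [Real.norm_eq_abs, abs_of_nonneg (Real.exp_pos _).le]
      exact Finset.single_le_sum (f := fun i => Real.exp (g i (β y)))
        (fun i _ => (Real.exp_pos _).le) (Finset.mem_univ (α' x))
    rw [← integral_add_compl hA hint]
    have b1 : ∫ x in A, Real.exp (g (α' x) (β y)) ∂μ ≤ μ.real A := by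
      refine le_trans (setIntegral_mono_on hint.integrableOn ?_ hA ?_) (hexp y)
      · refine (Integrable.of_bound (C := Real.exp c) ?_ ?_ : Integrable _ μ).integrableOn
        · exact (Real.measurable_exp.comp (measurable_const.sub
            ((Dbar_continuous hT hLip hL y).measurable.const_mul s))).aestronglyMeasurable
        · refine Eventually.of_forall fun x => ?_
          rw [Real.norm_eq_abs, abs_of_nonneg (Real.exp_pos _).le, Real.exp_le_exp]
          have := mul_nonneg hs (Dbar_nonneg (T := T) hL x y)
          linarith
      · intro x hx
        exact Real.exp_le_exp.2 (g_up x y hx)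
    have b2 : ∫ x in Aᶜ, Real.exp (g (α' x) (β y)) ∂μ = μ.real Aᶜ := by
      have : ∫ x in Aᶜ, Real.exp (g (α' x) (β y)) ∂μ = ∫ x in Aᶜ, (1 : ℝ) ∂μ := by
        refine setIntegral_congr_fun hA.compl fun x hx => ?_
        have hx' : x ∉ A := hx
        simp [g, α', hx']
      rw [this]; simp
    rw [b2]
    have := probReal_add_probReal_compl (μ := μ) hA
    linarith
  refine le_trans (ENNReal.ofReal_le_ofReal ?_)
    (le_mutualInfo P hX hY α' hα' β hβ g hexp')
  refine div_le_div_of_nonneg_right ?_ hl2.le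
  have hDm := Dbar_measurable_comp hT hLip hL hX hY
  have hDi : Integrable (fun ω => Dbar d T L (Xv ω) (Yv ω)) P := by
    refine Integrable.of_bound (C := C) hDm.aestronglyMeasurable ?_
    refine Eventually.of_forall fun ω => ?_
    rw [Real.norm_eq_abs, abs_of_nonneg (Dbar_nonneg hL _ _)]
    exact Dbar_le hT hL _ _
  have hdist' : ∫ ω, Dbar d T L (Xv ω) (Yv ω) ∂P < ε := hdist
  have hcA : Integrable (fun ω => A.indicator (fun _ => c) (Xv ω)) P := by
    refine Integrable.of_bound (C := |c|)
      ((measurable_const.indicator hA).comp hX).aestronglyMeasurable ?_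
    refine Eventually.of_forall fun ω => ?_
    rw [Real.norm_eq_abs]
    by_cases h : Xv ω ∈ A <;> simp [h]
  have hgm : Measurable fun ω => g (α' (Xv ω)) (β (Yv ω)) :=
    (Measurable.of_discrete (f := fun i : (Fin N × Bool) × (Fin N → Fin (B + 1)) => g i.1 i.2)).comp
      ((hα'.comp hX).prodMk (hβ.comp hY))
  have hgi : Integrable (fun ω => g (α' (Xv ω)) (β (Yv ω))) P := by
    refine Integrable.of_bound (C := ∑ i : (Fin N × Bool) × (Fin N → Fin (B + 1)), |g i.1 i.2|)
      hgm.aestronglyMeasurable ?_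
    refine Eventually.of_forall fun ω => ?_
    rw [Real.norm_eq_abs]
    exact Finset.single_le_sum
      (f := fun i : (Fin N × Bool) × (Fin N → Fin (B + 1)) => |g i.1 i.2|)
      (fun i _ => abs_nonneg _) (Finset.mem_univ (α' (Xv ω), β (Yv ω)))
  have hfin : ∫ ω, (A.indicator (fun _ => c) (Xv ω) - s * Dbar d T L (Xv ω) (Yv ω) - 3 * s * ε) ∂P
      ≤ ∫ ω, g (α' (Xv ω)) (β (Yv ω)) ∂P :=
    integral_mono ((hcA.sub (hDi.const_mul s)).sub (integrable_const _)) hgi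
      fun ω => g_lo (Xv ω) (Yv ω)
  have hsub : Integrable (fun ω => A.indicator (fun _ => c) (Xv ω)
      - s * Dbar d T L (Xv ω) (Yv ω)) P := hcA.sub (hDi.const_mul s)
  rw [integral_sub hsub (integrable_const _),
    integral_sub hcA (hDi.const_mul s), integral_const_mul] at hfin
  have e1 : ∫ ω, A.indicator (fun _ => c) (Xv ω) ∂P = μ.real A * c := by
    have : ∫ ω, A.indicator (fun _ => c) (Xv ω) ∂P = ∫ x, A.indicator (fun _ => c) x ∂μ := by
      rw [← hmap, integral_map hX.aemeasurable
        (measurable_const.indicator hA).aestronglyMeasurable]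
    rw [this, integral_indicator hA]
    simp
  rw [e1] at hfin
  simp only [integral_const, probReal_univ, smul_eq_mul, one_mul] at hfin
  nlinarith [mul_le_mul_of_nonneg_left hdist'.le hs]

end

end RDProof

open MeasureTheory Filter Set
open scoped ENNReal Topology NNReal

namespace RDProof

section
variable {X : Type} [MetricSpace X] [CompactSpace X] {d : ℕ} {T : (Fin d → ℝ) → X → X}
variable [MeasurableSpace X] [BorelSpace X]

lemma rate_upper (hT : IsContAction d T)
    (ν : Measure X) [IsProbabilityMeasure ν] {L ε ε' : ℝ} (hL : 0 < L) (hε : ε' < ε)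
    (ι : Type) [Fintype ι] [Nonempty ι] (r : ι → X)
    (hcov : ∀ᵐ x ∂ν, ∃ i, ∀ u ∈ unitBox d L, dist (T u x) (T u (r i)) ≤ ε') :
    RL d T ν L ε ≤ ENNReal.ofReal (Real.logb 2 (Fintype.card ι)) := by
  classical
  let N := Fintype.card ι
  have hN : 0 < N := Fintype.card_pos
  let eq := (Fintype.equivFin ι).symm
  let r' : Fin N → X := fun i => r (eq i)
  let B : Fin N → Set X := fun i => {x | ∀ u ∈ unitBox d L, dist (T u x) (T u (r' i)) ≤ ε'}
  have hB : ∀ i, MeasurableSet (B i) := by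
    intro i
    have : B i = ⋂ u ∈ unitBox d L, {x | dist (T u x) (T u (r' i)) ≤ ε'} := by
      ext x; simp [B]
    rw [this]
    refine (isClosed_biInter fun u _ => ?_).measurableSet
    refine isClosed_le (Continuous.dist ?_ continuous_const) continuous_const
    exact hT.1.comp (continuous_const.prodMk continuous_id)
  let p : X → ℕ → Prop := fun x k => N - 1 ≤ k ∨ ∃ h : k < N, x ∈ B ⟨k, h⟩
  have hp : ∀ x, ∃ k, p x k := fun x => ⟨N - 1, Or.inl le_rfl⟩
  have hpm : ∀ k, MeasurableSet {x | p x k} := by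
    intro k
    by_cases h1 : N - 1 ≤ k
    · have : {x | p x k} = univ := by ext x; simp only [p, h1, true_or, setOf_true]
      rw [this]; exact MeasurableSet.univ
    · have h2 : k < N := by omega
      have : {x | p x k} = B ⟨k, h2⟩ := by ext x; simp only [p, h1, false_or, mem_setOf_eq]; exact ⟨fun ⟨_, h⟩ => h, fun h => ⟨h2, h⟩⟩
      rw [this]; exact hB _
  let f : X → ℕ := fun x => Nat.find (hp x)
  have hf : Measurable f := measurable_find hp hpm
  have hfN : ∀ x, f x < N := by
    intro x
    have : f x ≤ N - 1 := Nat.find_min' (hp x) (Or.inl le_rfl)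
    omega
  let κ : X → Fin N := fun x => ⟨f x, hfN x⟩
  have hκ : Measurable κ := measurable_fin_mk hf hfN
  have hκB : ∀ x, (∃ i, ∀ u ∈ unitBox d L, dist (T u x) (T u (r i)) ≤ ε') → x ∈ B (κ x) := by
    rintro x ⟨i, hi⟩
    have hxi : x ∈ B (eq.symm i) := by
      intro u hu
      have := hi u hu
      simpa [r'] using this
    rcases Nat.find_spec (hp x) with h | ⟨h, hx⟩
    · have h3 : f x ≤ (eq.symm i : Fin N) :=
        Nat.find_min' (hp x) (Or.inr ⟨(eq.symm i).2, hxi⟩)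
      have h4 := (eq.symm i).2
      have h' : N - 1 ≤ f x := h
      have : κ x = eq.symm i := by
        apply Fin.ext
        change f x = _
        omega
      rw [this]; exact hxi
    · exact hx
  let orb : Fin N → L1Maps d L X := fun i =>
    AEEqFun.mk (fun u => T u (r' i)) (orbit_continuous hT (r' i)).aestronglyMeasurable
  let Yv : X → L1Maps d L X := fun x => orb (κ x)
  have hY : Measurable Yv := (Measurable.of_discrete (f := orb)).comp hκ
  have hdist : distortion d T L ν id Yv < ε := by
    refine lt_of_le_of_lt ?_ hε
    change ∫ x, Dbar d T L x (Yv x) ∂ν ≤ ε'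
    have hh : ∫ x, Dbar d T L x (Yv x) ∂ν ≤ ∫ x, ε' ∂ν := by
      refine integral_mono_of_nonneg (Eventually.of_forall fun x => Dbar_nonneg hL _ _)
        (integrable_const _) ?_
      filter_upwards [hcov] with x hx
      have hxB := hκB x hx
      have := isFiniteMeasure_box d L hL.le
      have h : ∫ u, dist (T u x) (Yv x u) ∂(boxMeasure d L) ≤
          ∫ u, ε' ∂(boxMeasure d L) := by
        refine integral_mono_ae (Dbar_integrable hT hL x _) (integrable_const _) ?_
        filter_upwards [ae_box, AEEqFun.coeFn_mk (μ := boxMeasure d L)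
          (fun u => T u (r' (κ x))) (orbit_continuous hT (r' (κ x))).aestronglyMeasurable]
          with u hu hu2
        have : Yv x u = T u (r' (κ x)) := hu2
        rw [this]
        exact hxB u hu
      rw [integral_const, box_real hL, smul_eq_mul] at h
      unfold Dbar
      rw [inv_mul_le_iff₀ (by positivity)]
      exact h
    simpa using hh
  unfold RL
  refine iInf_le_of_le X (iInf_le_of_le inferInstance (iInf_le_of_le ν (iInf_le_of_le inferInstance
    (iInf_le_of_le id (iInf_le_of_le Yv (iInf_le_of_le measurable_id (iInf_le_of_le hY
    (iInf_le_of_le Measure.map_id (iInf_le_of_le hdist ?_)))))))))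
  have := mutualInfo_le ν measurable_id hY (Fin N) κ orb (fun _ => rfl)
  simpa [N] using this

end

/-! ### The space -/

/-- amplitude -/
noncomputable def amp (n : ℕ) : ℝ := (1 / 2) ^ n

/-- size of the alphabet -/
def K (n : ℕ) : ℕ := 2 ^ (4 ^ (n + 1))

instance (n : ℕ) : NeZero (K n) := ⟨by unfold K; positivity⟩

lemma amp_pos (n : ℕ) : 0 < amp n := by unfold amp; positivity

lemma amp_le_one (n : ℕ) : amp n ≤ 1 := pow_le_one₀ (by norm_num) (by norm_num)

/-- cell containing a point -/
noncomputable def fl {d : ℕ} (t : Fin d → ℝ) : Fin d → ℤ := fun i => ⌊t i⌋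

/-- center of a cell -/
noncomputable def ctr {d : ℕ} (j : Fin d → ℤ) : Fin d → ℝ := fun i => j i + 1 / 2

/-- an integer vector as a real vector -/
noncomputable def iv {d : ℕ} (j : Fin d → ℤ) : Fin d → ℝ := fun i => j i

lemma fl_add_iv {d : ℕ} (t : Fin d → ℝ) (j : Fin d → ℤ) : fl (t + iv j) = fl t + j := by
  ext i; simp [fl, iv]

lemma ctr_add {d : ℕ} (i j : Fin d → ℤ) : ctr (i + j) = ctr i + iv j := by
  ext l; simp [ctr, iv]; ring

lemma fl_ctr {d : ℕ} (j : Fin d → ℤ) : fl (ctr j) = j := by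
  ext i
  simp only [fl, ctr]
  rw [Int.floor_eq_iff]
  constructor <;> linarith

lemma norm_sub_ctr_le {d : ℕ} (t : Fin d → ℝ) : ‖t - ctr (fl t)‖ ≤ 1 / 2 := by
  rw [pi_norm_le_iff_of_nonneg (by norm_num)]
  intro i
  simp only [Pi.sub_apply, fl, ctr, Real.norm_eq_abs]
  rw [abs_le]
  have h1 := Int.floor_le (t i)
  have h2 := Int.lt_floor_add_one (t i)
  constructor <;> linarith

lemma fl_eq_of_norm_lt {d : ℕ} (t : Fin d → ℝ) (j : Fin d → ℤ) (h : ‖t - ctr j‖ < 1 / 2) :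
    fl t = j := by
  rw [pi_norm_lt_iff (by norm_num)] at h
  ext i
  have := h i
  simp only [Pi.sub_apply, ctr, Real.norm_eq_abs, abs_lt] at this
  simp only [fl]
  rw [Int.floor_eq_iff]
  constructor <;> linarith

/-- the basic step functions -/
noncomputable def G {d : ℕ} (n : ℕ) (z : (Fin d → ℤ) → Fin (K n)) (a : ℕ) (t : Fin d → ℝ) : ℝ :=
  if (z (fl t) : ℕ) = a then amp n * (1 / 2 - ‖t - ctr (fl t)‖) else 0

lemma G_nonneg {d : ℕ} (n : ℕ) (z : (Fin d → ℤ) → Fin (K n)) (a : ℕ) (t : Fin d → ℝ) :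
    0 ≤ G n z a t := by
  unfold G
  split_ifs
  · exact mul_nonneg (amp_pos n).le (by linarith [norm_sub_ctr_le t])
  · exact le_rfl

lemma G_le {d : ℕ} (n : ℕ) (z : (Fin d → ℤ) → Fin (K n)) (a : ℕ) (t : Fin d → ℝ) :
    G n z a t ≤ amp n / 2 := by
  unfold G
  have := amp_pos n
  split_ifs
  · nlinarith [norm_nonneg (t - ctr (fl t))]
  · positivity

lemma G_ge {d : ℕ} (n : ℕ) (z : (Fin d → ℤ) → Fin (K n)) (a : ℕ) (t : Fin d → ℝ)
    (j : Fin d → ℤ) (hj : (z j : ℕ) = a) : amp n * (1 / 2 - ‖t - ctr j‖) ≤ G n z a t := by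
  by_cases h : ‖t - ctr j‖ < 1 / 2
  · have := fl_eq_of_norm_lt t j h
    unfold G
    rw [this, if_pos hj]
  · refine le_trans ?_ (G_nonneg n z a t)
    have := amp_pos n
    nlinarith

lemma G_lip_aux {d : ℕ} (n : ℕ) (z : (Fin d → ℤ) → Fin (K n)) (a : ℕ) (s t : Fin d → ℝ) :
    G n z a s ≤ G n z a t + ‖s - t‖ := by
  by_cases h : (z (fl s) : ℕ) = a
  · have h1 := G_ge n z a t (fl s) h
    have h2 : G n z a s = amp n * (1 / 2 - ‖s - ctr (fl s)‖) := by unfold G; rw [if_pos h]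
    have h3 : ‖t - ctr (fl s)‖ ≤ ‖s - t‖ + ‖s - ctr (fl s)‖ := by
      rw [norm_sub_rev s t]
      exact norm_sub_le_norm_sub_add_norm_sub t s (ctr (fl s))
    have h4 := amp_pos n
    have h5 := amp_le_one n
    have h6 := norm_nonneg (s - t)
    rw [h2]
    nlinarith
  · have h2 : G n z a s = 0 := by unfold G; rw [if_neg h]
    rw [h2]
    have := G_nonneg n z a t
    positivity

lemma G_shift {d : ℕ} (n : ℕ) (z : (Fin d → ℤ) → Fin (K n)) (a : ℕ) (t : Fin d → ℝ)
    (j : Fin d → ℤ) : G n z a (t + iv j) = G n (fun i => z (i + j)) a t := by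
  unfold G
  rw [fl_add_iv, ctr_add, add_sub_add_right_eq_sub]

/-- the phase space -/
def XX (d : ℕ) : Type :=
  {F : ℕ → (Fin d → ℝ) → ℝ // F = 0 ∨ ∃ (n : ℕ) (z : (Fin d → ℤ) → Fin (K n)) (θ : Fin d → ℝ),
    F = fun a t => G n z a (t + θ)}

/-- points of level `n` -/
noncomputable def pt {d : ℕ} (n : ℕ) (z : (Fin d → ℤ) → Fin (K n)) (θ : Fin d → ℝ) : XX d :=
  ⟨fun a t => G n z a (t + θ), Or.inr ⟨n, z, θ, rfl⟩⟩

/-- the fixed point -/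
def x0 (d : ℕ) : XX d := ⟨0, Or.inl rfl⟩

lemma XX_cases {d : ℕ} (x : XX d) : x = x0 d ∨ ∃ n z θ, x = pt n z θ := by
  rcases x.2 with h | ⟨n, z, θ, h⟩
  · exact Or.inl (Subtype.ext h)
  · exact Or.inr ⟨n, z, θ, Subtype.ext h⟩

lemma XX_nonneg {d : ℕ} (x : XX d) (a : ℕ) (t : Fin d → ℝ) : 0 ≤ x.1 a t := by
  rcases XX_cases x with h | ⟨n, z, θ, h⟩
  · rw [h]; simp [x0]
  · rw [h]; exact G_nonneg n z a _

lemma XX_le_one {d : ℕ} (x : XX d) (a : ℕ) (t : Fin d → ℝ) : x.1 a t ≤ 1 := by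
  rcases XX_cases x with h | ⟨n, z, θ, h⟩
  · rw [h]; simp [x0]
  · rw [h]
    have := G_le n z a (t + θ)
    have := amp_le_one n
    change G n z a (t + θ) ≤ 1
    linarith

lemma XX_lip {d : ℕ} (x : XX d) (a : ℕ) (s t : Fin d → ℝ) : |x.1 a s - x.1 a t| ≤ ‖s - t‖ := by
  rcases XX_cases x with h | ⟨n, z, θ, h⟩
  · rw [h]; simp [x0]
  · rw [h]
    change |G n z a (s + θ) - G n z a (t + θ)| ≤ _
    have h1 := G_lip_aux n z a (s + θ) (t + θ)
    have h2 := G_lip_aux n z a (t + θ) (s + θ)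
    rw [add_sub_add_right_eq_sub] at h1 h2
    rw [norm_sub_rev] at h2
    rw [abs_le]
    constructor <;> linarith

lemma XX_abs_le {d : ℕ} (x y : XX d) (a : ℕ) (t : Fin d → ℝ) : |x.1 a t - y.1 a t| ≤ 1 := by
  have := XX_nonneg x a t
  have := XX_nonneg y a t
  have := XX_le_one x a t
  have := XX_le_one y a t
  rw [abs_le]
  constructor <;> linarith

/-- the weighted sup distance -/
noncomputable def dd {d : ℕ} (x y : XX d) : ℝ :=
  ⨆ p : ℕ × (Fin d → ℝ), Real.exp (-‖p.2‖) * |x.1 p.1 p.2 - y.1 p.1 p.2|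

lemma dd_bdd {d : ℕ} (x y : XX d) : BddAbove (range fun p : ℕ × (Fin d → ℝ) =>
    Real.exp (-‖p.2‖) * |x.1 p.1 p.2 - y.1 p.1 p.2|) := by
  refine ⟨1, ?_⟩
  rintro _ ⟨p, rfl⟩
  have h1 : Real.exp (-‖p.2‖) ≤ 1 := Real.exp_le_one_iff.2 (by simp)
  have h2 := XX_abs_le x y p.1 p.2
  exact mul_le_one₀ h1 (abs_nonneg _) h2

lemma le_dd {d : ℕ} (x y : XX d) (a : ℕ) (t : Fin d → ℝ) :
    Real.exp (-‖t‖) * |x.1 a t - y.1 a t| ≤ dd x y :=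
  le_ciSup (dd_bdd x y) (a, t)

lemma dd_le {d : ℕ} (x y : XX d) (c : ℝ)
    (h : ∀ a t, Real.exp (-‖t‖) * |x.1 a t - y.1 a t| ≤ c) : dd x y ≤ c :=
  ciSup_le fun p => h p.1 p.2

noncomputable instance (d : ℕ) : MetricSpace (XX d) where
  dist := dd
  dist_self x := by
    refine le_antisymm (dd_le _ _ _ fun a t => by simp) ?_
    exact le_trans (by positivity) (le_dd x x 0 0)
  dist_comm x y := by
    unfold dd
    simp_rw [abs_sub_comm]
  dist_triangle x y z := by
    refine dd_le _ _ _ fun a t => ?_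
    have h1 := le_dd x y a t
    have h2 := le_dd y z a t
    have h3 := abs_sub_le (x.1 a t) (y.1 a t) (z.1 a t)
    have h4 := Real.exp_pos (-‖t‖)
    nlinarith
  eq_of_dist_eq_zero {x y} h := by
    apply Subtype.ext
    funext a t
    have h1 := le_dd x y a t
    have h' : dd x y = 0 := h
    rw [h'] at h1
    have h4 := Real.exp_pos (-‖t‖)
    have h5 := abs_nonneg (x.1 a t - y.1 a t)
    have : |x.1 a t - y.1 a t| = 0 := by nlinarith
    rw [abs_eq_zero] at this
    linarith

lemma dist_def {d : ℕ} (x y : XX d) : dist x y = dd x y := rfl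

/-- the shift action -/
noncomputable def TT (d : ℕ) (u : Fin d → ℝ) (x : XX d) : XX d :=
  ⟨fun a t => x.1 a (t + u), by
    rcases x.2 with h | ⟨n, z, θ, h⟩
    · left; rw [h]; rfl
    · right
      refine ⟨n, z, θ + u, ?_⟩
      rw [h]
      funext a t
      simp only []
      congr 1
      abel⟩

lemma TT_pt {d : ℕ} (u : Fin d → ℝ) (n : ℕ) (z : (Fin d → ℤ) → Fin (K n)) (θ : Fin d → ℝ) :
    TT d u (pt n z θ) = pt n z (θ + u) := by
  apply Subtype.ext
  funext a t
  change G n z a (t + u + θ) = G n z a (t + (θ + u))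
  congr 1
  abel

lemma TT_lip {d : ℕ} (u : Fin d → ℝ) (x y : XX d) :
    dist (TT d u x) (TT d u y) ≤ Real.exp ‖u‖ * dist x y := by
  refine dd_le _ _ _ fun a t => ?_
  have h1 := le_dd x y a (t + u)
  change Real.exp (-‖t‖) * |x.1 a (t + u) - y.1 a (t + u)| ≤ Real.exp ‖u‖ * dd x y
  have h2 : Real.exp (-‖t‖) ≤ Real.exp ‖u‖ * Real.exp (-‖t + u‖) := by
    rw [← Real.exp_add, Real.exp_le_exp]
    linarith [norm_add_le t u]
  calc _ ≤ Real.exp ‖u‖ * Real.exp (-‖t + u‖) * |x.1 a (t + u) - y.1 a (t + u)| :=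
        mul_le_mul_of_nonneg_right h2 (abs_nonneg _)
    _ = Real.exp ‖u‖ * (Real.exp (-‖t + u‖) * |x.1 a (t + u) - y.1 a (t + u)|) := by ring
    _ ≤ _ := mul_le_mul_of_nonneg_left h1 (Real.exp_pos _).le

lemma exp_mul_le {t : ℝ} (ht : 0 ≤ t) {r : ℝ} (hr : 0 ≤ r) : Real.exp (-t) * r ≤ r :=
  mul_le_of_le_one_left hr (Real.exp_le_one_iff.2 (by linarith))

lemma TT_time {d : ℕ} (u v : Fin d → ℝ) (x : XX d) : dist (TT d u x) (TT d v x) ≤ ‖u - v‖ := by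
  refine dd_le _ _ _ fun a t => ?_
  refine (exp_mul_le (norm_nonneg t) (abs_nonneg _)).trans ?_
  have := XX_lip x a (t + u) (t + v)
  rwa [add_sub_add_left_eq_sub] at this

lemma TT_action (d : ℕ) : IsContAction d (TT d) := by
  refine ⟨?_, ?_, ?_⟩
  · rw [continuous_iff_continuousAt]
    rintro ⟨u, x⟩
    unfold ContinuousAt
    rw [tendsto_iff_dist_tendsto_zero]
    have hlim : Tendsto (fun p : (Fin d → ℝ) × XX d =>
        Real.exp ‖p.1‖ * dist p.2 x + ‖p.1 - u‖) (𝓝 (u, x)) (𝓝 0) := by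
      have : Continuous (fun p : (Fin d → ℝ) × XX d =>
        Real.exp ‖p.1‖ * dist p.2 x + ‖p.1 - u‖) := by fun_prop
      simpa using this.tendsto (u, x)
    refine squeeze_zero (fun _ => dist_nonneg) (fun p => ?_) hlim
    exact (dist_triangle _ (TT d p.1 x) _).trans (add_le_add (TT_lip _ _ _) (TT_time _ _ _))
  · intro x
    apply Subtype.ext
    funext a t
    change x.1 a (t + 0) = x.1 a t
    rw [add_zero]
  · intro u v x
    apply Subtype.ext
    funext a t
    change x.1 a (t + (u + v)) = x.1 a (t + u + v)
    rw [add_assoc]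

lemma pt_close {d : ℕ} (n : ℕ) (z z' : (Fin d → ℤ) → Fin (K n)) (θ θ' : Fin d → ℝ) (M : ℝ)
    (h : ∀ v, ‖v‖ ≤ M → z (fl (v + θ)) = z' (fl (v + θ))) :
    dist (pt n z θ) (pt n z' θ') ≤ ‖θ - θ'‖ + Real.exp (-M) := by
  refine dd_le _ _ _ fun a t => ?_
  by_cases ht : ‖t‖ ≤ M
  · refine (exp_mul_le (norm_nonneg t) (abs_nonneg _)).trans ?_
    have h1 : (pt n z θ).1 a t = (pt n z' θ).1 a t := by
      change G n z a (t + θ) = G n z' a (t + θ)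
      unfold G
      rw [h t ht]
    have h2 : |(pt n z' θ).1 a t - (pt n z' θ').1 a t| ≤ ‖θ - θ'‖ := by
      have := XX_lip (pt n z' 0) a (t + θ) (t + θ')
      rw [add_sub_add_left_eq_sub] at this
      simpa [pt] using this
    rw [h1]
    have := Real.exp_pos (-M)
    linarith
  · have h1 : Real.exp (-‖t‖) ≤ Real.exp (-M) := Real.exp_le_exp.2 (by linarith)
    have h2 := XX_abs_le (pt n z θ) (pt n z' θ') a t
    have h3 := Real.exp_pos (-‖t‖)
    have h4 := norm_nonneg (θ - θ')
    nlinarith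

/-- window of cells -/
noncomputable def win (d m : ℕ) : Finset (Fin d → ℤ) := Finset.Icc (fun _ => -(m : ℤ)) (fun _ => (m : ℤ))

lemma fl_mem_win {d : ℕ} (t : Fin d → ℝ) (m : ℕ) (h : ‖t‖ ≤ m) : fl t ∈ win d m := by
  have hi : ∀ i, |t i| ≤ m := fun i => (norm_le_pi_norm t i).trans h
  rw [win, Finset.mem_Icc]
  constructor
  · intro i
    have := (abs_le.1 (hi i)).1
    simp only [fl]
    rw [Int.le_floor]
    push_cast
    exact this
  · intro i
    have h1 := (abs_le.1 (hi i)).2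
    have h2 := Int.floor_le (t i)
    have : ((⌊t i⌋ : ℤ) : ℝ) ≤ ((m : ℤ) : ℝ) := by push_cast; linarith
    exact_mod_cast this

lemma pt_continuous (d n : ℕ) :
    Continuous fun p : ((Fin d → ℤ) → Fin (K n)) × (Fin d → ℝ) => pt n p.1 p.2 := by
  rw [continuous_iff_continuousAt]
  rintro ⟨z, θ⟩
  rw [Metric.continuousAt_iff']
  intro ε hε
  obtain ⟨M, hM⟩ : ∃ M : ℕ, Real.exp (-(M : ℝ)) < ε / 2 := by
    have : Tendsto (fun M : ℕ => Real.exp (-(M : ℝ))) atTop (𝓝 0) :=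
      Real.tendsto_exp_neg_atTop_nhds_zero.comp tendsto_natCast_atTop_atTop
    exact (this.eventually (gt_mem_nhds (half_pos hε))).exists
  obtain ⟨R, hR⟩ := exists_nat_ge (M + ‖θ‖)
  have e1 : ∀ᶠ p : ((Fin d → ℤ) → Fin (K n)) × (Fin d → ℝ) in 𝓝 (z, θ),
      ∀ j ∈ win d R, z j = p.1 j := by
    rw [Finset.eventually_all]
    intro j _
    have hc : Continuous fun p : ((Fin d → ℤ) → Fin (K n)) × (Fin d → ℝ) => p.1 j := by fun_prop
    have := hc.continuousAt (x := (z, θ))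
    have h2 := this.eventually (show ∀ᶠ b in 𝓝 (z j), z j = b by simp)
    exact h2
  have e2 : ∀ᶠ p : ((Fin d → ℤ) → Fin (K n)) × (Fin d → ℝ) in 𝓝 (z, θ),
      ‖θ - p.2‖ < ε / 2 := by
    have hc : Continuous fun p : ((Fin d → ℤ) → Fin (K n)) × (Fin d → ℝ) => ‖θ - p.2‖ := by
      fun_prop
    exact hc.continuousAt.eventually (gt_mem_nhds (by simpa using half_pos hε))
  filter_upwards [e1, e2] with p h1 h2
  rw [dist_comm]
  have := pt_close n z p.1 θ p.2 M (fun v hv => h1 _ (fl_mem_win _ _ (by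
    refine (norm_add_le v θ).trans ?_
    linarith)))
  linarith

lemma pt_shift {d : ℕ} (n : ℕ) (z : (Fin d → ℤ) → Fin (K n)) (θ : Fin d → ℝ) (j : Fin d → ℤ) :
    pt n z (θ + iv j) = pt n (fun i => z (i + j)) θ := by
  apply Subtype.ext
  funext a t
  change G n z a (t + (θ + iv j)) = G n (fun i => z (i + j)) a (t + θ)
  rw [← G_shift, add_assoc]

/-- the `n`-th level -/
def lev (d n : ℕ) : Set (XX d) := {x | ∃ z θ, x = pt n z θ}

lemma pt_normalize {d : ℕ} (n : ℕ) (z : (Fin d → ℤ) → Fin (K n)) (θ : Fin d → ℝ) :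
    ∃ z' θ', pt n z θ = pt n z' θ' ∧ ∀ i, θ' i ∈ Ico (0 : ℝ) 1 := by
  refine ⟨fun i => z (i + fl θ), fun i => Int.fract (θ i), ?_, fun i =>
    ⟨Int.fract_nonneg _, Int.fract_lt_one _⟩⟩
  rw [← pt_shift]
  congr 1
  ext i
  simp [iv, fl]

lemma isCompact_lev (d n : ℕ) : IsCompact (lev d n) := by
  have h : lev d n = (fun p : ((Fin d → ℤ) → Fin (K n)) × (Fin d → ℝ) => pt n p.1 p.2) ''
      (univ ×ˢ (Set.Icc 0 1)) := by
    ext x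
    constructor
    · rintro ⟨z, θ, rfl⟩
      obtain ⟨z', θ', h, hθ⟩ := pt_normalize n z θ
      refine ⟨(z', θ'), ⟨mem_univ _, ?_⟩, h.symm⟩
      exact ⟨fun i => (hθ i).1, fun i => (hθ i).2.le⟩
    · rintro ⟨p, _, rfl⟩
      exact ⟨p.1, p.2, rfl⟩
  rw [h]
  exact (isCompact_univ.prod isCompact_Icc).image (pt_continuous d n)

lemma dist_x0_le {d n : ℕ} {x : XX d} (hx : x ∈ lev d n) : dist x (x0 d) ≤ amp n := by
  obtain ⟨z, θ, rfl⟩ := hx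
  refine dd_le _ _ _ fun a t => ?_
  refine (exp_mul_le (norm_nonneg t) (abs_nonneg _)).trans ?_
  change |G n z a (t + θ) - 0| ≤ amp n
  rw [sub_zero, abs_of_nonneg (G_nonneg _ _ _ _)]
  have := G_le n z a (t + θ)
  have := amp_pos n
  linarith

instance (d : ℕ) : CompactSpace (XX d) := by
  refine ⟨?_⟩
  rw [isCompact_iff_ultrafilter_le_nhds]
  intro f _
  by_cases h : ∃ n, lev d n ∈ f
  · obtain ⟨n, hn⟩ := h
    obtain ⟨x, _, hx⟩ := (isCompact_iff_ultrafilter_le_nhds.1 (isCompact_lev d n)) f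
      (le_principal_iff.2 hn)
    exact ⟨x, mem_univ _, hx⟩
  · push Not at h
    refine ⟨x0 d, mem_univ _, ?_⟩
    rw [Metric.nhds_basis_ball.ge_iff]
    intro ε hε
    obtain ⟨N, hN⟩ : ∃ N, amp N < ε := exists_pow_lt_of_lt_one hε (by norm_num)
    have hall : ∀ᶠ x in (f : Filter (XX d)), ∀ n ∈ Finset.range N, x ∉ lev d n := by
      rw [Finset.eventually_all]
      intro n _
      exact Ultrafilter.compl_mem_iff_notMem.2 (h n)
    refine mem_of_superset hall fun x hx => ?_
    rw [Metric.mem_ball]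
    rcases XX_cases x with h0 | ⟨n, z, θ, h0⟩
    · rw [h0, dist_self]; exact hε
    · have hl : x ∈ lev d n := ⟨z, θ, h0⟩
      have hn : N ≤ n := by
        by_contra hlt
        exact hx n (Finset.mem_range.2 (by omega)) hl
      refine lt_of_le_of_lt (dist_x0_le hl) (lt_of_le_of_lt ?_ hN)
      exact pow_le_pow_of_le_one (by norm_num) (by norm_num) hn

noncomputable instance (d : ℕ) : MeasurableSpace (XX d) := borel (XX d)
instance (d : ℕ) : BorelSpace (XX d) := ⟨rfl⟩

lemma lev_measurable (d n : ℕ) : MeasurableSet (lev d n) := (isCompact_lev d n).isClosed.measurableSet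

lemma lev_amp {d n m : ℕ} {x : XX d} (hn : x ∈ lev d n) (hm : x ∈ lev d m) : amp n ≤ amp m := by
  obtain ⟨z, θ, rfl⟩ := hn
  obtain ⟨z', θ', h⟩ := hm
  have h1 : (pt n z θ).1 (z 0) (ctr 0 - θ) = amp n / 2 := by
    change G n z (z 0) (ctr 0 - θ + θ) = _
    rw [sub_add_cancel]
    unfold G
    rw [fl_ctr]
    simp
    ring
  have h2 : (pt m z' θ').1 (z 0) (ctr 0 - θ) ≤ amp m / 2 := G_le _ _ _ _
  rw [← h, h1] at h2
  linarith

lemma lev_disjoint {d n m : ℕ} (hnm : n ≠ m) {x : XX d} (hn : x ∈ lev d n) : x ∉ lev d m := by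
  intro hm
  have h : amp n = amp m := le_antisymm (lev_amp hn hm) (lev_amp hm hn)
  exact hnm (pow_right_injective₀ (by norm_num : (0:ℝ) < 1/2) (by norm_num) h)

lemma TT_lev {d : ℕ} (u : Fin d → ℝ) (n : ℕ) : TT d u ⁻¹' lev d n = lev d n := by
  have key : ∀ (u : Fin d → ℝ) x, x ∈ lev d n → TT d u x ∈ lev d n := by
    rintro u x ⟨z, θ, rfl⟩
    exact ⟨z, θ + u, TT_pt _ _ _ _⟩
  ext x
  refine ⟨fun h => ?_, key u x⟩
  have h2 := key (-u) _ h
  rwa [← (TT_action d).2.2, neg_add_cancel, (TT_action d).2.1] at h2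

end RDProof

open MeasureTheory Filter Set
open scoped ENNReal Topology NNReal

namespace RDProof

lemma card_win (d m : ℕ) : (win d m).card = (2 * m + 1) ^ d := by
  unfold win
  rw [Pi.card_Icc]
  simp only [Int.card_Icc, Finset.prod_const, Finset.card_univ, Fintype.card_fin]
  congr 1
  omega

lemma log_card (d n m : ℕ) : Real.logb 2 (Fintype.card ((win d (2 * m + 1) → Fin (K n)) ×
    (Fin d → Fin (2 ^ m)))) = (4 * m + 3 : ℝ) ^ d * 4 ^ (n + 1) + m * d := by
  classical
  rw [Fintype.card_prod, Fintype.card_fun, Fintype.card_fun, Fintype.card_fin, Fintype.card_fin,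
    Fintype.card_fin, Fintype.card_coe, card_win]
  have : K n ^ (2 * (2 * m + 1) + 1) ^ d * (2 ^ m) ^ d
      = 2 ^ (4 ^ (n + 1) * (2 * (2 * m + 1) + 1) ^ d + m * d) := by
    unfold K
    rw [← pow_mul, ← pow_mul, ← pow_add]
  rw [this]
  push_cast
  rw [Real.logb_pow, Real.logb_self_eq_one one_lt_two]
  push_cast
  ring

lemma lev_RL (d n m : ℕ) (hm : 1 ≤ m) (ν : Measure (XX d)) [IsProbabilityMeasure ν]
    (hν : ν (lev d n) = 1) (ε : ℝ) (hε : 2 * (1 / 2 : ℝ) ^ m < ε) :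
    RL d (TT d) ν m ε ≤ ENNReal.ofReal ((4 * m + 3 : ℝ) ^ d * 4 ^ (n + 1) + m * d) := by
  classical
  have hmpos : (0 : ℝ) < m := by exact_mod_cast hm
  rw [← log_card]
  refine rate_upper (TT_action d) ν hmpos hε _
    (fun i => pt n (fun j => if h : j ∈ win d (2 * m + 1) then i.1 ⟨j, h⟩ else 0)
      (fun l => ((i.2 l : ℕ) : ℝ) / 2 ^ m)) ?_
  have hae : ∀ᵐ x ∂ν, x ∈ lev d n := by
    rw [ae_iff]
    have := prob_compl_eq_zero_iff (μ := ν) (lev_measurable d n)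
    exact this.2 hν
  filter_upwards [hae] with x hx
  obtain ⟨z, θ, rfl⟩ := hx
  obtain ⟨z, θ, h, hθ⟩ := pt_normalize n z θ
  rw [h]
  have h2m : (0 : ℝ) < 2 ^ m := by positivity
  refine ⟨(fun j => z j, fun l => ⟨⌊θ l * 2 ^ m⌋₊, ?_⟩), ?_⟩
  · have h1 := Nat.floor_le (mul_nonneg (hθ l).1 h2m.le)
    have h2 : ((⌊θ l * 2 ^ m⌋₊ : ℕ) : ℝ) < ((2 ^ m : ℕ) : ℝ) := by
      push_cast
      nlinarith [(hθ l).2]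
    exact_mod_cast h2
  intro u hu
  have hu' := norm_le_of_mem_box hmpos.le hu
  rw [TT_pt, TT_pt]
  refine (pt_close n _ _ _ _ m ?_).trans ?_
  · intro v hv
    have hθn : ‖θ‖ ≤ 1 := by
      rw [pi_norm_le_iff_of_nonneg zero_le_one]
      intro i
      rw [Real.norm_eq_abs, abs_of_nonneg (hθ i).1]
      exact (hθ i).2.le
    have hmem : fl (v + (θ + u)) ∈ win d (2 * m + 1) := by
      refine fl_mem_win _ _ ?_
      have h1 := norm_add_le v (θ + u)
      have h2 := norm_add_le θ u
      push_cast
      linarith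
    rw [dif_pos hmem]
  · have e1 : Real.exp (-(m : ℝ)) ≤ (1 / 2) ^ m := by
      have h1 : Real.exp (-(m : ℝ)) = (Real.exp (-1)) ^ m := by
        rw [← Real.exp_nat_mul]; congr 1; ring
      rw [h1]
      refine pow_le_pow_left₀ (Real.exp_pos _).le ?_ m
      rw [Real.exp_neg, one_div]
      refine inv_anti₀ (by norm_num) ?_
      have := Real.add_one_le_exp (1 : ℝ)
      linarith
    rw [add_sub_add_right_eq_sub]
    have e2 : ‖θ - fun l => ((⌊θ l * 2 ^ m⌋₊ : ℕ) : ℝ) / 2 ^ m‖ ≤ (1 / 2) ^ m := by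
      rw [pi_norm_le_iff_of_nonneg (by positivity)]
      intro l
      have h1 := Nat.floor_le (mul_nonneg (hθ l).1 h2m.le)
      have h2 := Nat.lt_floor_add_one (θ l * 2 ^ m)
      have e : (1 / 2 : ℝ) ^ m = 1 / 2 ^ m := by rw [one_div_pow]
      rw [Pi.sub_apply, Real.norm_eq_abs, e]
      have e3 : θ l - (⌊θ l * 2 ^ m⌋₊ : ℝ) / 2 ^ m = (θ l * 2 ^ m - (⌊θ l * 2 ^ m⌋₊ : ℝ)) / 2 ^ m := by
        field_simp
      rw [e3, abs_of_nonneg (div_nonneg (by linarith) h2m.le)]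
      exact div_le_div_of_nonneg_right (by linarith) h2m.le
    have := add_le_add e2 e1
    linarith

lemma lev_RD (d n : ℕ) (hd : 0 < d) (ν : Measure (XX d)) [IsProbabilityMeasure ν]
    (hν : ν (lev d n) = 1) (ε : ℝ) (hε : 0 < ε) :
    RD d (TT d) ν ε ≤ ENNReal.ofReal (7 ^ d * 4 ^ (n + 1) + d) := by
  obtain ⟨m, hm⟩ : ∃ m : ℕ, (1 / 2 : ℝ) ^ m < ε / 2 :=
    exists_pow_lt_of_lt_one (half_pos hε) (by norm_num)
  have hm' : 2 * (1 / 2 : ℝ) ^ (m + 1) < ε := by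
    rw [pow_succ]
    have : (0 : ℝ) < (1 / 2) ^ m := by positivity
    linarith
  set M := m + 1
  have hM1 : (1 : ℝ) ≤ M := by exact_mod_cast (by omega : 1 ≤ M)
  have hM : (0 : ℝ) < M := by linarith
  unfold RD
  refine iInf_le_of_le (M : ℝ) (iInf_le_of_le hM ?_)
  have := lev_RL d n M (by omega) ν hν ε hm'
  refine (ENNReal.div_le_div_right this _).trans ?_
  rw [← ENNReal.ofReal_div_of_pos (by positivity)]
  refine ENNReal.ofReal_le_ofReal ?_
  rw [div_le_iff₀ (by positivity)]
  have h1 : (4 * M + 3 : ℝ) ^ d ≤ 7 ^ d * (M : ℝ) ^ d := by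
    rw [← mul_pow]
    exact pow_le_pow_left₀ (by positivity) (by linarith) d
  have h2 : (M : ℝ) ≤ (M : ℝ) ^ d := le_self_pow₀ hM1 hd.ne'
  have h3 := mul_le_mul_of_nonneg_right h1 (show (0 : ℝ) ≤ 4 ^ (n + 1) by positivity)
  have h4 := mul_le_mul_of_nonneg_right h2 (show (0 : ℝ) ≤ d by positivity)
  linarith

lemma fixed_RD (d : ℕ) (ν : Measure (XX d)) [IsProbabilityMeasure ν]
    (hν : ν {x0 d} = 1) (ε : ℝ) (hε : 0 < ε) :
    RD d (TT d) ν ε ≤ 0 := by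
  unfold RD
  refine iInf_le_of_le 1 (iInf_le_of_le one_pos ?_)
  have hae : ∀ᵐ x ∂ν, x ∈ ({x0 d} : Set (XX d)) := by
    rw [ae_iff]
    exact (prob_compl_eq_zero_iff (μ := ν) (measurableSet_singleton _)).2 hν
  have := rate_upper (TT_action d) ν one_pos hε Unit (fun _ => x0 d) (by
    filter_upwards [hae] with x hx
    refine ⟨(), fun u _ => ?_⟩
    rw [mem_singleton_iff.1 hx, dist_self])
  simp at this
  simp [this]

lemma tendsto_log : Tendsto (fun ε : ℝ => Real.logb 2 (1 / ε)) (𝓝[>] (0 : ℝ)) atTop := by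
  have h1 : Tendsto (fun ε : ℝ => 1 / ε) (𝓝[>] (0 : ℝ)) atTop := by
    simp only [one_div]
    exact tendsto_inv_nhdsGT_zero
  exact (Real.tendsto_logb_atTop one_lt_two).comp h1

lemma rdim_zero_of_bounded {d : ℕ} (ν : Measure (XX d)) (C : ℝ)
    (h : ∀ ε, 0 < ε → RD d (TT d) ν ε ≤ ENNReal.ofReal C) :
    urdim d (TT d) ν = 0 ∧ lrdim d (TT d) ν = 0 := by
  have hlim : Tendsto (fun ε : ℝ => RD d (TT d) ν ε / ENNReal.ofReal (Real.logb 2 (1 / ε)))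
      (𝓝[>] (0 : ℝ)) (𝓝 0) := by
    have h1 : Tendsto (fun ε : ℝ => ENNReal.ofReal C / ENNReal.ofReal (Real.logb 2 (1 / ε)))
        (𝓝[>] (0 : ℝ)) (𝓝 0) := by
      have h2 := ENNReal.tendsto_ofReal_atTop.comp tendsto_log
      have h3 := ENNReal.Tendsto.const_div (a := ENNReal.ofReal C) h2
        (Or.inr ENNReal.ofReal_ne_top)
      simpa using h3
    refine tendsto_of_tendsto_of_tendsto_of_le_of_le' tendsto_const_nhds h1
      (Eventually.of_forall fun _ => zero_le) ?_
    filter_upwards [self_mem_nhdsWithin] with ε hε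
    exact ENNReal.div_le_div_right (h ε hε) _
  exact ⟨hlim.limsup_eq, hlim.liminf_eq⟩

lemma ergodic_zero (d : ℕ) (hd : 0 < d) (ν : Measure (XX d)) [IsProbabilityMeasure ν]
    (herg : MeasErgodic d (TT d) ν) : urdim d (TT d) ν = 0 ∧ lrdim d (TT d) ν = 0 := by
  by_cases h : ∃ n, ν (lev d n) = 1
  · obtain ⟨n, hn⟩ := h
    exact rdim_zero_of_bounded ν _ (lev_RD d n hd ν hn)
  · push Not at h
    have h0 : ∀ n, ν (lev d n) = 0 := fun n =>
      (herg (lev d n) (lev_measurable d n) (fun u => TT_lev u n)).resolve_right (h n)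
    refine rdim_zero_of_bounded ν 0 fun ε hε => ?_
    rw [ENNReal.ofReal_zero]
    refine fixed_RD d ν ?_ ε hε
    rw [← prob_compl_eq_zero_iff (measurableSet_singleton _)]
    refine measure_mono_null ?_ (measure_iUnion_null h0)
    intro x hx
    rcases XX_cases x with h1 | ⟨n, z, θ, h1⟩
    · exact absurd h1 hx
    · exact mem_iUnion.2 ⟨n, z, θ, h1⟩

end RDProof

open MeasureTheory Filter Set
open scoped ENNReal Topology NNReal

namespace RDProof

/-- uniform measure on the alphabet -/
noncomputable def unif (n : ℕ) : Measure (Fin (K n)) := (PMF.uniformOfFintype (Fin (K n))).toMeasure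

instance (n : ℕ) : IsProbabilityMeasure (unif n) := by unfold unif; infer_instance

lemma unif_singleton (n : ℕ) (a : Fin (K n)) : unif n {a} = (K n : ℝ≥0∞)⁻¹ := by
  unfold unif
  rw [PMF.toMeasure_apply_singleton _ _ (measurableSet_singleton a)]
  simp

/-- Bernoulli measure on configurations -/
noncomputable def ZZ (d n : ℕ) : Measure ((Fin d → ℤ) → Fin (K n)) :=
  Measure.infinitePi (fun _ : Fin d → ℤ => unif n)

instance (d n : ℕ) : IsProbabilityMeasure (ZZ d n) := by unfold ZZ; infer_instance

lemma ZZ_shift (d n : ℕ) (j : Fin d → ℤ) :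
    (ZZ d n).map (fun z i => z (i + j)) = ZZ d n := by
  classical
  unfold ZZ
  refine Measure.eq_infinitePi _ fun s t ht => ?_
  rw [Measure.map_apply (by fun_prop) (.pi s.countable_toSet fun _ _ => ht _)]
  have : (fun (z : (Fin d → ℤ) → Fin (K n)) i => z (i + j)) ⁻¹' ((s : Set (Fin d → ℤ)).pi t) =
      ((s.image (· + j) : Finset (Fin d → ℤ)) : Set (Fin d → ℤ)).pi (fun i => t (i - j)) := by
    ext z
    simp only [mem_preimage, Set.mem_pi, Finset.coe_image, mem_image, SetLike.mem_coe]
    constructor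
    · rintro h _ ⟨i, hi, rfl⟩
      simpa using h i hi
    · intro h i hi
      simpa using h (i + j) ⟨i, hi, rfl⟩
  rw [this, Measure.infinitePi_pi _ (fun i _ => ht _),
    Finset.prod_image (fun a _ b _ h => add_right_cancel h)]
  simp

instance (d : ℕ) : IsProbabilityMeasure (boxMeasure d 1) :=
  ⟨by rw [boxMeasure_univ d 1 zero_le_one]; simp⟩

lemma pt_meas (d n : ℕ) : Measurable
    fun p : ((Fin d → ℤ) → Fin (K n)) × (Fin d → ℝ) => pt n p.1 p.2 :=
  (pt_continuous d n).measurable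

/-- the invariant measure at level `n` -/
noncomputable def mun (d n : ℕ) : Measure (XX d) :=
  ((ZZ d n).prod (boxMeasure d 1)).map (fun p => pt n p.1 p.2)

instance (d n : ℕ) : IsProbabilityMeasure (mun d n) := by
  unfold mun
  exact Measure.isProbabilityMeasure_map (pt_meas d n).aemeasurable

lemma lint_mun (d n : ℕ) (h : XX d → ℝ≥0∞) (hh : Measurable h) :
    ∫⁻ x, h x ∂(mun d n) = ∫⁻ θ, ∫⁻ z, h (pt n z θ) ∂(ZZ d n) ∂(boxMeasure d 1) := by
  unfold mun
  rw [lintegral_map hh (pt_meas d n), 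
    lintegral_prod_symm (fun p : ((Fin d → ℤ) → Fin (K n)) × (Fin d → ℝ) => h (pt n p.1 p.2))
      (hh.comp (pt_meas d n)).aemeasurable]

lemma periodic_box {d : ℕ} (g : (Fin d → ℝ) → ℝ≥0∞)
    (hp : ∀ t j, g (t + iv j) = g t) (v : Fin d → ℝ) :
    ∫⁻ θ, g (θ + v) ∂(boxMeasure d 1) = ∫⁻ θ, g θ ∂(boxMeasure d 1) := by
  have hF := ZSpan.isAddFundamentalDomain (Pi.basisFun ℝ (Fin d)) (volume : Measure (Fin d → ℝ))
  have hbox : ZSpan.fundamentalDomain (Pi.basisFun ℝ (Fin d)) = unitBox d 1 :=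
    ZSpan.fundamentalDomain_pi_basisFun
  rw [hbox] at hF
  have hF2 := hF.vadd_of_comm v
  have hinv : VAddInvariantMeasure (Submodule.span ℤ (range (Pi.basisFun ℝ (Fin d)))) (Fin d → ℝ)
      volume := inferInstanceAs <| VAddInvariantMeasure
        (Submodule.span ℤ (range (Pi.basisFun ℝ (Fin d)))).toAddSubgroup (Fin d → ℝ) volume
  have hg : ∀ (γ : Submodule.span ℤ (range (Pi.basisFun ℝ (Fin d)))) (x : Fin d → ℝ),
      g (γ +ᵥ x) = g x := by
    rintro ⟨γ, hγ⟩ x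
    rw [Module.Basis.mem_span_iff_repr_mem] at hγ
    choose j hj using hγ
    have : γ = iv j := by
      ext i
      have := hj i
      simp at this
      simp [iv, this]
    change g (γ + x) = g x
    rw [add_comm, this, hp]
  have h := hF2.setLIntegral_eq hF g hg
  unfold boxMeasure
  rw [← h]
  have h2 := (measurePreserving_vadd v (volume : Measure (Fin d → ℝ))).setLIntegral_comp_emb
    (measurableEmbedding_const_vadd v) g (unitBox d 1)
  rw [image_vadd] at h2
  refine Eq.trans (lintegral_congr fun θ => ?_) h2
  rw [vadd_eq_add, add_comm]

lemma mun_inv (d n : ℕ) : MeasInvariant d (TT d) (mun d n) := by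
  intro v
  have hc : Measurable (TT d v) := by
    have : Continuous (TT d v) := (TT_action d).1.comp (continuous_const.prodMk continuous_id)
    exact this.measurable
  refine Measure.ext_of_lintegral _ fun h hh => ?_
  rw [lintegral_map hh hc, lint_mun d n (fun a => h (TT d v a)) (hh.comp hc), lint_mun d n h hh]
  simp_rw [TT_pt]
  refine periodic_box (fun θ => ∫⁻ z, h (pt n z θ) ∂(ZZ d n)) (fun t j => ?_) v
  simp_rw [pt_shift]
  conv_rhs => rw [← ZZ_shift d n j]
  have hm : Measurable (fun z : (Fin d → ℤ) → Fin (K n) => h (pt n z t)) :=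
    hh.comp ((pt_meas d n).comp (measurable_id.prodMk measurable_const))
  rw [lintegral_map hm (by fun_prop)]

lemma mun_lev (d n : ℕ) : mun d n (lev d n) = 1 := by
  unfold mun
  rw [Measure.map_apply (pt_meas d n) (lev_measurable d n)]
  have : (fun p : ((Fin d → ℤ) → Fin (K n)) × (Fin d → ℝ) => pt n p.1 p.2) ⁻¹' lev d n = univ :=
    eq_univ_of_forall fun p => ⟨p.1, p.2, rfl⟩
  rw [this, measure_univ]

lemma mun_lev_ne (d : ℕ) {n m : ℕ} (h : m ≠ n) : mun d n (lev d m) = 0 := by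
  unfold mun
  rw [Measure.map_apply (pt_meas d n) (lev_measurable d m)]
  have : (fun p : ((Fin d → ℤ) → Fin (K n)) × (Fin d → ℝ) => pt n p.1 p.2) ⁻¹' lev d m = ∅ :=
    eq_empty_of_forall_notMem fun p hp => lev_disjoint h hp ⟨p.1, p.2, rfl⟩
  rw [this, measure_empty]

/-- weights -/
noncomputable def wt (n : ℕ) : ℝ≥0∞ := (2⁻¹ : ℝ≥0∞) ^ (n + 1)

/-- the non-ergodic measure -/
noncomputable def mu (d : ℕ) : Measure (XX d) := Measure.sum fun n => wt n • mun d n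

instance (d : ℕ) : IsProbabilityMeasure (mu d) := by
  refine ⟨?_⟩
  unfold mu
  rw [Measure.sum_apply _ MeasurableSet.univ]
  simp only [Measure.smul_apply, measure_univ, smul_eq_mul, mul_one, wt]
  rw [ENNReal.tsum_geometric_add_one, ENNReal.one_sub_inv_two, inv_inv]
  exact ENNReal.inv_mul_cancel two_ne_zero ENNReal.ofNat_ne_top

lemma mu_inv (d : ℕ) : MeasInvariant d (TT d) (mu d) := by
  intro v
  have hc : Measurable (TT d v) := by
    have : Continuous (TT d v) := (TT_action d).1.comp (continuous_const.prodMk continuous_id)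
    exact this.measurable
  unfold mu
  rw [Measure.map_sum hc.aemeasurable]
  congr 1
  funext n
  rw [Measure.map_smul, mun_inv d n v]

lemma mu_restrict (d n : ℕ) : (mu d).restrict (lev d n) = wt n • mun d n := by
  unfold mu
  rw [Measure.restrict_sum _ (lev_measurable d n)]
  ext s hs
  rw [Measure.sum_apply _ hs, tsum_eq_single n]
  · rw [Measure.restrict_smul, Measure.restrict_eq_self_of_ae_mem]
    exact (prob_compl_eq_zero_iff (lev_measurable d n)).2 (mun_lev d n)
  · intro m hm
    rw [Measure.restrict_smul, Measure.smul_apply, Measure.restrict_apply hs]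
    rw [measure_mono_null inter_subset_right (mun_lev_ne d hm.symm), smul_zero]

lemma mu_real_lev (d n : ℕ) : (mu d).real (lev d n) = (1 / 2) ^ (n + 1) := by
  have : mu d (lev d n) = wt n := by
    rw [← Measure.restrict_apply_univ, mu_restrict]
    simp
  rw [Measure.real, this, wt]
  simp

end RDProof

open MeasureTheory Filter Set
open scoped ENNReal Topology NNReal

namespace RDProof

lemma sep {d n : ℕ} (z z' : (Fin d → ℤ) → Fin (K n)) (θ u : Fin d → ℝ)
    (hne : z (fl (u + θ)) ≠ z' (fl (u + θ))) :
    amp n / 4 ≤ dist (TT d u (pt n z θ)) (TT d u (pt n z' θ)) := by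
  set j := fl (u + θ) with hj
  have h := le_dd (TT d u (pt n z θ)) (TT d u (pt n z' θ)) (z j) (ctr j - (u + θ))
  rw [dist_def]
  refine le_trans ?_ h
  have e1 : (TT d u (pt n z θ)).1 (z j) (ctr j - (u + θ)) = amp n / 2 := by
    change G n z (z j) (ctr j - (u + θ) + u + θ) = _
    rw [add_assoc, sub_add_cancel]
    unfold G
    rw [fl_ctr, if_pos rfl, sub_self, norm_zero]
    ring
  have e2 : (TT d u (pt n z' θ)).1 (z j) (ctr j - (u + θ)) = 0 := by
    change G n z' (z j) (ctr j - (u + θ) + u + θ) = _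
    rw [add_assoc, sub_add_cancel]
    unfold G
    rw [fl_ctr, if_neg]
    intro h
    exact hne (Fin.ext h.symm)
  have hn : ‖ctr j - (u + θ)‖ ≤ 1 / 2 := by
    rw [← norm_neg, neg_sub]
    exact norm_sub_ctr_le (u + θ)
  have hpos := amp_pos n
  rw [e1, e2, sub_zero, abs_of_pos (by positivity)]
  have hexp : 1 / 2 ≤ Real.exp (-‖ctr j - (u + θ)‖) := by
    have := Real.add_one_le_exp (-‖ctr j - (u + θ)‖)
    linarith
  nlinarith

/-- which half of the box is used -/
noncomputable def sg (h x : ℝ) : ℤ := if x < 1 - h / 2 then 0 else 1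

/-- the cell index -/
noncomputable def cell {d N : ℕ} (h : ℝ) (θ : Fin d → ℝ) (i : Fin d → Fin N) : Fin d → ℤ :=
  fun l => 2 * ((i l : ℕ) : ℤ) + sg h (θ l)

/-- the piece of the time box -/
noncomputable def piece {d N : ℕ} (h : ℝ) (θ : Fin d → ℝ) (i : Fin d → Fin N) : Set (Fin d → ℝ) :=
  univ.pi fun l => Ico (2 * ((i l : ℕ) : ℝ) + sg h (θ l) * (h / 2))
    (2 * ((i l : ℕ) : ℝ) + sg h (θ l) * (h / 2) + h / 2)

lemma cell_injective {d N : ℕ} (h : ℝ) (θ : Fin d → ℝ) :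
    Function.Injective (cell (N := N) h θ) := by
  intro i i' hii
  funext l
  have := congrFun hii l
  simp only [cell] at this
  apply Fin.ext
  omega

lemma fl_piece {d N : ℕ} {h : ℝ} (hh : 0 < h) (hh1 : h ≤ 1) {θ : Fin d → ℝ} (hθ : θ ∈ unitBox d 1)
    (i : Fin d → Fin N) {u : Fin d → ℝ} (hu : u ∈ piece h θ i) : fl (u + θ) = cell h θ i := by
  funext l
  have h1 := hu l (mem_univ l)
  have h2 := hθ l (mem_univ l)
  simp only [fl, cell, Pi.add_apply]
  rw [Int.floor_eq_iff]
  simp only [mem_Ico, sg] at h1 h2 ⊢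
  split_ifs at h1 ⊢ with hc <;> push_cast at * <;> constructor <;> linarith

lemma piece_disjoint {d N : ℕ} {h : ℝ} (hh : 0 < h) (hh1 : h ≤ 1) {θ : Fin d → ℝ}
    (hθ : θ ∈ unitBox d 1) : Pairwise (Function.onFun Disjoint (piece (N := N) h θ)) := by
  intro i i' hii
  refine Set.disjoint_left.2 fun u hu hu' => hii (cell_injective h θ ?_)
  rw [← fl_piece hh hh1 hθ i hu, ← fl_piece hh hh1 hθ i' hu']

lemma piece_measurable {d N : ℕ} (h : ℝ) (θ : Fin d → ℝ) (i : Fin d → Fin N) :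
    MeasurableSet (piece h θ i) := MeasurableSet.univ_pi fun _ => measurableSet_Ico

lemma piece_subset {d N : ℕ} {h L : ℝ} (hh : 0 < h) (hN : 2 * ((N : ℝ) - 1) + h ≤ L)
    (θ : Fin d → ℝ) (i : Fin d → Fin N) : piece h θ i ⊆ unitBox d L := by
  intro u hu l _
  have h1 := hu l (mem_univ l)
  have hi : ((i l : ℕ) : ℝ) + 1 ≤ N := by exact_mod_cast (i l).2
  have hi0 : (0 : ℝ) ≤ ((i l : ℕ) : ℝ) := by positivity
  simp only [mem_Ico, sg] at h1 ⊢
  split_ifs at h1 with hc <;> push_cast at * <;> constructor <;> linarith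

lemma piece_vol {d N : ℕ} {h L : ℝ} (hh : 0 < h) (hN : 2 * ((N : ℝ) - 1) + h ≤ L)
    (θ : Fin d → ℝ) (i : Fin d → Fin N) : (boxMeasure d L).real (piece h θ i) = (h / 2) ^ d := by
  unfold boxMeasure
  rw [Measure.real, Measure.restrict_apply (piece_measurable h θ i),
    inter_eq_left.2 (piece_subset hh hN θ i), piece, Real.volume_pi_Ico]
  simp only [add_sub_cancel_left, Finset.prod_const, Finset.card_univ, Fintype.card_fin]
  rw [ENNReal.toReal_pow, ENNReal.toReal_ofReal (by positivity)]

lemma hamming {d n N : ℕ} {h L : ℝ} (hL : 0 < L) (hh : 0 < h) (hh1 : h ≤ 1)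
    (hN : 2 * ((N : ℝ) - 1) + h ≤ L) {θ : Fin d → ℝ} (hθ : θ ∈ unitBox d 1)
    (y : L1Maps d L (XX d)) : ∃ a : (Fin d → Fin N) → Fin (K n), ∀ z : (Fin d → ℤ) → Fin (K n),
      ∑ i, (if z (cell h θ i) = a i then 0 else amp n / 8 * (h / 2) ^ d) ≤
        ∫ u, dist (TT d u (pt n z θ)) (y u) ∂(boxMeasure d L) := by
  classical
  have := isFiniteMeasure_box d L hL.le
  have hint := fun z : (Fin d → ℤ) → Fin (K n) =>
    Dbar_integrable (TT_action d) hL (pt n z θ) y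
  set τ := amp n / 8 * (h / 2) ^ d with hτ
  have hτ0 : 0 ≤ τ := by have := amp_pos n; positivity
  have key : ∀ i : Fin d → Fin N, ∃ a : Fin (K n), ∀ z : (Fin d → ℤ) → Fin (K n),
      (if z (cell h θ i) = a then 0 else τ) ≤
        ∫ u in piece h θ i, dist (TT d u (pt n z θ)) (y u) ∂(boxMeasure d L) := by
    intro i
    have hnn : ∀ z : (Fin d → ℤ) → Fin (K n),
        0 ≤ ∫ u in piece h θ i, dist (TT d u (pt n z θ)) (y u) ∂(boxMeasure d L) :=
      fun z => integral_nonneg fun _ => dist_nonneg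
    by_cases hex : ∃ z' : (Fin d → ℤ) → Fin (K n),
        ∫ u in piece h θ i, dist (TT d u (pt n z' θ)) (y u) ∂(boxMeasure d L) < τ
    · obtain ⟨z', hz'⟩ := hex
      refine ⟨z' (cell h θ i), fun z => ?_⟩
      split_ifs with hc
      · exact hnn z
      · have h1 := setIntegral_ge_of_const_le_real (μ := boxMeasure d L) (c := amp n / 4)
          (f := fun u => dist (TT d u (pt n z θ)) (y u) + dist (TT d u (pt n z' θ)) (y u))
          (piece_measurable h θ i) (measure_ne_top _ _) (fun u hu => ?_)
          ((hint z).add (hint z')).integrableOn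
        · rw [integral_add (hint z).integrableOn (hint z').integrableOn, piece_vol hh hN] at h1
          have : amp n / 4 * (h / 2) ^ d = 2 * τ := by rw [hτ]; ring
          linarith
        · have hf := fl_piece hh hh1 hθ i hu
          have := sep z z' θ u (by rw [hf]; exact hc)
          exact this.trans (dist_triangle_right _ _ _)
    · push Not at hex
      refine ⟨0, fun z => ?_⟩
      split_ifs with hc
      · exact hnn z
      · exact hex z
  choose a ha using key
  refine ⟨a, fun z => ?_⟩
  refine (Finset.sum_le_sum fun i _ => ha i z).trans ?_
  rw [← integral_iUnion_fintype (fun i => piece_measurable h θ i) (piece_disjoint hh hh1 hθ)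
    fun i => (hint z).integrableOn]
  exact setIntegral_le_integral (hint z) (Eventually.of_forall fun _ => dist_nonneg)

lemma ZZ_marg {d n : ℕ} {ι : Type} [Fintype ι] (j : ι → Fin d → ℤ) (hj : Function.Injective j) :
    (ZZ d n).map (fun z i => z (j i)) = Measure.pi fun _ : ι => unif n := by
  classical
  refine (Measure.pi_eq fun t ht => ?_).symm
  rw [Measure.map_apply (by fun_prop) (MeasurableSet.univ_pi ht)]
  let t' : (Fin d → ℤ) → Set (Fin (K n)) := fun k => if hk : ∃ i, j i = k then t hk.choose else univ
  have ht' : ∀ i, t' (j i) = t i := by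
    intro i
    have hk : ∃ i', j i' = j i := ⟨i, rfl⟩
    simp only [t', dif_pos hk]
    rw [hj hk.choose_spec]
  have : (fun (z : (Fin d → ℤ) → Fin (K n)) i => z (j i)) ⁻¹' (univ.pi t) =
      ((Finset.univ.image j : Finset (Fin d → ℤ)) : Set (Fin d → ℤ)).pi t' := by
    ext z
    simp [Set.mem_pi, ht']
  unfold ZZ
  rw [this, Measure.infinitePi_pi _ (fun _ _ => MeasurableSet.of_discrete),
    Finset.prod_image (fun a _ b _ h => hj h)]
  simp [ht']

lemma unif_int (n : ℕ) (a : Fin (K n)) (q : ℝ) (hq : 0 ≤ q) :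
    ∫ x, (if x = a then 1 else q) ∂(unif n) ≤ (K n : ℝ)⁻¹ + q := by
  classical
  rw [integral_fintype .of_finite]
  have hk : (0 : ℝ) < K n := by exact_mod_cast NeZero.pos (K n)
  have h1 : ∀ x : Fin (K n), (unif n).real {x} • (if x = a then (1 : ℝ) else q) ≤
      (K n : ℝ)⁻¹ * ((if x = a then 1 else 0) + q) := by
    intro x
    rw [Measure.real, unif_singleton, smul_eq_mul, ENNReal.toReal_inv, ENNReal.toReal_natCast]
    refine mul_le_mul_of_nonneg_left ?_ (by positivity)
    split_ifs <;> linarith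
  refine (Finset.sum_le_sum fun x _ => h1 x).trans ?_
  rw [← Finset.mul_sum, Finset.sum_add_distrib]
  simp
  rw [mul_add, inv_mul_cancel_left₀ hk.ne']
  simp

lemma exp_bound {d n N : ℕ} (h : ℝ) (θ : Fin d → ℝ) (a : (Fin d → Fin N) → Fin (K n)) (q : ℝ)
    (hq : 0 ≤ q) : ∫ z, ∏ i, (if z (cell h θ i) = a i then 1 else q) ∂(ZZ d n) ≤
      ((K n : ℝ)⁻¹ + q) ^ (N ^ d) := by
  classical
  have h1 := integral_fintype_prod_eq_prod (𝕜 := ℝ) (μ := fun _ : Fin d → Fin N => unif n)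
    (fun i x => if x = a i then 1 else q)
  rw [← ZZ_marg (cell h θ) (cell_injective h θ), integral_map
    (measurable_pi_lambda _ fun i => measurable_pi_apply (cell h θ i)).aemeasurable
    (AEStronglyMeasurable.of_discrete)] at h1
  rw [h1]
  refine (Finset.prod_le_prod (fun i _ => integral_nonneg fun x => ?_)
    (fun i _ => unif_int n (a i) q hq)).trans ?_
  · dsimp only; split_ifs <;> simp [hq]
  · simp

lemma level_bound {d n N : ℕ} {h L : ℝ} (hL : 0 < L) (hh : 0 < h) (hh1 : h ≤ 1)
    (hN : 2 * ((N : ℝ) - 1) + h ≤ L) (y : L1Maps d L (XX d)) (s : ℝ)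
    (hs : s = L ^ d * Real.log (K n) / (amp n / 8 * (h / 2) ^ d)) :
    ∫ x, Real.exp (- (s * Dbar d (TT d) L x y)) ∂(mun d n) ≤ (2 / (K n : ℝ)) ^ (N ^ d) := by
  have hk : (0 : ℝ) < K n := by exact_mod_cast NeZero.pos (K n)
  have hk1 : (1 : ℝ) ≤ K n := by exact_mod_cast NeZero.pos (K n)
  have hlog : 0 ≤ Real.log (K n) := Real.log_nonneg hk1
  set τ := amp n / 8 * (h / 2) ^ d with hτ
  have hτ0 : 0 < τ := by have := amp_pos n; positivity
  have hs0 : 0 ≤ s := by rw [hs]; positivity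
  have hcont : Continuous fun x : XX d => Real.exp (- (s * Dbar d (TT d) L x y)) :=
    Real.continuous_exp.comp
      ((Dbar_continuous (TT_action d) (fun u x x' => TT_lip u x x') hL y).const_mul s).neg
  have hle1 : ∀ x : XX d, Real.exp (- (s * Dbar d (TT d) L x y)) ≤ 1 := fun x =>
    Real.exp_le_one_iff.2 (neg_nonpos.2 (mul_nonneg hs0 (Dbar_nonneg hL x y)))
  have hbd : ∀ x : XX d, ‖Real.exp (- (s * Dbar d (TT d) L x y))‖ ≤ 1 := fun x => by
    rw [Real.norm_eq_abs, abs_of_pos (Real.exp_pos _)]; exact hle1 x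
  unfold mun
  rw [integral_map (pt_meas d n).aemeasurable hcont.aestronglyMeasurable]
  rw [integral_prod_symm (fun p : ((Fin d → ℤ) → Fin (K n)) × (Fin d → ℝ) =>
    Real.exp (- (s * Dbar d (TT d) L (pt n p.1 p.2) y))) (Integrable.of_bound
    (hcont.comp (pt_continuous d n)).aestronglyMeasurable 1 (Eventually.of_forall fun p => hbd _))]
  have inner : ∀ θ ∈ unitBox d 1,
      ∫ z, Real.exp (- (s * Dbar d (TT d) L (pt n z θ) y)) ∂(ZZ d n) ≤
        (2 / (K n : ℝ)) ^ (N ^ d) := by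
    intro θ hθ
    obtain ⟨a, ha⟩ := hamming (n := n) hL hh hh1 hN hθ y
    have h2 := exp_bound h θ a (K n : ℝ)⁻¹ (by positivity)
    have e : (K n : ℝ)⁻¹ + (K n : ℝ)⁻¹ = 2 / K n := by ring
    rw [e] at h2
    refine le_trans (integral_mono_of_nonneg (Eventually.of_forall fun z => (Real.exp_pos _).le)
      ?_ (Eventually.of_forall fun z => ?_)) h2
    · refine Integrable.of_bound (C := 1) ?_ (Eventually.of_forall fun z => ?_)
      · refine Measurable.aestronglyMeasurable ?_
        refine Finset.measurable_prod _ fun i _ => ?_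
        exact (Measurable.of_discrete (f := fun x : Fin (K n) =>
          if x = a i then (1 : ℝ) else (K n : ℝ)⁻¹)).comp (measurable_pi_apply (cell h θ i))
      · rw [Real.norm_eq_abs, abs_of_nonneg]
        · refine Finset.prod_le_one (fun i _ => ?_) (fun i _ => ?_)
          · split_ifs <;> positivity
          · split_ifs
            · exact le_rfl
            · exact inv_le_one_of_one_le₀ hk1
        · exact Finset.prod_nonneg fun i _ => by split_ifs <;> positivity
    · dsimp only
      have e2 : ∏ i, (if z (cell h θ i) = a i then 1 else (K n : ℝ)⁻¹) =
          Real.exp (- (Real.log (K n) / τ * ∑ i, (if z (cell h θ i) = a i then 0 else τ))) := by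
        rw [Finset.mul_sum, ← Finset.sum_neg_distrib, Real.exp_sum]
        refine Finset.prod_congr rfl fun i _ => ?_
        split_ifs
        · simp
        · rw [div_mul_cancel₀ _ hτ0.ne', Real.exp_neg, Real.exp_log hk]
      rw [e2]
      refine Real.exp_le_exp.2 (neg_le_neg ?_)
      have e3 : s * Dbar d (TT d) L (pt n z θ) y = Real.log (K n) / τ *
          ∫ u, dist (TT d u (pt n z θ)) (y u) ∂(boxMeasure d L) := by
        unfold Dbar
        rw [hs]
        field_simp
      rw [e3]
      exact mul_le_mul_of_nonneg_left (ha z) (by positivity)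
  have h3 : ∫ θ, ∫ z, Real.exp (- (s * Dbar d (TT d) L (pt n z θ) y)) ∂(ZZ d n) ∂(boxMeasure d 1)
      ≤ ∫ _, (2 / (K n : ℝ)) ^ (N ^ d) ∂(boxMeasure d 1) := by
    refine integral_mono_of_nonneg (Eventually.of_forall fun θ =>
      integral_nonneg fun z => (Real.exp_pos _).le) (integrable_const _) ?_
    filter_upwards [ae_box] with θ hθ using inner θ hθ
  simpa using h3

end RDProof

open MeasureTheory Filter Set
open scoped ENNReal Topology NNReal

namespace RDProof

lemma log_K (n : ℕ) : Real.log (K n) = 4 ^ (n + 1) * Real.log 2 := by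
  unfold K
  push_cast
  rw [Real.log_pow]
  push_cast
  rfl

lemma exists_N {L : ℝ} (hL : 0 < L) : ∃ (h : ℝ) (N : ℕ), 0 < h ∧ h ≤ 1 ∧ 1 ≤ N ∧
    2 * ((N : ℝ) - 1) + h ≤ L ∧ L / h ≤ 4 * N ∧ L ≤ 4 * N := by
  rcases lt_or_ge L 1 with h1 | h1
  · refine ⟨L, 1, hL, h1.le, le_rfl, by simp, ?_, by push_cast; linarith⟩
    rw [div_self hL.ne']; norm_num
  · rcases lt_or_ge L 4 with h4 | h4
    · exact ⟨1, 1, one_pos, le_rfl, le_rfl, by simpa using h1, by push_cast; linarith,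
        by push_cast; linarith⟩
    · have hf := Nat.floor_le (show 0 ≤ L / 2 by linarith)
      have hf2 := Nat.lt_floor_add_one (L / 2)
      refine ⟨1, ⌊L / 2⌋₊, one_pos, le_rfl, Nat.le_floor (by push_cast; linarith), by linarith,
        by linarith, by linarith⟩

lemma RL_lower (d n : ℕ) {L ε : ℝ} (hL : 0 < L) (hε : 0 < ε)
    (hsm : 128 * 8 ^ d * ε ≤ (1 / 2) ^ (n + 1) * amp n) :
    ENNReal.ofReal ((1 / 4) ^ (d + 1) * 2 ^ (n + 1) * L ^ d) ≤ RL d (TT d) (mu d) L ε := by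
  obtain ⟨h, N, hh, hh1, hN1, hN, hLh, hLN⟩ := exists_N hL
  have hk : (0 : ℝ) < K n := by exact_mod_cast NeZero.pos (K n)
  have hl2 : 0 < Real.log 2 := Real.log_pos one_lt_two
  have hamp := amp_pos n
  have hlogk := log_K n
  have hlog0 : 0 < Real.log (K n) := by rw [hlogk]; positivity
  set M : ℕ := N ^ d with hM
  set s : ℝ := L ^ d * Real.log (K n) / (amp n / 8 * (h / 2) ^ d) with hs
  set c : ℝ := M * (Real.log (K n) - Real.log 2) with hc
  have hs0 : 0 ≤ s := by rw [hs]; positivity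
  have hexpc : Real.exp c * (2 / (K n : ℝ)) ^ M = 1 := by
    have : (2 / (K n : ℝ)) = Real.exp (-(Real.log (K n) - Real.log 2)) := by
      rw [neg_sub, Real.exp_sub, Real.exp_log two_pos, Real.exp_log hk]
    rw [this, ← Real.exp_nat_mul, ← Real.exp_add, hc]
    rw [mul_neg, add_neg_cancel, Real.exp_zero]
  have key := rate_lower (TT_action d) (fun u x x' => TT_lip u x x') (mu d) hL hε (lev d n)
    (lev_measurable d n) s c hs0 (fun y => by
      rw [mu_restrict, integral_smul_measure, mu_real_lev]
      have hw : (wt n).toReal = (1 / 2) ^ (n + 1) := by simp [wt]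
      rw [hw, smul_eq_mul]
      refine mul_le_of_le_one_right (by positivity) ?_
      have hb := level_bound (n := n) hL hh hh1 hN y s hs
      have e : ∀ x : XX d, Real.exp (c - s * Dbar d (TT d) L x y) =
          Real.exp c * Real.exp (-(s * Dbar d (TT d) L x y)) := fun x => by
        rw [← Real.exp_add, sub_eq_add_neg]
      simp_rw [e]
      rw [integral_const_mul, ← hexpc]
      exact mul_le_mul_of_nonneg_left hb (Real.exp_pos c).le)
  refine le_trans (ENNReal.ofReal_le_ofReal ?_) key
  rw [mu_real_lev]
  rw [le_div_iff₀ hl2]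
  set w : ℝ := (1 / 2) ^ (n + 1) with hw
  have hw0 : 0 < w := by positivity
  have hMp : (0 : ℝ) < M := by rw [hM]; positivity
  -- bound on c
  have h4 : (4 : ℝ) ≤ 4 ^ (n + 1) := by
    rw [pow_succ]
    have : (1 : ℝ) ≤ 4 ^ n := one_le_pow₀ (by norm_num)
    linarith
  have hc1 : M * (Real.log (K n) / 2) ≤ c := by
    rw [hc]
    refine mul_le_mul_of_nonneg_left ?_ hMp.le
    rw [hlogk]
    nlinarith
  -- bound on s
  have hLd : L ^ d / h ^ d ≤ 4 ^ d * M := by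
    rw [← div_pow, hM]
    push_cast
    rw [← mul_pow]
    exact pow_le_pow_left₀ (by positivity) hLh d
  have hs1 : s * amp n ≤ 8 * 8 ^ d * (M * Real.log (K n)) := by
    have e : s * amp n = 8 * 2 ^ d * Real.log (K n) * (L ^ d / h ^ d) := by
      rw [hs, div_pow]
      field_simp
    rw [e]
    have e8 : (8 : ℝ) ^ d = 2 ^ d * 4 ^ d := by rw [← mul_pow]; norm_num
    calc 8 * 2 ^ d * Real.log (K n) * (L ^ d / h ^ d)
        ≤ 8 * 2 ^ d * Real.log (K n) * (4 ^ d * M) :=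
          mul_le_mul_of_nonneg_left hLd (by positivity)
      _ = _ := by rw [e8]; ring
  have hs2 : 4 * s * ε ≤ w / 4 * (M * Real.log (K n)) := by
    have h1 : 4 * s * ε * amp n ≤ w / 4 * (M * Real.log (K n)) * amp n := by
      calc 4 * s * ε * amp n = 4 * ε * (s * amp n) := by ring
        _ ≤ 4 * ε * (8 * 8 ^ d * (M * Real.log (K n))) :=
          mul_le_mul_of_nonneg_left hs1 (by positivity)
        _ = (128 * 8 ^ d * ε) * (M * Real.log (K n) / 4) := by ring
        _ ≤ (w * amp n) * (M * Real.log (K n) / 4) :=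
          mul_le_mul_of_nonneg_right hsm (by positivity)
        _ = _ := by ring
    exact le_of_mul_le_mul_right h1 hamp
  have hML : L ^ d * (1 / 4) ^ d ≤ M := by
    rw [hM, ← mul_pow]
    push_cast
    exact pow_le_pow_left₀ (by positivity) (by linarith) d
  have e2 : (2 : ℝ) ^ (n + 1) = w * 4 ^ (n + 1) := by rw [hw, ← mul_pow]; norm_num
  calc (1 / 4) ^ (d + 1) * 2 ^ (n + 1) * L ^ d * Real.log 2
      = w / 4 * (4 ^ (n + 1) * Real.log 2) * (L ^ d * (1 / 4) ^ d) := by rw [e2]; ring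
    _ = w / 4 * Real.log (K n) * (L ^ d * (1 / 4) ^ d) := by rw [hlogk]
    _ ≤ w / 4 * Real.log (K n) * M := mul_le_mul_of_nonneg_left hML (by positivity)
    _ = w * (M * (Real.log (K n) / 2)) - w / 4 * (M * Real.log (K n)) := by ring
    _ ≤ w * c - 4 * s * ε := by
      have := mul_le_mul_of_nonneg_left hc1 hw0.le
      linarith

lemma RD_lower (d n : ℕ) {ε : ℝ} (hε : 0 < ε)
    (hsm : 128 * 8 ^ d * ε ≤ (1 / 2) ^ (n + 1) * amp n) :
    ENNReal.ofReal ((1 / 4) ^ (d + 1) * 2 ^ (n + 1)) ≤ RD d (TT d) (mu d) ε := by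
  unfold RD
  refine le_iInf fun L => le_iInf fun hL => ?_
  have hp : 0 < L ^ d := by positivity
  rw [ENNReal.le_div_iff_mul_le (Or.inl (by simpa using hp)) (Or.inl ENNReal.ofReal_ne_top),
    ← ENNReal.ofReal_mul (by positivity)]
  exact RL_lower d n hL hε hsm

lemma ratio_tendsto (d : ℕ) : Tendsto
    (fun ε : ℝ => RD d (TT d) (mu d) ε / ENNReal.ofReal (Real.logb 2 (1 / ε)))
    (𝓝[>] (0 : ℝ)) (𝓝 ⊤) := by
  have hN : Tendsto (fun ε : ℝ => ⌊Real.logb 2 (1 / ε) / 4⌋₊) (𝓝[>] (0 : ℝ)) atTop :=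
    tendsto_nat_floor_atTop.comp (tendsto_log.atTop_div_const (by norm_num))
  have hlow : Tendsto (fun n : ℕ => ENNReal.ofReal
      ((1 / 4) ^ (d + 1) * 2 ^ (n + 1) / (4 * ((n : ℝ) + 1)))) atTop (𝓝 ⊤) := by
    refine ENNReal.tendsto_ofReal_nhds_top.2 ?_
    have h0 := (tendsto_pow_const_div_const_pow_of_one_lt 1 (one_lt_two (α := ℝ))).comp
      (tendsto_add_atTop_nat 1)
    have h1 := (tendsto_nhdsWithin_iff.2 ⟨h0, Eventually.of_forall fun n =>
      (show (0 : ℝ) < (((n + 1 : ℕ) : ℝ) ^ 1 / 2 ^ (n + 1)) by positivity)⟩).inv_tendsto_nhdsGT_zero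
    have h2 := h1.const_mul_atTop
      (show (0 : ℝ) < (1 / 4) ^ (d + 1) / 4 by positivity)
    refine h2.congr fun n => ?_
    simp only [Function.comp_apply, Pi.inv_apply]
    push_cast
    field_simp
  refine tendsto_nhds_top_mono (hlow.comp hN) ?_
  have hsmall : ∀ᶠ ε : ℝ in 𝓝[>] (0 : ℝ), ε ≤ (1 / (256 * 8 ^ d)) ^ 2 := by
    filter_upwards [Ioo_mem_nhdsGT (show (0 : ℝ) < (1 / (256 * 8 ^ d)) ^ 2 by positivity)] with ε h
    exact h.2.le
  filter_upwards [self_mem_nhdsWithin, hsmall, tendsto_log.eventually_gt_atTop 0] with ε hε hs hl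
  have hε' : (0 : ℝ) < ε := hε
  simp only [Function.comp_apply]
  set l := Real.logb 2 (1 / ε) with hldef
  set n := ⌊l / 4⌋₊ with hn
  have hn1 : (n : ℝ) ≤ l / 4 := Nat.floor_le (by positivity)
  have hn2 : l / 4 < n + 1 := Nat.lt_floor_add_one _
  have hsm : 128 * 8 ^ d * ε ≤ (1 / 2) ^ (n + 1) * amp n := by
    have h1 : (2 : ℝ) ^ (4 * n) ≤ 1 / ε := by
      rw [← Real.rpow_natCast]
      rw [← Real.le_logb_iff_rpow_le one_lt_two (by positivity)]
      push_cast
      linarith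
    have h2 : ε * ((2 : ℝ) ^ n) ^ 4 ≤ 1 := by
      rw [← pow_mul, mul_comm n 4]
      rw [le_div_iff₀ hε'] at h1
      linarith
    set p : ℝ := (2 : ℝ) ^ n with hp
    have hp0 : 0 < p := by positivity
    have e : (1 / 2) ^ (n + 1) * amp n = (1 / 2) * (1 / p ^ 2) := by
      unfold amp
      rw [pow_succ, one_div_pow, ← hp]
      field_simp
    rw [e]
    set B : ℝ := 256 * 8 ^ d with hB
    have hB0 : 0 < B := by positivity
    have e2 : 128 * 8 ^ d * ε = (1 / 2) * (B * ε) := by rw [hB]; ring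
    rw [e2]
    refine mul_le_mul_of_nonneg_left ?_ (by norm_num)
    rw [le_div_iff₀ (by positivity)]
    have h3 : (B * ε * p ^ 2) ^ 2 ≤ 1 := by
      have h4 : B ^ 2 * ε ≤ 1 := by
        calc B ^ 2 * ε ≤ B ^ 2 * (1 / B) ^ 2 := mul_le_mul_of_nonneg_left hs (by positivity)
          _ = 1 := by field_simp
      calc (B * ε * p ^ 2) ^ 2 = (B ^ 2 * ε) * (ε * p ^ 4) := by ring
        _ ≤ 1 * 1 := mul_le_mul h4 h2 (by positivity) (by norm_num)
        _ = 1 := one_mul 1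
    exact (sq_le_one_iff₀ (by positivity)).1 h3
  have hRD := RD_lower d n hε' hsm
  rw [ENNReal.ofReal_div_of_pos (by positivity)]
  refine ENNReal.div_le_div hRD (ENNReal.ofReal_le_ofReal ?_)
  linarith

end RDProof

theorem exists_action_ergodic_rdim_zero_but_some_rdim_top (d : ℕ) (hd : 0 < d) :
    ∃ (X : Type) (_ : MetricSpace X) (_ : CompactSpace X)
      (_ : MeasurableSpace X) (_ : BorelSpace X) (T : (Fin d → ℝ) → X → X),
      IsContAction d T ∧
      (∀ ν : Measure X, IsProbabilityMeasure ν → MeasInvariant d T ν → MeasErgodic d T ν →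
        urdim d T ν = 0 ∧ lrdim d T ν = 0) ∧
      (∃ μ : Measure X, IsProbabilityMeasure μ ∧ MeasInvariant d T μ ∧
        urdim d T μ = ⊤ ∧ lrdim d T μ = ⊤) := by
  refine ⟨RDProof.XX d, inferInstance, inferInstance, inferInstance, inferInstance,
    RDProof.TT d, RDProof.TT_action d, fun ν _ _ herg => RDProof.ergodic_zero d hd ν herg,
    RDProof.mu d, inferInstance, RDProof.mu_inv d, ?_, ?_⟩
  · exact (RDProof.ratio_tendsto d).limsup_eq
  · exact (RDProof.ratio_tendsto d).liminf_eq
end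

section
/- Let T : ℝ^d × 𝒳 → 𝒳 be a continuous action of ℝ^d on a compact metric space (𝒳, 𝐝) and L > 0. Then R_L(𝐝, μ, ε) is jointly continuous in (μ, ε): if ε_n → ε in (0,∞) and μ_n → μ in M^T(𝒳) with respect to the weak* topology, then R_L(𝐝, μ_n, ε_n) → R_L(𝐝, μ, ε) as n → ∞. -/
open MeasureTheory Filter Set
open scoped ENNReal Topology NNReal

theorem aux_logsum {ι : Type*} (s : Finset ι) (a b : ι → ℝ) (ha : ∀ i ∈ s, 0 ≤ a i)
    (hb : ∀ i ∈ s, 0 ≤ b i) (hab : ∀ i ∈ s, b i = 0 → a i = 0) :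
    (∑ i ∈ s, a i) * (Real.logb 2 (∑ i ∈ s, a i) - Real.logb 2 (∑ i ∈ s, b i))
      ≤ ∑ i ∈ s, a i * (Real.logb 2 (a i) - Real.logb 2 (b i)) := by
  have hl2 : 0 < Real.log 2 := Real.log_pos (by norm_num)
  have key : (∑ i ∈ s, a i) * (Real.log (∑ i ∈ s, a i) - Real.log (∑ i ∈ s, b i))
      ≤ ∑ i ∈ s, a i * (Real.log (a i) - Real.log (b i)) := by
    set A := ∑ i ∈ s, a i with hA
    set B := ∑ i ∈ s, b i with hB
    have hA0 : 0 ≤ A := Finset.sum_nonneg ha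
    have hB0 : 0 ≤ B := Finset.sum_nonneg hb
    rcases hA0.eq_or_lt with h | h
    · have : ∀ i ∈ s, a i = 0 := (Finset.sum_eq_zero_iff_of_nonneg ha).1 h.symm
      rw [← h, zero_mul, Finset.sum_eq_zero]
      intro i hi
      rw [this i hi, zero_mul]
    have hBpos : 0 < B := by
      rcases hB0.eq_or_lt with h' | h'
      · have h2 : ∀ i ∈ s, b i = 0 := (Finset.sum_eq_zero_iff_of_nonneg hb).1 h'.symm
        have : A = 0 := Finset.sum_eq_zero fun i hi => hab i hi (h2 i hi)
        exact absurd this h.ne'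
      · exact h'
    have term : ∀ i ∈ s, a i * (Real.log A - Real.log B) + (a i - b i * (A / B))
        ≤ a i * (Real.log (a i) - Real.log (b i)) := by
      intro i hi
      rcases (ha i hi).eq_or_lt with h0 | h0
      · rw [← h0]
        have := mul_nonneg (hb i hi) (div_pos h hBpos).le
        simp; linarith
      · have hbi : 0 < b i := lt_of_le_of_ne (hb i hi) fun h' => h0.ne' (hab i hi h'.symm)
        have hx : 0 < b i * (A / B) / a i := by positivity
        have := Real.log_le_sub_one_of_pos hx
        rw [Real.log_div (by positivity) h0.ne', Real.log_mul hbi.ne' (by positivity),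
          Real.log_div h.ne' hBpos.ne'] at this
        have h3 := mul_le_mul_of_nonneg_left this h0.le
        have h4 : a i * (b i * (A / B) / a i - 1) = b i * (A / B) - a i := by
          field_simp
        rw [h4] at h3
        nlinarith
    calc A * (Real.log A - Real.log B)
        = ∑ i ∈ s, (a i * (Real.log A - Real.log B) + (a i - b i * (A / B))) := by
          rw [Finset.sum_add_distrib, ← Finset.sum_mul, Finset.sum_sub_distrib, ← Finset.sum_mul,
            ← hA, ← hB]
          field_simp
          ring
      _ ≤ _ := Finset.sum_le_sum term
  have e : ∀ x y : ℝ, Real.logb 2 x - Real.logb 2 y = (Real.log x - Real.log y) / Real.log 2 := by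
    intro x y; simp [Real.logb, sub_div]
  simp only [e, ← mul_div_assoc]
  rw [← Finset.sum_div]
  gcongr

/-- Finite mutual information of an array. -/
noncomputable def aux_J {ι κ : Type*} [Fintype ι] [Fintype κ] (p : ι → κ → ℝ) : ℝ :=
  ∑ i, ∑ j, p i j * (Real.logb 2 (p i j) - Real.logb 2 (∑ j', p i j') - Real.logb 2 (∑ i', p i' j))

theorem aux_J_symm {ι κ : Type*} [Fintype ι] [Fintype κ] (p : ι → κ → ℝ) :
    aux_J (fun j i => p i j) = aux_J p := by
  unfold aux_J
  rw [Finset.sum_comm]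
  refine Finset.sum_congr rfl fun i _ => Finset.sum_congr rfl fun j _ => ?_
  ring

theorem aux_J_dp {ι κ τ : Type*} [Fintype ι] [Fintype κ] [Fintype τ] (p : κ → ι → ℝ)
    (hp : ∀ k j, 0 ≤ p k j) (t : κ → τ → ℝ) (ht : ∀ k i, 0 ≤ t k i) (ht1 : ∀ k, ∑ i, t k i = 1) :
    aux_J (fun i j => ∑ k, t k i * p k j) ≤ aux_J p := by
  unfold aux_J
  have hrow : ∀ i, ∑ j, ∑ k, t k i * p k j = ∑ k, t k i * ∑ j, p k j := by
    intro i; rw [Finset.sum_comm]; simp [Finset.mul_sum]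
  have hcol : ∀ j, ∑ i, ∑ k, t k i * p k j = ∑ k, p k j := by
    intro j; rw [Finset.sum_comm]; simp [← Finset.sum_mul, ht1]
  simp only [hrow, hcol]
  have step : ∀ i j, (∑ k, t k i * p k j) * (Real.logb 2 (∑ k, t k i * p k j)
      - Real.logb 2 (∑ k, t k i * ∑ j', p k j') - Real.logb 2 (∑ k, p k j))
      ≤ ∑ k, t k i * (p k j * (Real.logb 2 (p k j) - Real.logb 2 (∑ j', p k j')
        - Real.logb 2 (∑ k', p k' j))) := by
    intro i j
    have hpr : ∀ k, (∑ j', p k j') = 0 → p k j = 0 := fun k h =>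
      (Finset.sum_eq_zero_iff_of_nonneg (fun j _ => hp k j)).1 h j (Finset.mem_univ _)
    have := aux_logsum Finset.univ (fun k => t k i * p k j) (fun k => t k i * ∑ j', p k j')
      (fun k _ => mul_nonneg (ht k i) (hp k j))
      (fun k _ => mul_nonneg (ht k i) (Finset.sum_nonneg fun j _ => hp k j))
      (fun k _ h => by
        rcases mul_eq_zero.1 h with h | h
        · simp [h]
        · simp [hpr k h])
    rw [mul_sub]
    calc _ ≤ (∑ k, t k i * p k j * (Real.logb 2 (t k i * p k j)
          - Real.logb 2 (t k i * ∑ j', p k j')))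
          - (∑ k, t k i * p k j) * Real.logb 2 (∑ k, p k j) := by gcongr
      _ = _ := by
        rw [Finset.sum_mul, ← Finset.sum_sub_distrib]
        refine Finset.sum_congr rfl fun k _ => ?_
        by_cases h1 : t k i = 0
        · simp [h1]
        by_cases h2 : p k j = 0
        · simp [h2]
        have h3 : (∑ j', p k j') ≠ 0 := fun h => h2 (hpr k h)
        rw [Real.logb_mul h1 h2, Real.logb_mul h1 h3]
        ring
  calc _ ≤ ∑ i, ∑ j, ∑ k, t k i * (p k j * (Real.logb 2 (p k j) - Real.logb 2 (∑ j', p k j')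
        - Real.logb 2 (∑ k', p k' j))) :=
        Finset.sum_le_sum fun i _ => Finset.sum_le_sum fun j _ => step i j
    _ = ∑ k, ∑ j, ∑ i, t k i * (p k j * (Real.logb 2 (p k j) - Real.logb 2 (∑ j', p k j')
        - Real.logb 2 (∑ k', p k' j))) := by
        rw [Finset.sum_comm' (t' := Finset.univ) (s' := fun _ => Finset.univ) (by simp)]
        rw [Finset.sum_congr rfl fun j _ => Finset.sum_comm]
        rw [Finset.sum_comm]
    _ = _ := by simp only [← Finset.sum_mul, ht1, one_mul]

theorem aux_J_convex {ι κ : Type*} [Fintype ι] [Fintype κ] (p q : ι → κ → ℝ)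
    (hp : ∀ k j, 0 ≤ p k j) (hq : ∀ k j, 0 ≤ q k j) (h : ∀ i, ∑ j, p i j = ∑ j, q i j)
    (a b : ℝ) (ha : 0 ≤ a) (hb : 0 ≤ b) (hab : a + b = 1) :
    aux_J (fun i j => a * p i j + b * q i j) ≤ a * aux_J p + b * aux_J q := by
  unfold aux_J
  have hrow : ∀ i, ∑ j, (a * p i j + b * q i j) = ∑ j, q i j := by
    intro i
    rw [Finset.sum_add_distrib, ← Finset.mul_sum, ← Finset.mul_sum, h, ← add_mul, hab, one_mul]
  have hcol : ∀ j, ∑ i, (a * p i j + b * q i j) = a * (∑ i, p i j) + b * (∑ i, q i j) := by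
    intro j
    rw [Finset.sum_add_distrib, ← Finset.mul_sum, ← Finset.mul_sum]
  simp only [hrow, hcol, h]
  rw [Finset.mul_sum, Finset.mul_sum, ← Finset.sum_add_distrib]
  refine Finset.sum_le_sum fun i _ => ?_
  rw [Finset.mul_sum, Finset.mul_sum, ← Finset.sum_add_distrib]
  refine Finset.sum_le_sum fun j _ => ?_
  have hpc : (∑ i', p i' j) = 0 → p i j = 0 := fun h =>
    (Finset.sum_eq_zero_iff_of_nonneg (fun k _ => hp k j)).1 h i (Finset.mem_univ _)
  have hqc : (∑ i', q i' j) = 0 → q i j = 0 := fun h =>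
    (Finset.sum_eq_zero_iff_of_nonneg (fun k _ => hq k j)).1 h i (Finset.mem_univ _)
  have hP : 0 ≤ ∑ i', p i' j := Finset.sum_nonneg fun k _ => hp k j
  have hQ : 0 ≤ ∑ i', q i' j := Finset.sum_nonneg fun k _ => hq k j
  have := aux_logsum (Finset.univ : Finset Bool) (fun c => bif c then a * p i j else b * q i j)
    (fun c => bif c then a * (∑ i', p i' j) else b * (∑ i', q i' j))
    (by rintro (_ | _) _ <;> simp <;> exact mul_nonneg (by assumption) (by simp [hp, hq]))
    (by rintro (_ | _) _ <;> simp <;> exact mul_nonneg (by assumption) (by assumption))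
    (by
      rintro (_ | _) _ h <;> simp only [cond_true, cond_false] at h ⊢ <;>
        rcases mul_eq_zero.1 h with h | h
      · simp [h]
      · simp [hqc h]
      · simp [h]
      · simp [hpc h])
  simp only [Fintype.sum_bool, cond_true, cond_false] at this
  have e : ∀ c x y : ℝ, (y = 0 → x = 0) → c * x * (Real.logb 2 (c * x) - Real.logb 2 (c * y))
      = c * x * (Real.logb 2 x - Real.logb 2 y) := by
    intro c x y hxy
    by_cases h1 : c = 0
    · simp [h1]
    by_cases h2 : x = 0
    · simp [h2]
    rw [Real.logb_mul h1 h2, Real.logb_mul h1 (fun h => h2 (hxy h))]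
    ring
  rw [e _ _ _ hpc, e _ _ _ hqc] at this
  linarith

/-- entropy of a finite family -/
theorem aux_J_eq {ι κ : Type*} [Fintype ι] [Fintype κ] (p : ι → κ → ℝ) :
    aux_J p = (-∑ i, (∑ j, p i j) * Real.logb 2 (∑ j, p i j))
      + (-∑ j, (∑ i, p i j) * Real.logb 2 (∑ i, p i j))
      - (-∑ x : ι × κ, p x.1 x.2 * Real.logb 2 (p x.1 x.2)) := by
  unfold aux_J
  rw [Fintype.sum_prod_type]
  simp only [mul_sub, Finset.sum_sub_distrib, Finset.sum_mul]
  rw [Finset.sum_comm (f := fun i j => p i j * Real.logb 2 (∑ i', p i' j))]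
  ring

theorem aux_J_le {ι κ : Type*} [Fintype ι] [Fintype κ] (p : ι → κ → ℝ)
    (hp : ∀ k j, 0 ≤ p k j) :
    aux_J p ≤ (-∑ j, (∑ i, p i j) * Real.logb 2 (∑ i, p i j)) := by
  rw [aux_J_eq, Fintype.sum_prod_type]
  have : ∑ i, ∑ j, p i j * Real.logb 2 (p i j) ≤ ∑ i, (∑ j, p i j) * Real.logb 2 (∑ j, p i j) := by
    refine Finset.sum_le_sum fun i _ => ?_
    rw [Finset.sum_mul]
    refine Finset.sum_le_sum fun j _ => ?_
    rcases (hp i j).eq_or_lt with h | h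
    · simp [← h]
    · refine mul_le_mul_of_nonneg_left ?_ h.le
      exact Real.logb_le_logb_of_le (by norm_num) h
        (Finset.single_le_sum (fun j _ => hp i j) (Finset.mem_univ j))
  simp only at this ⊢
  linarith

theorem aux_entropy_eq {Ω A B : Type*} [MeasurableSpace Ω] [Fintype A] [Fintype B]
    [MeasurableSpace A] [MeasurableSpace B] [MeasurableSingletonClass A]
    [MeasurableSingletonClass B] (P : Measure Ω) [IsFiniteMeasure P] (f : Ω → A) (g : Ω → B)
    (hf : Measurable f) (hg : Measurable g) :
    shannonEntropy P f + shannonEntropy P g - shannonEntropy P (fun ω => (f ω, g ω))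
      = aux_J (fun i j => P.real (f ⁻¹' {i} ∩ g ⁻¹' {j})) := by
  have h1 : ∀ i, ∑ j, P.real (f ⁻¹' {i} ∩ g ⁻¹' {j}) = P.real (f ⁻¹' {i}) := by
    intro i
    rw [← measureReal_biUnion_finset]
    · congr 1; ext x; simp
    · intro a _ b _ hab
      refine Set.disjoint_left.2 fun x hx hy => hab ?_
      simp at hx hy
      rw [← hx.2, ← hy.2]
    · intro b _
      exact (hf (measurableSet_singleton i)).inter (hg (measurableSet_singleton b))
  have h2 : ∀ j, ∑ i, P.real (f ⁻¹' {i} ∩ g ⁻¹' {j}) = P.real (g ⁻¹' {j}) := by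
    intro i
    rw [← measureReal_biUnion_finset]
    · congr 1; ext x; simp
    · intro a _ b _ hab
      refine Set.disjoint_left.2 fun x hx hy => hab ?_
      simp at hx hy
      rw [← hx.1, ← hy.1]
    · intro b _
      exact (hf (measurableSet_singleton b)).inter (hg (measurableSet_singleton i))
  rw [aux_J_eq]
  simp only [h1, h2]
  unfold shannonEntropy
  have h3 : ∀ x : A × B, (fun ω => (f ω, g ω)) ⁻¹' {x} = f ⁻¹' {x.1} ∩ g ⁻¹' {x.2} := by
    intro x; ext ω; simp [Prod.ext_iff]
  simp only [h3]
  rfl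


/-- averaged distance between an orbit and a map -/
noncomputable def aux_phi {X : Type*} [MetricSpace X] (d : ℕ) (T : (Fin d → ℝ) → X → X) (L : ℝ)
    (x : X) (f : L1Maps d L X) : ℝ :=
  (L ^ d)⁻¹ * ∫ u, dist (T u x) (f u) ∂(boxMeasure d L)

theorem aux_box_real (d : ℕ) (L : ℝ) (hL : 0 < L) : (boxMeasure d L).real univ = L ^ d := by
  have : unitBox d L = Set.univ.pi fun _ => Set.Ico (0 : ℝ) L := rfl
  simp only [boxMeasure, Measure.real, Measure.restrict_apply_univ, this, volume_pi_pi]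
  simp [Real.volume_Ico, hL.le]

theorem aux_box_finite (d : ℕ) (L : ℝ) : IsFiniteMeasure (boxMeasure d L) := by
  constructor
  have : unitBox d L = Set.univ.pi fun _ => Set.Ico (0 : ℝ) L := rfl
  simp only [boxMeasure, Measure.restrict_apply_univ, this, volume_pi_pi]
  simp [Real.volume_Ico]

theorem aux_unif {X : Type*} [MetricSpace X] [CompactSpace X] (d : ℕ)
    (T : (Fin d → ℝ) → X → X) (hT : IsContAction d T) (L : ℝ) (δ : ℝ) (hδ : 0 < δ) :
    ∃ r > 0, ∀ x y : X, dist x y < r → ∀ u ∈ unitBox d L, dist (T u x) (T u y) ≤ δ := by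
  have hK : IsCompact ((Set.univ.pi fun _ : Fin d => Set.Icc (0 : ℝ) L) ×ˢ (univ : Set X)) :=
    (isCompact_univ_pi fun _ => isCompact_Icc).prod isCompact_univ
  have := hK.uniformContinuousOn_of_continuous hT.1.continuousOn
  rw [Metric.uniformContinuousOn_iff] at this
  obtain ⟨r, hr, h⟩ := this δ hδ
  refine ⟨r, hr, fun x y hxy u hu => ?_⟩
  have hu' : u ∈ (Set.univ.pi fun _ : Fin d => Set.Icc (0 : ℝ) L) := fun i hi =>
    Set.Ico_subset_Icc_self (hu i hi)
  refine (h (u, x) ⟨hu', mem_univ _⟩ (u, y) ⟨hu', mem_univ _⟩ ?_).le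
  simpa [Prod.dist_eq] using hxy

theorem aux_integrable {X : Type*} [MetricSpace X] [CompactSpace X] (d : ℕ)
    (T : (Fin d → ℝ) → X → X) (hT : IsContAction d T) (L : ℝ) (x : X) (f : L1Maps d L X) :
    Integrable (fun u => dist (T u x) (f u)) (boxMeasure d L) := by
  have := aux_box_finite d L
  have h1 : Continuous fun u => T u x := hT.1.comp (by fun_prop : Continuous fun u => (u, x))
  refine Integrable.of_bound (h1.aestronglyMeasurable.dist f.aestronglyMeasurable)
    (Metric.diam (univ : Set X)) (ae_of_all _ fun u => ?_)
  rw [Real.norm_of_nonneg dist_nonneg]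
  exact Metric.dist_le_diam_of_mem isCompact_univ.isBounded (mem_univ _) (mem_univ _)

theorem aux_phi_le {X : Type*} [MetricSpace X] [CompactSpace X] (d : ℕ)
    (T : (Fin d → ℝ) → X → X) (hT : IsContAction d T) (L : ℝ) (hL : 0 < L) (x y : X)
    (f : L1Maps d L X) (c : ℝ) (h : ∀ u ∈ unitBox d L, dist (T u x) (T u y) ≤ c) :
    aux_phi d T L x f ≤ c + aux_phi d T L y f := by
  have := aux_box_finite d L
  unfold aux_phi
  have hLd : 0 < L ^ d := by positivity
  have hm : MeasurableSet (unitBox d L) := MeasurableSet.univ_pi fun _ => measurableSet_Ico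
  have h2 : ∫ u, dist (T u x) (f u) ∂(boxMeasure d L)
      ≤ ∫ u, (c + dist (T u y) (f u)) ∂(boxMeasure d L) := by
    refine integral_mono_ae (aux_integrable d T hT L x f)
      ((integrable_const c).add (aux_integrable d T hT L y f)) ?_
    refine (ae_restrict_iff' hm).2 (ae_of_all _ fun u hu => ?_)
    have := dist_triangle (T u x) (T u y) (f u)
    have := h u hu
    simp only
    linarith
  rw [integral_add (integrable_const c) (aux_integrable d T hT L y f), integral_const,
    aux_box_real d L hL, smul_eq_mul] at h2
  calc _ ≤ (L ^ d)⁻¹ * (L ^ d * c + ∫ u, dist (T u y) (f u) ∂(boxMeasure d L)) := by gcongr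
    _ = _ := by field_simp

theorem aux_phi_nonneg {X : Type*} [MetricSpace X] (d : ℕ)
    (T : (Fin d → ℝ) → X → X) (L : ℝ) (hL : 0 < L) (x : X)
    (f : L1Maps d L X) : 0 ≤ aux_phi d T L x f :=
  mul_nonneg (by positivity) (integral_nonneg fun _ => dist_nonneg)

theorem aux_phi_le_diam {X : Type*} [MetricSpace X] [CompactSpace X] (d : ℕ)
    (T : (Fin d → ℝ) → X → X) (hT : IsContAction d T) (L : ℝ) (hL : 0 < L) (x : X)
    (f : L1Maps d L X) : aux_phi d T L x f ≤ Metric.diam (univ : Set X) := by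
  have := aux_box_finite d L
  have hLd : 0 < L ^ d := by positivity
  have h2 : ∫ u, dist (T u x) (f u) ∂(boxMeasure d L)
      ≤ ∫ u, Metric.diam (univ : Set X) ∂(boxMeasure d L) := by
    refine integral_mono (aux_integrable d T hT L x f) (integrable_const _) fun u => ?_
    exact Metric.dist_le_diam_of_mem isCompact_univ.isBounded (mem_univ _) (mem_univ _)
  rw [integral_const, aux_box_real d L hL, smul_eq_mul] at h2
  unfold aux_phi
  calc _ ≤ (L ^ d)⁻¹ * (L ^ d * Metric.diam (univ : Set X)) := by gcongr
    _ = _ := by field_simp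

theorem aux_phi_meas {X : Type*} [MetricSpace X] [CompactSpace X] [MeasurableSpace X]
    [BorelSpace X] (d : ℕ)
    (T : (Fin d → ℝ) → X → X) (hT : IsContAction d T) (L : ℝ) (hL : 0 < L) :
    Measurable (Function.uncurry (aux_phi d T L)) := by
  refine measurable_uncurry_of_continuous_of_measurable (fun f => ?_) (fun x => ?_)
  · rw [Metric.continuous_iff]
    intro x δ hδ
    obtain ⟨r, hr, h⟩ := aux_unif d T hT L (δ / 2) (by positivity)
    refine ⟨r, hr, fun y hy => ?_⟩
    have h1 := aux_phi_le d T hT L hL y x f _ (h y x hy)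
    have h2 := aux_phi_le d T hT L hL x y f _ (h x y (by rwa [dist_comm]))
    rw [Real.dist_eq, abs_lt]
    constructor <;> linarith
  · unfold aux_phi
    refine Measurable.const_mul ?_ _
    have h1 : Continuous fun u => T u x := hT.1.comp (by fun_prop : Continuous fun u => (u, x))
    set g : L1Maps d L X := AEEqFun.mk (fun u => T u x) h1.aestronglyMeasurable with hg
    have : (fun f : L1Maps d L X => ∫ u, dist (T u x) (f u) ∂(boxMeasure d L))
        = fun f => L1dist g f := by
      funext f
      refine integral_congr_ae ?_
      filter_upwards [AEEqFun.coeFn_mk (fun u => T u x) h1.aestronglyMeasurable] with u hu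
      rw [hg, hu]
    rw [this]
    refine measurable_of_Iio fun r => ?_
    exact MeasurableSpace.measurableSet_generateFrom ⟨g, r, rfl⟩

theorem aux_phi_integrable {X : Type*} [MetricSpace X] [CompactSpace X] [MeasurableSpace X]
    [BorelSpace X] (d : ℕ)
    (T : (Fin d → ℝ) → X → X) (hT : IsContAction d T) (L : ℝ) (hL : 0 < L)
    {Ω : Type*} [MeasurableSpace Ω] (P : Measure Ω) [IsFiniteMeasure P]
    (Xv : Ω → X) (Yv : Ω → L1Maps d L X) (hX : Measurable Xv) (hY : Measurable Yv) :
    Integrable (fun ω => aux_phi d T L (Xv ω) (Yv ω)) P := by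
  refine Integrable.of_bound ((aux_phi_meas d T hT L hL).comp (hX.prodMk hY)).aestronglyMeasurable
    (Metric.diam (univ : Set X)) (ae_of_all _ fun ω => ?_)
  rw [Real.norm_of_nonneg (aux_phi_nonneg d T L hL _ _)]
  exact aux_phi_le_diam d T hT L hL _ _

theorem aux_partition {X : Type*} [MetricSpace X] [CompactSpace X] [MeasurableSpace X]
    [BorelSpace X] (μ : Measure X) [IsProbabilityMeasure μ] (r : ℝ) (hr : 0 < r) :
    ∃ (N : ℕ) (π : X → Fin N), Measurable π ∧ (∀ x y, π x = π y → dist x y < r) ∧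
      ∀ k, μ (frontier (π ⁻¹' {k})) = 0 := by
  classical
  have h1 : ∀ x : X, ∃ ρ ∈ Ioo 0 (r / 2), μ (frontier (Metric.ball x ρ)) = 0 := by
    intro x
    obtain ⟨ρ, h, h'⟩ := exists_null_frontier_thickening μ {x} (half_pos hr)
    rw [Metric.thickening_singleton] at h'
    exact ⟨ρ, h, h'⟩
  choose ρ hρ hnull using h1
  obtain ⟨t, ht⟩ := isCompact_univ.elim_finite_subcover (fun x => Metric.ball x (ρ x))
    (fun _ => Metric.isOpen_ball)
    (fun x _ => mem_iUnion.2 ⟨x, Metric.mem_ball_self (hρ x).1⟩)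
  let s : X → (t → Bool) := fun x i => decide (x ∈ Metric.ball i.1 (ρ i.1))
  let e := Fintype.equivFin (t → Bool)
  have hs : Measurable s := by
    refine measurable_pi_lambda _ fun i => ?_
    refine measurable_to_bool ?_
    have : (fun x => s x i) ⁻¹' {true} = Metric.ball i.1 (ρ i.1) := by ext x; simp [s]
    rw [this]
    exact Metric.isOpen_ball.measurableSet
  refine ⟨_, fun x => e (s x), (measurable_of_finite e).comp hs, ?_, ?_⟩
  · intro x y hxy
    have hxy := e.injective hxy
    obtain ⟨i, hi⟩ := mem_iUnion.1 (ht (mem_univ x))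
    obtain ⟨hi, hx⟩ := mem_iUnion.1 hi
    have : y ∈ Metric.ball i (ρ i) := by
      have := congrFun hxy ⟨i, hi⟩
      simp only [s, decide_eq_decide] at this
      exact this.1 hx
    rw [Metric.mem_ball] at hx this
    have h3 := dist_triangle_right x y i
    have := (hρ i).2
    linarith
  · intro k
    refine measure_mono_null (t := ⋃ i ∈ t, frontier (Metric.ball i (ρ i))) ?_ ?_
    · intro x hx
      by_contra hcon
      simp only [mem_iUnion, not_exists] at hcon
      have hev : ∀ᶠ y in 𝓝 x, ∀ i : t, s y i = s x i := by
        refine eventually_all.2 fun i => ?_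
        have hi := hcon i.1 i.2
        rw [Metric.isOpen_ball.frontier_eq, Set.mem_sdiff, not_and_not_right] at hi
        by_cases hxi : x ∈ Metric.ball i.1 (ρ i.1)
        · filter_upwards [Metric.isOpen_ball.mem_nhds hxi] with y hy
          simp only [s, hy, hxi]
        · have : x ∈ (closure (Metric.ball i.1 (ρ i.1)))ᶜ := fun h => hxi (hi h)
          filter_upwards [isClosed_closure.isOpen_compl.mem_nhds this] with y hy
          have : y ∉ Metric.ball i.1 (ρ i.1) := fun h => hy (subset_closure h)
          simp only [s, this, hxi]
      have hev' : ∀ᶠ y in 𝓝 x, e (s y) = e (s x) := by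
        filter_upwards [hev] with y hy
        rw [funext hy]
      rw [frontier_eq_closure_inter_closure] at hx
      obtain ⟨y, hy, hy'⟩ := mem_closure_iff_nhds.1 hx.1 _ hev'
      obtain ⟨z, hz, hz'⟩ := mem_closure_iff_nhds.1 hx.2 _ hev'
      apply hz'
      simp only [mem_preimage, mem_singleton_iff, mem_ofPred_eq] at *
      rw [hz, ← hy, hy']
    · exact (measure_biUnion_null_iff t.countable_toSet).2 fun i _ => hnull i

theorem aux_matrix {N : ℕ} (w v : Fin N → ℝ) (hw : ∀ k, 0 ≤ w k) (hv : ∀ k, 0 ≤ v k)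
    (hw1 : ∑ k, w k = 1) (hv1 : ∑ k, v k = 1) :
    ∃ t : Fin N → Fin N → ℝ, (∀ k l, 0 ≤ t k l) ∧ (∀ k, ∑ l, t k l = 1) ∧
      (∀ l, ∑ k, w k * t k l = v l) ∧ ∑ k, w k * (1 - t k k) ≤ ∑ k, |w k - v k| := by
  classical
  set m : Fin N → ℝ := fun k => min (w k) (v k) with hm
  have hmw : ∀ k, m k ≤ w k := fun k => min_le_left _ _
  have hmv : ∀ k, m k ≤ v k := fun k => min_le_right _ _
  have hm0 : ∀ k, 0 ≤ m k := fun k => le_min (hw k) (hv k)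
  set s : ℝ := ∑ k, (v k - m k) with hs
  have hs' : s = ∑ k, (w k - m k) := by
    rw [hs, Finset.sum_sub_distrib, Finset.sum_sub_distrib, hw1, hv1]
  have hs0 : 0 ≤ s := Finset.sum_nonneg fun k _ => sub_nonneg.2 (hmv k)
  rcases hs0.eq_or_lt with h0 | h0
  · have e1 : ∀ k, v k - m k = 0 := fun k =>
      (Finset.sum_eq_zero_iff_of_nonneg (fun k _ => sub_nonneg.2 (hmv k))).1 h0.symm k
        (Finset.mem_univ _)
    have e2 : ∀ k, w k - m k = 0 := fun k =>
      (Finset.sum_eq_zero_iff_of_nonneg (fun k _ => sub_nonneg.2 (hmw k))).1 (hs' ▸ h0.symm) k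
        (Finset.mem_univ _)
    refine ⟨fun k l => if k = l then 1 else 0, fun k l => by positivity, by simp, ?_, ?_⟩
    · intro l
      simp
      linarith [e1 l, e2 l]
    · simp
      exact Finset.sum_nonneg fun k _ => abs_nonneg _
  · set c : Fin N → ℝ := fun k => if w k = 0 then 1 else m k / w k with hc
    have hwc : ∀ k, w k * c k = m k := by
      intro k
      by_cases h : w k = 0
      · have := hmw k
        have := hm0 k
        simp only [hc, h, if_true]
        linarith
      · simp only [hc, h, if_false]; field_simp
    have hc0 : ∀ k, 0 ≤ c k := by
      intro k
      simp only [hc]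
      split_ifs
      · norm_num
      · exact div_nonneg (hm0 k) (hw k)
    have hc1 : ∀ k, c k ≤ 1 := by
      intro k
      simp only [hc]
      split_ifs
      · norm_num
      · exact div_le_one_of_le₀ (hmw k) (hw k)
    refine ⟨fun k l => (if k = l then c k else 0) + (1 - c k) * ((v l - m l) / s), ?_, ?_, ?_, ?_⟩
    · intro k l
      have := div_nonneg (sub_nonneg.2 (hmv l)) hs0
      have := mul_nonneg (sub_nonneg.2 (hc1 k)) this
      have := hc0 k
      beta_reduce
      split_ifs <;> linarith
    · intro k
      rw [Finset.sum_add_distrib, ← Finset.mul_sum, ← Finset.sum_div, ← hs, div_self h0.ne']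
      simp
    · intro l
      simp only [mul_add, Finset.sum_add_distrib, mul_ite, mul_zero, Finset.sum_ite_eq',
        Finset.mem_univ, if_true, hwc, ← mul_assoc, ← Finset.sum_mul, mul_sub, mul_one]
      rw [← hs']
      field_simp
      ring
    · refine Finset.sum_le_sum fun k _ => ?_
      simp only [if_true]
      have h1 := div_nonneg (sub_nonneg.2 (hmv k)) hs0
      have h2 := mul_nonneg (hw k) (mul_nonneg (sub_nonneg.2 (hc1 k)) h1)
      have h3 : w k - m k ≤ |w k - v k| := by
        simp only [hm]
        rcases le_total (w k) (v k) with h | h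
        · rw [min_eq_left h]; simp
        · rw [min_eq_right h]; exact le_abs_self _
      have := hwc k
      nlinarith

theorem aux_coupling {X : Type*} [MeasurableSpace X] (μ ν : Measure X) [IsProbabilityMeasure μ]
    [IsProbabilityMeasure ν] {N : ℕ} (π : X → Fin N) (hπ : Measurable π) :
    ∃ η : Fin N → Measure X, (∀ k, IsProbabilityMeasure (η k)) ∧
      (∀ S, MeasurableSet S → ∑ k, μ.real (π ⁻¹' {k}) * (η k).real S = ν.real S) ∧
      ∑ k, μ.real (π ⁻¹' {k}) * (η k).real (π ⁻¹' {k})ᶜ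
        ≤ ∑ k, |μ.real (π ⁻¹' {k}) - ν.real (π ⁻¹' {k})| := by
  classical
  have hAm : ∀ k, MeasurableSet (π ⁻¹' {k}) := fun k => hπ (measurableSet_singleton k)
  have hsum : ∀ (ρ : Measure X) [IsProbabilityMeasure ρ] (S : Set X), MeasurableSet S →
      ∑ k, ρ.real (π ⁻¹' {k} ∩ S) = ρ.real S := by
    intro ρ _ S hS
    rw [← measureReal_biUnion_finset]
    · congr 1; ext x; simp
    · intro a _ b _ hab
      refine Set.disjoint_left.2 fun x hx hy => hab ?_
      simp at hx hy
      rw [← hx.1, ← hy.1]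
    · intro b _
      exact (hAm b).inter hS
  have hsum1 : ∀ (ρ : Measure X) [IsProbabilityMeasure ρ], ∑ k, ρ.real (π ⁻¹' {k}) = 1 := by
    intro ρ _
    simpa using hsum ρ univ MeasurableSet.univ
  obtain ⟨t, ht0, ht1, ht2, ht3⟩ := aux_matrix (fun k => μ.real (π ⁻¹' {k}))
    (fun k => ν.real (π ⁻¹' {k})) (fun _ => measureReal_nonneg) (fun _ => measureReal_nonneg)
    (hsum1 μ) (hsum1 ν)
  let κ : Fin N → Measure X := fun l =>
    if ν (π ⁻¹' {l}) = 0 then ν else ProbabilityTheory.cond ν (π ⁻¹' {l})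
  have hκ : ∀ l, IsProbabilityMeasure (κ l) := by
    intro l
    simp only [κ]
    split_ifs with h
    · infer_instance
    · exact ProbabilityTheory.cond_isProbabilityMeasure h
  have hκS : ∀ l S, MeasurableSet S →
      ν.real (π ⁻¹' {l}) * (κ l).real S = ν.real (π ⁻¹' {l} ∩ S) := by
    intro l S hS
    by_cases h : ν (π ⁻¹' {l}) = 0
    · have h2 : ν.real (π ⁻¹' {l}) = 0 := by simp [Measure.real, h]
      have h3 : ν.real (π ⁻¹' {l} ∩ S) = 0 := by
        simp [Measure.real, measure_mono_null inter_subset_left h]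
      rw [h2, h3, zero_mul]
    · have h2 : ν.real (π ⁻¹' {l}) ≠ 0 := by
        simp [Measure.real, ENNReal.toReal_eq_zero_iff, h]
      simp only [κ, h, if_false]
      rw [Measure.real, Measure.real, Measure.real, ProbabilityTheory.cond_apply (hAm l), ENNReal.toReal_mul,
        ENNReal.toReal_inv]
      rw [Measure.real] at h2
      field_simp
  have hη : ∀ k S, (∑ l, ENNReal.ofReal (t k l) • κ l).real S = ∑ l, t k l * (κ l).real S := by
    intro k S
    simp only [Measure.real, Measure.finsetSum_apply, Measure.smul_apply, smul_eq_mul]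
    rw [ENNReal.toReal_sum]
    · simp [ENNReal.toReal_mul, ht0]
    · intro l _
      exact ENNReal.mul_ne_top ENNReal.ofReal_ne_top (measure_ne_top _ _)
  refine ⟨fun k => ∑ l, ENNReal.ofReal (t k l) • κ l, ?_, ?_, ?_⟩
  · intro k
    constructor
    simp only [Measure.finsetSum_apply, Measure.smul_apply, smul_eq_mul, measure_univ, mul_one]
    rw [← ENNReal.ofReal_sum_of_nonneg (fun l _ => ht0 k l), ht1, ENNReal.ofReal_one]
  · intro S hS
    simp only [hη, Finset.mul_sum]
    rw [Finset.sum_comm]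
    simp only [← mul_assoc, ← Finset.sum_mul, ht2]
    simp only [hκS _ S hS]
    exact hsum ν S hS
  · refine le_trans ?_ ht3
    refine Finset.sum_le_sum fun k _ => ?_
    rw [hη]
    have hsplit : ∀ l, μ.real (π ⁻¹' {k}) * (t k l * (κ l).real (π ⁻¹' {k})ᶜ)
        ≤ μ.real (π ⁻¹' {k}) * (if l = k then 0 else t k l) := by
      intro l
      by_cases hl : l = k
      · subst hl
        simp only [if_true, mul_zero]
        by_cases h : ν.real (π ⁻¹' {l}) = 0
        · have := ht2 l
          rw [h] at this
          have h2 := (Finset.sum_eq_zero_iff_of_nonneg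
            (fun k _ => mul_nonneg measureReal_nonneg (ht0 k l))).1 this l (Finset.mem_univ _)
          rw [← mul_assoc, h2, zero_mul]
        · have := hκS l _ (hAm l).compl
          rw [inter_compl_self, measureReal_empty] at this
          rw [(mul_eq_zero.1 this).resolve_left h]
          simp
      · simp only [hl, if_false]
        refine mul_le_mul_of_nonneg_left ?_ measureReal_nonneg
        exact mul_le_of_le_one_right (ht0 k l) measureReal_le_one
    rw [Finset.mul_sum]
    refine (Finset.sum_le_sum fun l _ => hsplit l).trans ?_
    rw [← Finset.mul_sum]
    refine le_of_eq ?_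
    congr 1
    rw [← ht1 k, ← Finset.add_sum_erase _ _ (Finset.mem_univ k),
      ← Finset.add_sum_erase Finset.univ (t k) (Finset.mem_univ k)]
    simp only [if_true, zero_add, add_sub_cancel_left]
    refine Finset.sum_congr rfl fun l hl => ?_
    rw [if_neg (Finset.ne_of_mem_erase hl)]


theorem aux_RL_le {X : Type*} [MetricSpace X] [MeasurableSpace X] (d : ℕ)
    (T : (Fin d → ℝ) → X → X) (μ : Measure X) (L ε : ℝ) (Ω : Type) [m : MeasurableSpace Ω]
    (P : Measure Ω) [hP : IsProbabilityMeasure P] (Xv : Ω → X) (Yv : Ω → L1Maps d L X)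
    (hX : Measurable Xv) (hY : Measurable Yv) (hμ : Measure.map Xv P = μ)
    (hD : distortion d T L P Xv Yv < ε) : RL d T μ L ε ≤ mutualInfo P Xv Yv :=
  iInf_le_of_le Ω <| iInf_le_of_le m <| iInf_le_of_le P <| iInf_le_of_le hP <| iInf_le_of_le Xv <|
    iInf_le_of_le Yv <| iInf_le_of_le hX <| iInf_le_of_le hY <| iInf_le_of_le hμ <|
    iInf_le_of_le hD le_rfl

theorem aux_le_MI {Ω A B : Type*} [MeasurableSpace Ω] [MeasurableSpace A] [MeasurableSpace B]
    (P : Measure Ω) [IsFiniteMeasure P] (X : Ω → A) (Y : Ω → B) (hX : Measurable X)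
    (hY : Measurable Y) {n m : ℕ}
    (α : A → Fin n) (hα : Measurable α) (β : B → Fin m) (hβ : Measurable β) :
    ENNReal.ofReal (aux_J fun i j => P.real ((fun ω => α (X ω)) ⁻¹' {i} ∩ (fun ω => β (Y ω)) ⁻¹' {j}))
      ≤ mutualInfo P X Y := by
  rw [← aux_entropy_eq P (fun ω => α (X ω)) (fun ω => β (Y ω)) (hα.comp hX) (hβ.comp hY)]
  exact le_iSup_of_le n <| le_iSup_of_le m <| le_iSup_of_le α <| le_iSup_of_le hα <|
    le_iSup_of_le β <| le_iSup_of_le hβ le_rfl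

theorem aux_MI_le {Ω A B : Type*} [MeasurableSpace Ω] [MeasurableSpace A] [MeasurableSpace B]
    (P : Measure Ω) [IsFiniteMeasure P] (X : Ω → A) (Y : Ω → B) (hX : Measurable X)
    (hY : Measurable Y) (c : ℝ≥0∞)
    (h : ∀ (n m : ℕ) (α : A → Fin n) (β : B → Fin m), Measurable α → Measurable β →
      ENNReal.ofReal (aux_J fun i j =>
        P.real ((fun ω => α (X ω)) ⁻¹' {i} ∩ (fun ω => β (Y ω)) ⁻¹' {j})) ≤ c) :
    mutualInfo P X Y ≤ c := by
  refine iSup_le fun n => iSup_le fun m => iSup_le fun α => iSup_le fun hα => iSup_le fun β =>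
    iSup_le fun hβ => ?_
  rw [aux_entropy_eq P (fun ω => α (X ω)) (fun ω => β (Y ω)) (hα.comp hX) (hβ.comp hY)]
  exact h n m α β hα hβ

theorem aux_fiber_sum {Y : Type*} [MeasurableSpace Y] (ρ : Measure Y) [IsFiniteMeasure ρ] {N : ℕ}
    (π : Y → Fin N) (hπ : Measurable π) (S : Set Y) (hS : MeasurableSet S) :
    ∑ k, ρ.real (π ⁻¹' {k} ∩ S) = ρ.real S := by
  rw [← measureReal_biUnion_finset]
  · congr 1; ext x; simp
  · intro a _ b _ hab
    refine Set.disjoint_left.2 fun x hx hy => hab ?_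
    simp at hx hy
    rw [← hx.1, ← hy.1]
  · intro b _
    exact (hπ (measurableSet_singleton b)).inter hS

theorem aux_transport {X : Type*} [MetricSpace X] [CompactSpace X] [MeasurableSpace X]
    [BorelSpace X] (d : ℕ) (T : (Fin d → ℝ) → X → X) (hT : IsContAction d T) (L : ℝ) (hL : 0 < L)
    (μ ν : Measure X) [IsProbabilityMeasure μ] [IsProbabilityMeasure ν] {N : ℕ} (π : X → Fin N)
    (hπ : Measurable π) (δ : ℝ) (hδ : 0 ≤ δ)
    (hd : ∀ x y, π x = π y → ∀ u ∈ unitBox d L, dist (T u x) (T u y) ≤ δ) (ε ε' : ℝ)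
    (hε : ε + δ + Metric.diam (univ : Set X) *
      ∑ k, |μ.real (π ⁻¹' {k}) - ν.real (π ⁻¹' {k})| ≤ ε') :
    RL d T ν L ε' ≤ RL d T μ L ε := by
  obtain ⟨η, hη, hη1, hη2⟩ := aux_coupling μ ν π hπ
  refine le_iInf fun Ω => le_iInf fun mΩ => le_iInf fun P => le_iInf fun hP => le_iInf fun Xv =>
    le_iInf fun Yv => le_iInf fun hX => le_iInf fun hY => le_iInf fun hμ => le_iInf fun hD => ?_
  have : Nonempty X := (inferInstance : NeZero μ).1 |> fun h => by
    by_contra hne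
    rw [not_nonempty_iff] at hne
    exact h (Measure.eq_zero_of_isEmpty μ)
  let e : X → ℝ := embeddingReal X
  have he : MeasurableEmbedding e := measurableEmbedding_embeddingReal X
  obtain ⟨g, hg, hge⟩ := he.exists_measurable_extend measurable_id (fun _ => inferInstance)
  let E : Fin N → Set Ω := fun k => (fun ω => π (Xv ω)) ⁻¹' {k}
  have hE : ∀ k, MeasurableSet (E k) := fun k => (hπ.comp hX) (measurableSet_singleton k)
  have hPE : ∀ k, P.real (E k) = μ.real (π ⁻¹' {k}) := by
    intro k
    rw [← hμ, map_measureReal_apply hX (hπ (measurableSet_singleton k))]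
    rfl
  let Q : Measure (Ω × ℝ) := ∑ k, (P.restrict (E k)).prod ((η k).map e)
  have hQfin : IsFiniteMeasure Q := by
    constructor
    simp only [Q, Measure.finsetSum_apply]
    exact ENNReal.sum_lt_top.2 fun k _ => measure_lt_top _ _
  have hQ : ∀ S R, MeasurableSet S → MeasurableSet R →
      Q.real (S ×ˢ (g ⁻¹' R)) = ∑ k, (η k).real R * P.real (E k ∩ S) := by
    intro S R hS hR
    simp only [Q, Measure.real, Measure.finsetSum_apply]
    rw [ENNReal.toReal_sum (fun _ _ => measure_ne_top _ _)]
    refine Finset.sum_congr rfl fun k _ => ?_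
    rw [Measure.prod_prod, Measure.restrict_apply hS, Measure.map_apply he.measurable (hg hR),
      ← preimage_comp, hge, ENNReal.toReal_mul, mul_comm, inter_comm, preimage_id]
  have hQfst : Q.map Prod.fst = P := by
    refine Measure.ext fun S hS => ?_
    rw [← measureReal_eq_measureReal_iff, map_measureReal_apply measurable_fst hS]
    have h1 := hQ S univ hS MeasurableSet.univ
    rw [preimage_univ, prod_univ] at h1
    rw [h1]
    simp only [probReal_univ, one_mul]
    exact aux_fiber_sum P _ (hπ.comp hX) S hS
  have hQp : IsProbabilityMeasure Q := by
    constructor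
    have := congrArg (fun m => m univ) hQfst
    simpa [Measure.map_apply measurable_fst MeasurableSet.univ] using this
  have hX' : Measurable (fun z : Ω × ℝ => g z.2) := hg.comp measurable_snd
  have hY' : Measurable (fun z : Ω × ℝ => Yv z.1) := hY.comp measurable_fst
  have hlaw : Q.map (fun z : Ω × ℝ => g z.2) = ν := by
    refine Measure.ext fun S hS => ?_
    rw [← measureReal_eq_measureReal_iff, map_measureReal_apply hX' hS]
    have h1 := hQ univ S MeasurableSet.univ hS
    rw [univ_prod, ← preimage_comp] at h1
    refine h1.trans ?_
    rw [← hη1 S hS]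
    refine Finset.sum_congr rfl fun k _ => ?_
    rw [inter_univ, hPE, mul_comm]
  refine (aux_RL_le d T ν L ε' (Ω × ℝ) Q _ _ hX' hY' hlaw ?_).trans ?_
  · change ∫ z : Ω × ℝ, aux_phi d T L (g z.2) (Yv z.1) ∂Q < ε'
    have hD' : ∫ ω, aux_phi d T L (Xv ω) (Yv ω) ∂P < ε := hD
    set C := Metric.diam (univ : Set X)
    let bad : Set (Ω × ℝ) := {z | π (g z.2) ≠ π (Xv z.1)}
    have hbad : MeasurableSet bad :=
      (measurableSet_eq_fun (hπ.comp hX') (hπ.comp (hX.comp measurable_fst))).compl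
    have hpt : ∀ z : Ω × ℝ, aux_phi d T L (g z.2) (Yv z.1)
        ≤ (δ + aux_phi d T L (Xv z.1) (Yv z.1)) + bad.indicator (fun _ => C) z := by
      intro z
      by_cases hz : z ∈ bad
      · rw [indicator_of_mem hz]
        have h1 := aux_phi_nonneg d T L hL (Xv z.1) (Yv z.1)
        have h2 := aux_phi_le_diam d T hT L hL (g z.2) (Yv z.1)
        linarith
      · rw [indicator_of_notMem hz, add_zero]
        exact aux_phi_le d T hT L hL _ _ _ _ (hd _ _ (not_not.1 hz))
    have hi1 : Integrable (fun z : Ω × ℝ => aux_phi d T L (Xv z.1) (Yv z.1)) Q :=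
      aux_phi_integrable d T hT L hL Q _ _ (hX.comp measurable_fst) hY'
    have hi2 : Integrable (fun z : Ω × ℝ => δ + aux_phi d T L (Xv z.1) (Yv z.1)) Q :=
      (integrable_const δ).add hi1
    have hi3 : Integrable (bad.indicator (fun _ => C)) Q := (integrable_const C).indicator hbad
    have hle := integral_mono (aux_phi_integrable d T hT L hL Q _ _ hX' hY') (hi2.add hi3) hpt
    simp only [Pi.add_apply] at hle
    rw [integral_add hi2 hi3, integral_add (integrable_const δ) hi1, integral_const,
      integral_indicator hbad, setIntegral_const] at hle
    have hfst : ∫ z : Ω × ℝ, aux_phi d T L (Xv z.1) (Yv z.1) ∂Q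
        = ∫ ω, aux_phi d T L (Xv ω) (Yv ω) ∂P := by
      conv_rhs => rw [← hQfst]
      rw [integral_map measurable_fst.aemeasurable]
      exact ((aux_phi_meas d T hT L hL).comp (hX.prodMk hY)).aestronglyMeasurable
    rw [hfst] at hle
    have hb : Q.real bad ≤ ∑ k, |μ.real (π ⁻¹' {k}) - ν.real (π ⁻¹' {k})| := by
      refine le_trans ?_ hη2
      have hsub : bad ⊆ ⋃ k ∈ (Finset.univ : Finset (Fin N)), E k ×ˢ (g ⁻¹' (π ⁻¹' {k})ᶜ) := by
        intro z hz
        simp only [Finset.mem_univ, iUnion_true, mem_iUnion]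
        exact ⟨π (Xv z.1), rfl, hz⟩
      refine (measureReal_mono hsub (measure_ne_top _ _)).trans
        ((measureReal_biUnion_finset_le _ _).trans ?_)
      refine Finset.sum_le_sum fun k _ => ?_
      rw [hQ _ _ (hE k) (hπ (measurableSet_singleton k)).compl, Finset.sum_eq_single k]
      · rw [inter_self, hPE, mul_comm]
      · intro j _ hj
        have : E j ∩ E k = ∅ := by
          ext ω
          simp only [E, mem_inter_iff, mem_preimage, mem_singleton_iff, mem_empty_iff_false,
            iff_false, not_and]
          intro h1 h2
          exact hj (h1.symm.trans h2)
        simp [this]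
      · simp
    have hC : 0 ≤ C := Metric.diam_nonneg
    have := mul_le_mul_of_nonneg_left hb hC
    simp only [smul_eq_mul, probReal_univ, one_mul] at hle
    nlinarith
  · refine aux_MI_le Q _ _ hX' hY' _ fun n m α β hα hβ => ?_
    refine le_trans ?_ (aux_le_MI P Xv Yv hX hY π hπ β hβ)
    refine ENNReal.ofReal_le_ofReal ?_
    have := aux_J_dp (fun k j => P.real ((fun ω => π (Xv ω)) ⁻¹' {k} ∩ (fun ω => β (Yv ω)) ⁻¹' {j}))
      (fun _ _ => measureReal_nonneg) (fun k i => (η k).real (α ⁻¹' {i}))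
      (fun _ _ => measureReal_nonneg)
      (fun k => by
        have := aux_fiber_sum (η k) α hα univ MeasurableSet.univ
        simpa using this)
    refine le_trans (le_of_eq ?_) this
    congr 1
    funext i j
    refine Eq.trans ?_ (hQ ((fun ω => β (Yv ω)) ⁻¹' {j}) (α ⁻¹' {i})
      ((hβ.comp hY) (measurableSet_singleton j)) (hα (measurableSet_singleton i)))
    congr 1
    ext z
    simp [and_comm]


theorem aux_right {X : Type*} [MetricSpace X] [CompactSpace X] [MeasurableSpace X]
    [BorelSpace X] (d : ℕ) (T : (Fin d → ℝ) → X → X) (hT : IsContAction d T) (L : ℝ) (hL : 0 < L)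
    (μ : Measure X) [IsProbabilityMeasure μ] (ε : ℝ) (hε : 0 < ε) :
    ∃ C : ℝ, ∀ t : ℝ, 0 < t → t < 1 →
      RL d T μ L ε ≤ RL d T μ L (ε + t * (ε / 2)) + ENNReal.ofReal (t * C) := by
  classical
  obtain ⟨r, hr, hunif⟩ := aux_unif d T hT L (ε / 2) (by positivity)
  obtain ⟨N, π, hπ, hdist, -⟩ := aux_partition μ r hr
  have : Nonempty X := (inferInstance : NeZero μ).1 |> fun h => by
    by_contra hne
    rw [not_nonempty_iff] at hne
    exact h (Measure.eq_zero_of_isEmpty μ)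
  let sel : Fin N → X := fun k => if h : ∃ x, π x = k then h.choose else Classical.arbitrary X
  have hsel : ∀ x, π (sel (π x)) = π x := by
    intro x
    have h : ∃ y, π y = π x := ⟨x, rfl⟩
    simp only [sel, h, dif_pos]
    exact h.choose_spec
  have hc : ∀ x, Continuous fun u => T u x := fun x =>
    hT.1.comp (by fun_prop : Continuous fun u => (u, x))
  let F : Fin N → L1Maps d L X := fun k =>
    AEEqFun.mk (fun u => T u (sel k)) (hc (sel k)).aestronglyMeasurable
  have hF : ∀ k, aux_phi d T L (sel k) (F k) = 0 := by
    intro k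
    unfold aux_phi
    rw [integral_eq_zero_of_ae, mul_zero]
    filter_upwards [AEEqFun.coeFn_mk (fun u => T u (sel k)) (hc (sel k)).aestronglyMeasurable]
      with u hu
    simp only [F, hu, dist_self, Pi.zero_apply]
  have hphi : ∀ x, aux_phi d T L x (F (π x)) ≤ ε / 2 := by
    intro x
    have := aux_phi_le d T hT L hL x (sel (π x)) (F (π x)) (ε / 2)
      (hunif _ _ (hdist _ _ (hsel x).symm))
    rw [hF, add_zero] at this
    exact this
  refine ⟨-∑ k, μ.real (π ⁻¹' {k}) * Real.logb 2 (μ.real (π ⁻¹' {k})), fun t ht0 ht1 => ?_⟩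
  set C := -∑ k, μ.real (π ⁻¹' {k}) * Real.logb 2 (μ.real (π ⁻¹' {k})) with hC
  rw [← tsub_le_iff_right]
  refine le_iInf fun Ω => le_iInf fun mΩ => le_iInf fun P => le_iInf fun hP => le_iInf fun Xv =>
    le_iInf fun Yv => le_iInf fun hX => le_iInf fun hY => le_iInf fun hμ => le_iInf fun hD => ?_
  rw [tsub_le_iff_right]
  let Y0 : Ω → L1Maps d L X := fun ω => F (π (Xv ω))
  have hY0 : Measurable Y0 := (measurable_of_finite F).comp (hπ.comp hX)
  let Q : Measure (Ω ⊕ Ω) :=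
    ENNReal.ofReal (1 - t) • P.map Sum.inl + ENNReal.ofReal t • P.map Sum.inr
  have hQ : ∀ S, MeasurableSet S →
      Q.real S = (1 - t) * P.real (Sum.inl ⁻¹' S) + t * P.real (Sum.inr ⁻¹' S) := by
    intro S hS
    simp only [Q, Measure.real, Measure.add_apply, Measure.smul_apply, smul_eq_mul,
      Measure.map_apply measurable_inl hS, Measure.map_apply measurable_inr hS]
    rw [ENNReal.toReal_add (ENNReal.mul_ne_top ENNReal.ofReal_ne_top (measure_ne_top _ _))
      (ENNReal.mul_ne_top ENNReal.ofReal_ne_top (measure_ne_top _ _)), ENNReal.toReal_mul,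
      ENNReal.toReal_mul, ENNReal.toReal_ofReal (by linarith), ENNReal.toReal_ofReal ht0.le]
  have hQp : IsProbabilityMeasure Q := by
    constructor
    simp only [Q, Measure.add_apply, Measure.smul_apply, smul_eq_mul,
      Measure.map_apply measurable_inl MeasurableSet.univ,
      Measure.map_apply measurable_inr MeasurableSet.univ, preimage_univ, measure_univ, mul_one]
    rw [← ENNReal.ofReal_add (by linarith) ht0.le]
    simp
  have hX' : Measurable (Sum.elim Xv Xv) := hX.sumElim hX
  have hY' : Measurable (Sum.elim Yv Y0) := hY.sumElim hY0
  have hlaw : Q.map (Sum.elim Xv Xv) = μ := by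
    refine Measure.ext fun S hS => ?_
    rw [← measureReal_eq_measureReal_iff, map_measureReal_apply hX' hS, hQ _ (hX' hS),
      ← preimage_comp, ← preimage_comp, Sum.elim_comp_inl, Sum.elim_comp_inr, ← hμ,
      map_measureReal_apply hX hS]
    ring
  refine (aux_RL_le d T μ L ε (Ω ⊕ Ω) Q _ _ hX' hY' hlaw ?_).trans ?_
  · change ∫ z, aux_phi d T L (Sum.elim Xv Xv z) (Sum.elim Yv Y0 z) ∂Q < ε
    have hD' : ∫ ω, aux_phi d T L (Xv ω) (Yv ω) ∂P < ε + t * (ε / 2) := hD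
    have hm : Measurable fun z => aux_phi d T L (Sum.elim Xv Xv z) (Sum.elim Yv Y0 z) :=
      (aux_phi_meas d T hT L hL).comp (hX'.prodMk hY')
    have hp1 : IsProbabilityMeasure (P.map (Sum.inl : Ω → Ω ⊕ Ω)) :=
      Measure.isProbabilityMeasure_map measurable_inl.aemeasurable
    have hp2 : IsProbabilityMeasure (P.map (Sum.inr : Ω → Ω ⊕ Ω)) :=
      Measure.isProbabilityMeasure_map measurable_inr.aemeasurable
    rw [integral_add_measure
      ((aux_phi_integrable d T hT L hL _ _ _ hX' hY').smul_measure ENNReal.ofReal_ne_top)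
      ((aux_phi_integrable d T hT L hL _ _ _ hX' hY').smul_measure ENNReal.ofReal_ne_top),
      integral_smul_measure, integral_smul_measure,
      integral_map measurable_inl.aemeasurable hm.aestronglyMeasurable,
      integral_map measurable_inr.aemeasurable hm.aestronglyMeasurable,
      ENNReal.toReal_ofReal (by linarith), ENNReal.toReal_ofReal ht0.le]
    simp only [Sum.elim_inl, Sum.elim_inr, smul_eq_mul]
    have h2 : ∫ ω, aux_phi d T L (Xv ω) (Y0 ω) ∂P ≤ ε / 2 := by
      have := integral_mono (aux_phi_integrable d T hT L hL P Xv Y0 hX hY0)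
        (integrable_const (ε / 2)) (fun ω => hphi (Xv ω))
      simpa using this
    have h3 := mul_lt_mul_of_pos_left hD' (sub_pos.2 ht1)
    have h4 := mul_le_mul_of_nonneg_left h2 ht0.le
    nlinarith [mul_pos (mul_pos ht0 ht0) hε]
  · refine aux_MI_le Q _ _ hX' hY' _ fun n m α β hα hβ => ?_
    set p : Fin n → Fin m → ℝ := fun i j =>
      P.real ((fun ω => α (Xv ω)) ⁻¹' {i} ∩ (fun ω => β (Yv ω)) ⁻¹' {j}) with hp
    set q : Fin n → Fin m → ℝ := fun i j =>
      P.real ((fun ω => α (Xv ω)) ⁻¹' {i} ∩ (fun ω => β (Y0 ω)) ⁻¹' {j}) with hq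
    have hαi : ∀ i, MeasurableSet ((fun ω => α (Xv ω)) ⁻¹' {i}) := fun i =>
      (hα.comp hX) (measurableSet_singleton i)
    have hrow : ∀ i, ∑ j, p i j = ∑ j, q i j := by
      intro i
      have h1 := aux_fiber_sum P (fun ω => β (Yv ω)) (hβ.comp hY) _ (hαi i)
      have h2 := aux_fiber_sum P (fun ω => β (Y0 ω)) (hβ.comp hY0) _ (hαi i)
      simp only [hp, hq, inter_comm _ ((fun ω => β (Yv ω)) ⁻¹' _),
        inter_comm _ ((fun ω => β (Y0 ω)) ⁻¹' _)]
      exact h1.trans h2.symm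
    have hJ : aux_J (fun i j => Q.real ((fun z => α (Sum.elim Xv Xv z)) ⁻¹' {i} ∩
        (fun z => β (Sum.elim Yv Y0 z)) ⁻¹' {j})) = aux_J fun i j => (1 - t) * p i j + t * q i j := by
      congr 1
      funext i j
      exact hQ _ (((hα.comp hX') (measurableSet_singleton i)).inter
        ((hβ.comp hY') (measurableSet_singleton j)))
    rw [hJ]
    have hconv := aux_J_convex p q (fun _ _ => measureReal_nonneg) (fun _ _ => measureReal_nonneg)
      hrow (1 - t) t (by linarith) ht0.le (by ring)
    have hqC : aux_J q ≤ C := by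
      set w : Fin n → Fin N → ℝ := fun i k =>
        P.real ((fun ω => α (Xv ω)) ⁻¹' {i} ∩ (fun ω => π (Xv ω)) ⁻¹' {k}) with hw
      have hdp := aux_J_dp (fun k i => w i k) (fun _ _ => measureReal_nonneg)
        (fun k j => if β (F k) = j then (1 : ℝ) else 0) (fun k j => by positivity)
        (fun k => by simp)
      rw [aux_J_symm w] at hdp
      have hq' : (fun (j : Fin m) (i : Fin n) => ∑ k, (if β (F k) = j then (1 : ℝ) else 0) * w i k)
          = fun j i => q i j := by
        funext j i
        have := aux_fiber_sum P (fun ω => π (Xv ω)) (hπ.comp hX)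
          ((fun ω => α (Xv ω)) ⁻¹' {i} ∩ (fun ω => β (Y0 ω)) ⁻¹' {j})
          ((hαi i).inter ((hβ.comp hY0) (measurableSet_singleton j)))
        simp only [hq]
        rw [← this]
        refine Finset.sum_congr rfl fun k _ => ?_
        split_ifs with h
        · rw [one_mul]
          simp only [hw]
          congr 1
          ext ω
          simp only [mem_inter_iff, mem_preimage, mem_singleton_iff, Y0]
          constructor
          · rintro ⟨h1, h2⟩
            exact ⟨h2, h1, by rw [h2, h]⟩
          · rintro ⟨h1, h2, _⟩
            exact ⟨h2, h1⟩
        · rw [zero_mul]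
          symm
          convert measureReal_empty (μ := P)
          ext ω
          simp only [mem_inter_iff, mem_preimage, mem_singleton_iff, Y0, mem_empty_iff_false,
            iff_false]
          rintro ⟨h1, _, h3⟩
          rw [h1] at h3
          exact h h3
      rw [hq', aux_J_symm q] at hdp
      refine hdp.trans ((aux_J_le w (fun _ _ => measureReal_nonneg)).trans (le_of_eq ?_))
      have hcol : ∀ k, ∑ i, w i k = μ.real (π ⁻¹' {k}) := by
        intro k
        rw [← hμ, map_measureReal_apply hX (hπ (measurableSet_singleton k))]
        exact aux_fiber_sum P (fun ω => α (Xv ω)) (hα.comp hX) _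
          ((hπ.comp hX) (measurableSet_singleton k))
      simp only [hcol, hC]
    have hMI := aux_le_MI P Xv Yv hX hY α hα β hβ
    calc _ ≤ ENNReal.ofReal ((1 - t) * aux_J p + t * C) := by
          refine ENNReal.ofReal_le_ofReal (hconv.trans ?_)
          gcongr
      _ ≤ ENNReal.ofReal ((1 - t) * aux_J p) + ENNReal.ofReal (t * C) := ENNReal.ofReal_add_le
      _ ≤ _ := by
          gcongr
          rw [ENNReal.ofReal_mul (by linarith)]
          calc _ ≤ 1 * ENNReal.ofReal (aux_J p) := by
                gcongr
                rw [← ENNReal.ofReal_one]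
                exact ENNReal.ofReal_le_ofReal (by linarith)
            _ ≤ _ := by rw [one_mul]; exact hMI

theorem aux_RL_anti {X : Type*} [MetricSpace X] [MeasurableSpace X] (d : ℕ)
    (T : (Fin d → ℝ) → X → X) (μ : Measure X) (L : ℝ) : Antitone (RL d T μ L) := by
  intro a b hab
  refine le_iInf fun Ω => le_iInf fun mΩ => le_iInf fun P => le_iInf fun hP => le_iInf fun Xv =>
    le_iInf fun Yv => le_iInf fun hX => le_iInf fun hY => le_iInf fun hμ => le_iInf fun hD => ?_
  exact aux_RL_le d T μ L b Ω P Xv Yv hX hY hμ (hD.trans_le hab)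

theorem aux_RL_left {X : Type*} [MetricSpace X] [MeasurableSpace X] (d : ℕ)
    (T : (Fin d → ℝ) → X → X) (μ : Measure X) (L ε : ℝ) (b : ℝ≥0∞) (h : RL d T μ L ε < b) :
    ∃ ε' < ε, RL d T μ L ε' < b := by
  simp only [RL, iInf_lt_iff] at h
  obtain ⟨Ω, mΩ, P, hP, Xv, Yv, hX, hY, hμ, hD, hb⟩ := h
  obtain ⟨e, h1, h2⟩ := exists_between hD
  exact ⟨e, h2, (aux_RL_le d T μ L e Ω P Xv Yv hX hY hμ h1).trans_lt hb⟩

theorem aux_RL_right {X : Type*} [MetricSpace X] [CompactSpace X] [MeasurableSpace X]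
    [BorelSpace X] (d : ℕ) (T : (Fin d → ℝ) → X → X) (hT : IsContAction d T) (L : ℝ) (hL : 0 < L)
    (μ : Measure X) [IsProbabilityMeasure μ] (ε : ℝ) (hε : 0 < ε) (a : ℝ≥0∞)
    (h : a < RL d T μ L ε) : ∃ ε' > ε, a < RL d T μ L ε' := by
  by_contra hcon
  push Not at hcon
  obtain ⟨C, hC⟩ := aux_right d T hT L hL μ ε hε
  have hlim : Tendsto (fun t : ℝ => a + ENNReal.ofReal (t * C)) (𝓝[>] 0) (𝓝 (a + 0)) := by
    refine Tendsto.const_add a ?_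
    have : Continuous fun t : ℝ => ENNReal.ofReal (t * C) :=
      ENNReal.continuous_ofReal.comp (by fun_prop)
    have := this.tendsto 0
    simp only [zero_mul, ENNReal.ofReal_zero] at this
    exact this.mono_left nhdsWithin_le_nhds
  rw [add_zero] at hlim
  refine absurd (ge_of_tendsto hlim ?_) (not_le.2 h)
  filter_upwards [Ioo_mem_nhdsGT (zero_lt_one' ℝ)] with t ht
  refine (hC t ht.1 ht.2).trans ?_
  gcongr
  refine hcon _ ?_
  have := mul_pos ht.1 (half_pos hε)
  linarith

theorem aux_close {X : Type*} [MetricSpace X] [CompactSpace X] [MeasurableSpace X]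
    [BorelSpace X] (d : ℕ) (T : (Fin d → ℝ) → X → X) (hT : IsContAction d T) (L : ℝ) (hL : 0 < L)
    (μs : ℕ → ProbabilityMeasure X) (μ : ProbabilityMeasure X)
    (hw : Tendsto μs atTop (𝓝 μ)) (δ : ℝ) (hδ : 0 < δ) :
    ∀ᶠ n in atTop, ∀ e, RL d T (μs n : Measure X) L (e + δ) ≤ RL d T (μ : Measure X) L e ∧
      RL d T (μ : Measure X) L (e + δ) ≤ RL d T (μs n : Measure X) L e := by
  obtain ⟨r, hr, hunif⟩ := aux_unif d T hT L (δ / 2) (by positivity)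
  obtain ⟨N, π, hπ, hdist, hnull⟩ := aux_partition (μ : Measure X) r hr
  have h1 : ∀ k, Tendsto (fun n => (μs n : Measure X).real (π ⁻¹' {k})) atTop
      (𝓝 ((μ : Measure X).real (π ⁻¹' {k}))) := by
    intro k
    exact (ENNReal.tendsto_toReal (measure_ne_top _ _)).comp
      (ProbabilityMeasure.tendsto_measure_of_null_frontier_of_tendsto' hw (hnull k))
  have h2 : Tendsto (fun n => Metric.diam (univ : Set X) *
      ∑ k, |(μs n : Measure X).real (π ⁻¹' {k}) - (μ : Measure X).real (π ⁻¹' {k})|) atTop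
      (𝓝 (Metric.diam (univ : Set X) *
      ∑ k, |(μ : Measure X).real (π ⁻¹' {k}) - (μ : Measure X).real (π ⁻¹' {k})|)) :=
    Tendsto.const_mul _ (tendsto_finsetSum _ fun k _ => ((h1 k).sub_const _).abs)
  simp only [sub_self, abs_zero, Finset.sum_const_zero, mul_zero] at h2
  filter_upwards [h2.eventually_lt_const (half_pos hδ)] with n hn e
  have hd : ∀ x y, π x = π y → ∀ u ∈ unitBox d L, dist (T u x) (T u y) ≤ δ / 2 :=
    fun x y hxy => hunif x y (hdist x y hxy)
  constructor
  · refine aux_transport d T hT L hL _ _ π hπ (δ / 2) (by positivity) hd e (e + δ) ?_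
    simp only [abs_sub_comm ((μ : Measure X).real _)]
    linarith
  · refine aux_transport d T hT L hL _ _ π hπ (δ / 2) (by positivity) hd e (e + δ) ?_
    linarith

/-- Lemma 3.3: `R_L(𝐝, μ, ε)` is jointly continuous in `(μ, ε)` along sequences, with respect
to the weak* topology on invariant probability measures. -/
theorem RL_tendsto_of_tendsto
    {X : Type*} [MetricSpace X] [CompactSpace X] [MeasurableSpace X] [BorelSpace X]
    (d : ℕ) (hd : 0 < d) (T : (Fin d → ℝ) → X → X) (hT : IsContAction d T)
    (L : ℝ) (hL : 0 < L)
    (μs : ℕ → ProbabilityMeasure X) (hμs : ∀ n, MeasInvariant d T (μs n : Measure X))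
    (μ : ProbabilityMeasure X) (hμ : MeasInvariant d T (μ : Measure X))
    (hw : Filter.Tendsto μs Filter.atTop (nhds μ))
    (εs : ℕ → ℝ) (hεs : ∀ n, 0 < εs n) (ε : ℝ) (hε : 0 < ε)
    (hεw : Filter.Tendsto εs Filter.atTop (nhds ε)) :
    Filter.Tendsto (fun n => RL d T (μs n : Measure X) L (εs n)) Filter.atTop
      (nhds (RL d T (μ : Measure X) L ε)) := by
  rw [tendsto_order]
  constructor
  · intro a ha
    obtain ⟨ε', h1, h2⟩ := aux_RL_right d T hT L hL (μ : Measure X) ε hε a ha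
    have hδ : 0 < (ε' - ε) / 2 := by linarith
    filter_upwards [aux_close d T hT L hL μs μ hw _ hδ,
      hεw.eventually_lt_const (show ε < ε + (ε' - ε) / 2 by linarith)] with n hn hn'
    refine h2.trans_le (le_trans ?_ (hn (εs n)).2)
    exact aux_RL_anti d T _ L (by linarith)
  · intro b hb
    obtain ⟨ε', h1, h2⟩ := aux_RL_left d T (μ : Measure X) L ε b hb
    have hδ : 0 < (ε - ε') / 2 := by linarith
    filter_upwards [aux_close d T hT L hL μs μ hw _ hδ,
      hεw.eventually_const_lt (show ε' + (ε - ε') / 2 < ε by linarith)] with n hn hn'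
    refine lt_of_le_of_lt (le_trans ?_ (hn ε').1) h2
    exact aux_RL_anti d T _ L (by linarith)
end
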